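/- Let Ω ⊆ ℝ² be a bounded, simply connected domain. Then the following are equivalent: (a) Ω is a John domain; (b) Ω supports a (2p/(2−ps), p)_s-Hajłasz–Sobolev–Poincaré imbedding for all s ∈ (0,1] and all p ∈ (2/(2+s), 2/s); (c) Ω supports a (2p/(2−ps), p)_s-Hajłasz–Sobolev–Poincaré imbedding for some s ∈ (0,1] and some p ∈ (2/(2+s), 2/s). -/

import Mathlib

open MeasureTheory Metric Set
open scoped ENNReal

noncomputable section

/-- Euclidean space `ℝⁿ`. -/
abbrev Eu (n : ℕ) : Type := EuclideanSpace ℝ (Fin n)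

/-- A domain: a nonempty open connected subset. -/
def IsDomainEu {n : ℕ} (Ω : Set (Eu n)) : Prop := IsOpen Ω ∧ IsConnected Ω

/-- The Hajłasz gradient class `𝒟^{s,ρ}_ball(u)` on `Ω`: nonnegative measurable `g` such that
`|u x - u y| ≤ |x-y|^s (g x + g y)` for all `x, y ∈ Ω` off a null set with
`|x - y| < ρ · dist(x, ∂Ω)`. -/
def DBall {n : ℕ} (Ω : Set (Eu n)) (s ρ : ℝ) (u : Eu n → ℝ) : Set (Eu n → ℝ) :=
  {g | Measurable g ∧ (∀ x, 0 ≤ g x) ∧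
    ∃ N : Set (Eu n), N ⊆ Ω ∧ volume N = 0 ∧
      ∀ x ∈ Ω \ N, ∀ y ∈ Ω \ N,
        edist x y < ENNReal.ofReal ρ * EMetric.infEdist x Ωᶜ →
        |u x - u y| ≤ dist x y ^ s * (g x + g y)}

/-- The full Hajłasz gradient class `𝒟^s(u)` on `U`. -/
def DFull {n : ℕ} (U : Set (Eu n)) (s : ℝ) (u : Eu n → ℝ) : Set (Eu n → ℝ) :=
  {g | Measurable g ∧ (∀ x, 0 ≤ g x) ∧
    ∃ N : Set (Eu n), N ⊆ U ∧ volume N = 0 ∧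
      ∀ x ∈ U \ N, ∀ y ∈ U \ N, |u x - u y| ≤ dist x y ^ s * (g x + g y)}

/-- `inf_{g ∈ 𝒟^{s,ρ}_ball(u)} ‖g‖_{L^p(Ω)}`. -/
def ballNormRho {n : ℕ} (Ω : Set (Eu n)) (s p ρ : ℝ) (u : Eu n → ℝ) : ℝ≥0∞ :=
  ⨅ g ∈ DBall Ω s ρ u, eLpNorm g (ENNReal.ofReal p) (volume.restrict Ω)

/-- The `Ṁ^{s,p}_ball(Ω)` seminorm (with `ρ = 1/2`). -/
def ballNorm {n : ℕ} (Ω : Set (Eu n)) (s p : ℝ) (u : Eu n → ℝ) : ℝ≥0∞ :=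
  ballNormRho Ω s p (1/2) u

/-- The `Ṁ^{s,p}(U)` seminorm. -/
def fullNorm {n : ℕ} (U : Set (Eu n)) (s p : ℝ) (u : Eu n → ℝ) : ℝ≥0∞ :=
  ⨅ g ∈ DFull U s u, eLpNorm g (ENNReal.ofReal p) (volume.restrict U)

/-- Membership in `Ṁ^{s,p}_ball(Ω)`. -/
def MemMball {n : ℕ} (Ω : Set (Eu n)) (s p : ℝ) (u : Eu n → ℝ) : Prop :=
  Measurable u ∧ ballNorm Ω s p u < ⊤

/-- Membership in `Ṁ^{s,p}(U)`. -/
def MemMfull {n : ℕ} (U : Set (Eu n)) (s p : ℝ) (u : Eu n → ℝ) : Prop :=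
  Measurable u ∧ fullNorm U s p u < ⊤

/-- `Ω` supports a `(pn/(n-ps), p)_s`-Hajłasz–Sobolev–Poincaré imbedding. -/
def SupportsHSP {n : ℕ} (Ω : Set (Eu n)) (s p : ℝ) : Prop :=
  ∃ C : ℝ, 0 < C ∧ ∀ u : Eu n → ℝ, MemMball Ω s p u →
    eLpNorm (fun x => u x - ⨍ y in Ω, u y)
        (ENNReal.ofReal (p * n / (n - p * s))) (volume.restrict Ω)
      ≤ ENNReal.ofReal C * ballNorm Ω s p u

/-- LLC(2) with constant `b`: points of `Ω \ B(z,r)` lie in the same connected component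
of `Ω \ B(z, br)`. -/
def LLC2With {n : ℕ} (Ω : Set (Eu n)) (b : ℝ) : Prop :=
  ∀ (z : Eu n) (r : ℝ), 0 < r →
    ∀ x ∈ Ω \ ball z r, ∀ y ∈ Ω \ ball z r,
      y ∈ connectedComponentIn (Ω \ ball z (b * r)) x

/-- The LLC(2) property. -/
def LLC2 {n : ℕ} (Ω : Set (Eu n)) : Prop :=
  ∃ b : ℝ, b ∈ Set.Ioo (0:ℝ) 1 ∧ LLC2With Ω b

/-- `Ω` is an `Ṁ^{s,p}_ball`-extension domain. -/
def IsMballExtensionDomain {n : ℕ} (Ω : Set (Eu n)) (s p : ℝ) : Prop :=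
  ∃ C : ℝ, 0 < C ∧ ∀ u : Eu n → ℝ, MemMball Ω s p u →
    ∃ v : Eu n → ℝ, MemMball (Set.univ) s p v ∧ (∀ x ∈ Ω, v x = u x) ∧
      ballNorm (Set.univ) s p v ≤ ENNReal.ofReal C * ballNorm Ω s p u

/-- `Ω` is a John domain: there are `x₀ ∈ Ω` and `C > 0` such that every `x ∈ Ω` is joined to
`x₀` by a curve parametrized by arclength (here: `1`-Lipschitz) with
`dist(γ t, Ωᶜ) ≥ C t`. -/
def IsJohnDomain {n : ℕ} (Ω : Set (Eu n)) : Prop :=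
  ∃ x₀ ∈ Ω, ∃ C : ℝ, 0 < C ∧ ∀ x ∈ Ω, ∃ ℓ : ℝ, 0 ≤ ℓ ∧ ∃ γ : ℝ → Eu n,
    LipschitzOnWith 1 γ (Set.Icc 0 ℓ) ∧ γ 0 = x ∧ γ ℓ = x₀ ∧
    ∀ t ∈ Set.Icc (0:ℝ) ℓ, γ t ∈ Ω ∧ C * t ≤ infDist (γ t) Ωᶜ

/-- Quasihyperbolic distance: infimum over arclength-parametrized (`1`-Lipschitz) curves in `Ω`
joining `x` to `y` of `∫ dist(γ t, Ωᶜ)⁻¹ dt`. -/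
def qhDist {n : ℕ} (Ω : Set (Eu n)) (x y : Eu n) : ℝ :=
  sInf { k : ℝ | ∃ ℓ : ℝ, 0 ≤ ℓ ∧ ∃ γ : ℝ → Eu n,
    LipschitzOnWith 1 γ (Set.Icc 0 ℓ) ∧ γ 0 = x ∧ γ ℓ = y ∧
    (∀ t ∈ Set.Icc (0:ℝ) ℓ, γ t ∈ Ω) ∧
    k = ∫ t in (0:ℝ)..ℓ, (infDist (γ t) Ωᶜ)⁻¹ }

/-- Weak carrot domain (quasihyperbolic boundary condition). -/
def IsWeakCarrot {n : ℕ} (Ω : Set (Eu n)) : Prop :=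
  ∃ x₀ ∈ Ω, ∃ C : ℝ, 1 ≤ C ∧ ∀ x ∈ Ω,
    qhDist Ω x x₀ ≤ C * Real.log (C / infDist x Ωᶜ)

/-- The Luxemburg norm `‖u‖_{φ_s(L)(Ω)}` with `φ_s(t) = exp(t^{n/(n-s)}) - 1`
(value `⊤` when no admissible `t` exists). -/
def phiLux {n : ℕ} (Ω : Set (Eu n)) (s : ℝ) (u : Eu n → ℝ) : ℝ≥0∞ :=
  sInf (ENNReal.ofReal '' { t : ℝ | 0 < t ∧
    (∫⁻ x in Ω, ENNReal.ofReal
        (Real.exp ((|u x| / t) ^ ((n : ℝ) / ((n : ℝ) - s))) - 1)) ≤ 1 })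

/-- `Ω` supports an `s`-Hajłasz–Trudinger imbedding. -/
def SupportsHT {n : ℕ} (Ω : Set (Eu n)) (s : ℝ) : Prop :=
  ∃ C : ℝ, 0 < C ∧ ∀ u : Eu n → ℝ, MemMball Ω s ((n : ℝ) / s) u →
    phiLux Ω s (fun x => u x - ⨍ y in Ω, u y)
      ≤ ENNReal.ofReal C * ballNorm Ω s ((n : ℝ) / s) u

/-- The separation property with respect to `x₀` and `C`. -/
def SeparationProperty {n : ℕ} (Ω : Set (Eu n)) (x₀ : Eu n) (C : ℝ) : Prop :=
  ∀ x ∈ Ω, ∃ γ : ℝ → Eu n, ContinuousOn γ (Set.Icc 0 1) ∧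
    (∀ t ∈ Set.Icc (0:ℝ) 1, γ t ∈ Ω) ∧ γ 0 = x ∧ γ 1 = x₀ ∧
    ∀ t ∈ Set.Ioc (0:ℝ) 1,
      γ '' Set.Icc 0 t ⊆ ball (γ t) (C * infDist (γ t) Ωᶜ) ∨
      ∀ y ∈ γ '' Set.Icc 0 t \ ball (γ t) (C * infDist (γ t) Ωᶜ),
        connectedComponentIn (Ω \ sphere (γ t) (C * infDist (γ t) Ωᶜ)) y ≠
          connectedComponentIn (Ω \ sphere (γ t) (C * infDist (γ t) Ωᶜ)) x₀

/-- The slice property with constant `C`. Lengths of curve portions are measured via the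
Lebesgue measure of parameter preimages of arclength (`1`-Lipschitz) parametrizations. -/
def SliceProperty {n : ℕ} (Ω : Set (Eu n)) (C : ℝ) : Prop :=
  ∀ x ∈ Ω, ∀ y ∈ Ω, ∃ (j : ℕ) (S : ℕ → Set (Eu n)) (L : ℝ) (γ : ℝ → Eu n),
    0 ≤ L ∧ LipschitzOnWith 1 γ (Set.Icc 0 L) ∧ γ 0 = x ∧ γ L = y ∧
    (∀ t ∈ Set.Icc (0:ℝ) L, γ t ∈ Ω) ∧
    (∀ i ≤ j, IsOpen (S i) ∧ S i ⊆ Ω) ∧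
    (∀ i ≤ j, ∀ k ≤ j, i ≠ k → Disjoint (S i) (S k)) ∧
    x ∈ S 0 ∧ y ∈ S j ∧
    (∀ i, 0 < i → i < j →
      connectedComponentIn (Ω \ closure (S i)) x ≠
        connectedComponentIn (Ω \ closure (S i)) y) ∧
    (∀ (LF : ℝ) (F : ℝ → Eu n), 0 ≤ LF → LipschitzOnWith 1 F (Set.Icc 0 LF) →
      F '' Set.Icc 0 LF ⊆ Ω → (∃ t ∈ Set.Icc (0:ℝ) LF, F t = x) →
      (∃ t ∈ Set.Icc (0:ℝ) LF, F t = y) →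
      ∀ i, 0 < i → i < j →
        Metric.diam (S i) ≤ C * (volume {t : ℝ | t ∈ Set.Icc (0:ℝ) LF ∧ F t ∈ S i}).toReal) ∧
    (∀ t ∈ Set.Icc (0:ℝ) L,
      ball (γ t) (C⁻¹ * infDist (γ t) Ωᶜ) ⊆ ⋃ i ∈ Finset.range (j + 1), S i) ∧
    (∀ i ≤ j, ∀ z ∈ γ '' Set.Icc (0:ℝ) L ∩ S i, Metric.diam (S i) ≤ C * infDist z Ωᶜ) ∧
    (∃ xi : ℕ → Eu n, xi 0 = x ∧ xi j = y ∧
      ∀ i ≤ j, xi i ∈ S i ∧ ball (xi i) (C⁻¹ * infDist (xi i) Ωᶜ) ⊆ S i)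

/-- `v : Ω → ℝⁿ` is a distributional gradient of `u` on `U`. -/
def HasDistribGradOn {n : ℕ} (U : Set (Eu n)) (u : Eu n → ℝ) (v : Eu n → Eu n) : Prop :=
  ∀ φ : Eu n → ℝ, ContDiff ℝ (⊤ : ℕ∞) φ → HasCompactSupport φ → tsupport φ ⊆ U →
    ∀ i : Fin n,
      ∫ x in U, u x * fderiv ℝ φ x (EuclideanSpace.single i 1) = - ∫ x in U, v x i * φ x

/-- `u ∈ Ẇ^{1,p}(U)` with distributional gradient `v ∈ L^p(U;ℝⁿ)`. -/
def MemW1p {n : ℕ} (U : Set (Eu n)) (p : ℝ) (u : Eu n → ℝ) (v : Eu n → Eu n) : Prop :=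
  LocallyIntegrableOn u U volume ∧ AEMeasurable v (volume.restrict U) ∧
    eLpNorm v (ENNReal.ofReal p) (volume.restrict U) < ⊤ ∧ HasDistribGradOn U u v

/-- `Ω` is a `Ẇ^{1,p}`-extension domain. -/
def IsW1pExtensionDomain {n : ℕ} (Ω : Set (Eu n)) (p : ℝ) : Prop :=
  ∃ C : ℝ, 0 < C ∧ ∀ u v, MemW1p Ω p u v →
    ∃ u' v', MemW1p (Set.univ) p u' v' ∧ (∀ᵐ x ∂(volume.restrict Ω), u' x = u x) ∧
      eLpNorm v' (ENNReal.ofReal p) volume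
        ≤ ENNReal.ofReal C * eLpNorm v (ENNReal.ofReal p) (volume.restrict Ω)

/-- The (uncentered over radii, centered) Hardy–Littlewood maximal function, `ℝ≥0∞`-valued. -/
def HLMax {n : ℕ} (g : Eu n → ℝ) (y : Eu n) : ℝ≥0∞ :=
  ⨆ (t : ℝ) (_ : 0 < t), (volume (ball y t))⁻¹ * ∫⁻ z in ball y t, ENNReal.ofReal |g z|

open scoped unitInterval



theorem exp_lift_homotopy {A : Type*} [TopologicalSpace A] (H : C(I × A, ℂ))
    (hne : ∀ q, H q ≠ 0) (h0 : ∀ a, H (0, a) = 1) :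
    ∃ L : C(I × A, ℂ), (∀ q, Complex.exp (L q) = H q) ∧ ∀ a, L (0, a) = 0 := by
  have cov := Complex.isCoveringMap_exp
  let H' : C(I × A, {z : ℂ // z ≠ 0}) := ⟨fun q => ⟨H q, hne q⟩, by fun_prop⟩
  have H0 : ∀ a, H' (0, a) = (fun z : ℂ ↦ (⟨_, z.exp_ne_zero⟩ : {z : ℂ // z ≠ 0}))
      ((ContinuousMap.const A (0:ℂ)) a) := by
    intro a; apply Subtype.ext; simp [H', h0]
  refine ⟨cov.liftHomotopy H' (ContinuousMap.const A 0) H0, ?_, ?_⟩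
  · intro q
    have := congr_fun (cov.liftHomotopy_lifts H' (ContinuousMap.const A 0) H0) q
    exact congr_arg Subtype.val this
  · intro a
    exact cov.liftHomotopy_zero H' (ContinuousMap.const A 0) H0 a

theorem exp_log_unique {A : Type*} [TopologicalSpace A] {S : Set A} (hS : IsPreconnected S)
    {F G : A → ℂ} (hF : ContinuousOn F S) (hG : ContinuousOn G S)
    (h : ∀ a ∈ S, Complex.exp (F a) = Complex.exp (G a)) {a : A} (ha : a ∈ S) (hFG : F a = G a) :
    ∀ b ∈ S, F b = G b := by
  have cov := Complex.isCoveringMap_exp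
  exact cov.eqOn_of_comp_eqOn hS hF hG (fun a ha => Subtype.ext (h a ha)) ha hFG

theorem exp_lift_sc {A : Type*} [TopologicalSpace A] [SimplyConnectedSpace A]
    [LocallyPathConnectedSpace A] (f : C(A, ℂ)) (hne : ∀ a, f a ≠ 0) :
    ∃ L : C(A, ℂ), ∀ a, Complex.exp (L a) = f a := by
  have cov := Complex.isCoveringMap_exp
  obtain ⟨a0⟩ : Nonempty A := inferInstance
  let f' : C(A, {z : ℂ // z ≠ 0}) := ⟨fun q => ⟨f q, hne q⟩, by fun_prop⟩
  obtain ⟨L, hL, -⟩ := cov.existsUnique_continuousMap_lifts f' a0 (Complex.log (f a0))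
    (Subtype.ext (Complex.exp_log (hne a0)))
  exact ⟨L, fun a => congr_arg Subtype.val (congr_fun hL.2 a)⟩

/-- identification of the plane with `ℂ`. -/
def toC : Eu 2 ≃ₗᵢ[ℝ] ℂ := Complex.orthonormalBasisOneI.repr.symm

theorem toC_sub_ne {a b : Eu 2} (h : a ≠ b) : toC a - toC b ≠ 0 :=
  sub_ne_zero.2 (fun h' => h (toC.injective h'))

/-- logs along paths. -/
theorem path_log (Ω : Set (Eu 2)) (hΩ : IsOpen Ω) (hsc : SimplyConnectedSpace Ω)
    {x x0 : Eu 2} (hx : x ∈ Ω) (hx0 : x0 ∈ Ω) :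
    ∃ f : Eu 2 → ℂ, ∀ K : Set (Eu 2), JoinedIn (Ω \ K) x0 x →
      ∃ L : Eu 2 → ℂ, ∃ U : Set (Eu 2), IsOpen U ∧ Ωᶜ ⊆ U ∧ K ⊆ U ∧ ContinuousOn L U ∧
        (∀ z ∈ U, z ≠ x0 ∧ Complex.exp (L z) = (toC z - toC x) / (toC z - toC x0)) ∧
        ∀ z ∈ Ωᶜ, L z = f z := by
  haveI : LocallyPathConnectedSpace Ω := hΩ.locallyPathConnectedSpace
  have key : ∀ z : Eu 2, ∃ ℓ : Ω → ℂ, z ∉ Ω → Continuous ℓ ∧ ℓ ⟨x0, hx0⟩ = 0 ∧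
      ∀ y : Ω, Complex.exp (ℓ y) = (toC z - toC y) / (toC z - toC x0) := by
    intro z
    by_cases hz : z ∈ Ω
    · exact ⟨fun _ => 0, fun h => absurd hz h⟩
    have hne : ∀ y : Ω, toC z - toC y ≠ 0 := fun y => toC_sub_ne (fun h => hz (h ▸ y.2))
    have hne0 : toC z - toC x0 ≠ 0 := hne ⟨x0, hx0⟩
    obtain ⟨L, hL⟩ := exp_lift_sc (A := Ω)
      ⟨fun y => (toC z - toC y) / (toC z - toC x0), by
        have := toC.continuous; fun_prop⟩ (fun y => div_ne_zero (hne y) hne0)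
    refine ⟨fun y => L y - L ⟨x0, hx0⟩, fun _ => ⟨by fun_prop, by simp, fun y => ?_⟩⟩
    rw [Complex.exp_sub, hL, hL]
    simp [div_self hne0]
  choose ℓ hℓ using key
  refine ⟨fun z => ℓ z ⟨x, hx⟩, fun K hK => ?_⟩
  obtain ⟨γ, hγ⟩ := hK
  have hcomp : IsCompact (range γ) := isCompact_range γ.continuous
  let U : Set (Eu 2) := (range γ)ᶜ
  have hUo : IsOpen U := hcomp.isClosed.isOpen_compl
  have hneU : ∀ z ∈ U, ∀ t, toC z - toC (γ t) ≠ 0 :=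
    fun z hz t => toC_sub_ne (fun h => hz ⟨t, h.symm⟩)
  have hne0 : ∀ z ∈ U, z ≠ x0 := fun z hz h => hz ⟨0, by simp [h]⟩
  let H : C(I × U, ℂ) := ⟨fun q => (toC q.2 - toC (γ q.1)) / (toC q.2 - toC x0), by
    have := toC.continuous
    have := γ.continuous
    refine Continuous.div (by fun_prop) (by fun_prop) (fun q => toC_sub_ne (hne0 _ q.2.2))⟩
  obtain ⟨L, hL, hL0⟩ := exp_lift_homotopy H
    (fun q => div_ne_zero (hneU _ q.2.2 _) (toC_sub_ne (hne0 _ q.2.2)))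
    (fun a => by
      simp only [H, ContinuousMap.coe_mk, γ.source]
      exact div_self (toC_sub_ne (hne0 _ a.2)))
  classical
  refine ⟨fun z => if h : z ∈ U then L (1, ⟨z, h⟩) else 0, U, hUo, ?_, ?_, ?_, ?_, ?_⟩
  · rintro z hz ⟨t, rfl⟩; exact hz (hγ t).1
  · rintro z hz ⟨t, rfl⟩; exact (hγ t).2 hz
  · rw [continuousOn_iff_continuous_restrict]
    have : Continuous fun z : U => L (1, z) := by fun_prop
    convert this using 1
    ext z
    simp [Set.restrict, z.2]
  · intro z hz
    refine ⟨hne0 z hz, ?_⟩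
    simp only [hz, dif_pos]
    rw [hL]; simp [H]
  · intro z hz
    have hzU : z ∈ U := by rintro ⟨t, rfl⟩; exact hz (hγ t).1
    simp only [hzU, dif_pos]
    obtain ⟨hc, h0, hexp⟩ := hℓ z hz
    have hc2 : Continuous fun t : I => ℓ z ⟨γ t, (hγ t).1⟩ := by
      have := γ.continuous
      exact hc.comp (by fun_prop)
    have := exp_log_unique (A := I) (S := univ) isPreconnected_univ
      (F := fun t => L (t, ⟨z, hzU⟩)) (G := fun t => ℓ z ⟨γ t, (hγ t).1⟩)
      (by fun_prop) hc2.continuousOn (fun t _ => by rw [hL, hexp]; rfl) (a := 0) (mem_univ _)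
      (by rw [hL0]; simp only [γ.source]; exact h0.symm) 1 (mem_univ _)
    simp only [γ.target] at this
    exact this



/-- No nonvanishing continuous function on the plane agrees with `z - x` off a bounded set. -/
theorem no_fill (x : Eu 2) (q : Eu 2 → ℂ) (hq : Continuous q) (hne : ∀ z, q z ≠ 0)
    (B : Set (Eu 2)) (hB : Bornology.IsBounded B) (hqB : ∀ z ∉ B, q z = toC z - toC x) : False := by
  obtain ⟨R, hR⟩ := hB.subset_ball x
  obtain ⟨L, hL⟩ := exp_lift_sc (A := Eu 2) ⟨q, hq⟩ hne
  set R' : ℝ := max R 1 with hR'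
  have hpos : 0 < R' := lt_of_lt_of_le one_pos (le_max_right _ _)
  let c : ℝ → Eu 2 := fun θ => x + toC.symm (R' * Complex.exp (θ * Complex.I))
  have hc : Continuous c := by
    have := toC.symm.continuous
    fun_prop
  have hcB : ∀ θ, c θ ∉ B := by
    intro θ hθ
    have := hR hθ
    rw [mem_ball, dist_eq_norm] at this
    simp only [c, add_sub_cancel_left, LinearIsometryEquiv.norm_map, norm_mul,
      Complex.norm_exp_ofReal_mul_I, Complex.norm_real, mul_one, Real.norm_eq_abs,
      abs_of_pos hpos] at this
    exact absurd this (not_lt.2 (le_max_left _ _))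
  have hv : ∀ θ, Complex.exp (L (c θ)) = R' * Complex.exp (θ * Complex.I) := by
    intro θ
    rw [hL]
    simp only [ContinuousMap.coe_mk]
    rw [hqB _ (hcB θ)]
    simp [c]
  have h0 : c 0 = c (2 * Real.pi) := by simp [c, Complex.exp_two_pi_mul_I]
  have hRexp : Complex.exp (Complex.log R') = R' :=
    Complex.exp_log (by exact_mod_cast hpos.ne')
  have := exp_log_unique (A := ℝ) (S := univ) isPreconnected_univ
      (F := fun t => L (c t)) (G := fun t => L (c 0) + t * Complex.I)
      (by fun_prop) (by fun_prop) (fun t _ => by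
        rw [Complex.exp_add, hv, hv]; simp) (a := 0) (mem_univ _)
      (by simp) (2 * Real.pi) (mem_univ _)
  simp only [← h0] at this
  simp at this

theorem gate (Ω : Set (Eu 2)) (hΩ : IsOpen Ω) (hb : Bornology.IsBounded Ω)
    (hsc : SimplyConnectedSpace Ω)
    {x x0 : Eu 2} (N : Set (Eu 2)) (hN : IsClosed N)
    (hΩN : Ωᶜ ⊆ N) (hxN : x ∉ N) (hx0N : x0 ∉ N)
    (h : ∀ y ∈ N, ∃ ρ, infDist y Ωᶜ < ρ ∧ JoinedIn (Ω \ closedBall y ρ) x0 x) :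
    JoinedIn Nᶜ x x0 := by
  have hx : x ∈ Ω := by by_contra h'; exact hxN (hΩN h')
  have hx0 : x0 ∈ Ω := by by_contra h'; exact hx0N (hΩN h')
  have hcl : IsClosed Ωᶜ := hΩ.isClosed_compl
  have hne : (Ωᶜ).Nonempty := by
    rw [nonempty_compl]
    rintro rfl
    exact (NormedSpace.unbounded_univ ℝ (Eu 2)) hb
  obtain ⟨f, hf⟩ := path_log Ω hΩ hsc hx hx0
  choose! ρ hρ hJ using h
  have hL : ∀ y : Eu 2, ∃ L : Eu 2 → ℂ, ∃ U : Set (Eu 2), y ∈ N → (IsOpen U ∧ Ωᶜ ⊆ U ∧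
        closedBall y (ρ y) ⊆ U ∧ ContinuousOn L U ∧
        (∀ z ∈ U, z ≠ x0 ∧ Complex.exp (L z) = (toC z - toC x) / (toC z - toC x0)) ∧
        ∀ z ∈ Ωᶜ, L z = f z) := by
    intro y
    by_cases hy : y ∈ N
    · obtain ⟨L, U, hLU⟩ := hf _ (hJ y hy)
      exact ⟨L, U, fun _ => hLU⟩
    · exact ⟨fun _ => 0, ∅, fun h => absurd h hy⟩
  choose L U hLU using hL
  let F : Eu 2 → ℂ := fun y => L y y
  have hρ0 : ∀ y ∈ N, 0 < ρ y := fun y hy => lt_of_le_of_lt infDist_nonneg (hρ y hy)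
  have hFexp : ∀ y ∈ N, Complex.exp (F y) = (toC y - toC x) / (toC y - toC x0) := by
    intro y hy
    obtain ⟨-, -, hs, -, he, -⟩ := hLU y hy
    exact (he y (hs (mem_closedBall_self (hρ0 y hy).le))).2
  have hFc : ContinuousOn F N := by
    intro y hy
    obtain ⟨hUo, hUc, hs, hc, he, hf1⟩ := hLU y hy
    have hyU : y ∈ U y := hs (mem_closedBall_self (hρ0 y hy).le)
    have hcy : ContinuousWithinAt (L y) N y :=
      (hc.continuousAt (hUo.mem_nhds hyU)).continuousWithinAt
    refine hcy.congr_of_eventuallyEq ?_ rfl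
    have hball : ball y ((ρ y - infDist y Ωᶜ) / 2) ∈ nhdsWithin y N :=
      mem_nhdsWithin_of_mem_nhds (ball_mem_nhds _ (by linarith [hρ y hy]))
    filter_upwards [hball, self_mem_nhdsWithin] with y' hy' hy'N
    obtain ⟨hUo', hUc', hs', hc', he', hf1'⟩ := hLU y' hy'N
    obtain ⟨z, hz, hzd⟩ := hcl.exists_infDist_eq_dist hne y'
    have hdy : infDist y' Ωᶜ ≤ infDist y Ωᶜ + dist y' y := infDist_le_infDist_add_dist
    rw [mem_ball] at hy'
    have hz1 : z ∈ closedBall y' (ρ y') := by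
      rw [mem_closedBall, dist_comm, ← hzd]; exact (hρ y' hy'N).le
    have hz2 : z ∈ closedBall y (ρ y) := by
      rw [mem_closedBall]
      have := dist_triangle z y' y
      rw [dist_comm z y', ← hzd] at this
      linarith
    have hy1 : y' ∈ closedBall y' (ρ y') := mem_closedBall_self (hρ0 y' hy'N).le
    have hy2 : y' ∈ closedBall y (ρ y) := by
      rw [mem_closedBall]
      have := infDist_nonneg (x := y) (s := Ωᶜ)
      linarith [hρ0 y hy]
    exact exp_log_unique (S := closedBall y' (ρ y') ∩ closedBall y (ρ y))
      ((convex_closedBall _ _).inter (convex_closedBall _ _)).isPreconnected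
      (hc'.mono (inter_subset_left.trans hs')) (hc.mono (inter_subset_right.trans hs))
      (fun a ha => by rw [(he' a (hs' ha.1)).2, (he a (hs ha.2)).2]) (a := z) ⟨hz1, hz2⟩
      (by rw [hf1' z hz, hf1 z hz]) y' ⟨hy1, hy2⟩
  -- Borsuk separation
  set A := connectedComponentIn Nᶜ x with hA
  have hAo : IsOpen A := hN.isOpen_compl.connectedComponentIn
  have hxA : x ∈ A := mem_connectedComponentIn hxN
  have hAN : A ⊆ Nᶜ := connectedComponentIn_subset _ _
  by_cases hx0A : x0 ∈ A
  · have hAc : IsConnected A := ⟨⟨x, hxA⟩, isPreconnected_connectedComponentIn⟩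
    have := (hAo.isConnected_iff_isPathConnected.1 hAc).joinedIn x hxA x0 hx0A
    exact this.mono hAN
  exfalso
  have hfr : frontier A ⊆ N := by
    intro z hz
    by_contra hzN
    have hzA : z ∉ A := by
      have := hz.2; rwa [hAo.interior_eq] at this
    have hopen : IsOpen (connectedComponentIn Nᶜ z) := hN.isOpen_compl.connectedComponentIn
    have hzz : z ∈ connectedComponentIn Nᶜ z := mem_connectedComponentIn hzN
    obtain ⟨w, hw1, hw2⟩ := mem_closure_iff.1 hz.1 _ hopen hzz
    have e1 := connectedComponentIn_eq hw1
    have e2 := connectedComponentIn_eq hw2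
    rw [hA, e2, ← e1] at hzA
    exact hzA hzz
  have hfrc : IsClosed (frontier A) := isClosed_frontier
  obtain ⟨Ft, hFt⟩ := ContinuousMap.exists_restrict_eq hfrc
    (⟨fun z : frontier A => F z, by
      have := hFc.mono hfr
      rw [continuousOn_iff_continuous_domRestrict] at this
      exact this⟩ : C(frontier A, ℂ))
  have hFt' : ∀ z ∈ frontier A, Ft z = F z := by
    intro z hz
    exact congr_arg (fun φ : C(frontier A, ℂ) => φ ⟨z, hz⟩) hFt
  classical
  let q : Eu 2 → ℂ := fun z => if z ∈ A then (toC z - toC x0) * Complex.exp (Ft z) else toC z - toC x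
  have hq : Continuous q := by
    have := toC.continuous
    refine continuous_if (fun z hz => ?_) (by fun_prop) (by fun_prop)
    have hz' : z ∈ N := hfr hz
    rw [hFt' z hz, hFexp z hz', mul_div_cancel₀]
    exact toC_sub_ne (fun h => hx0N (h ▸ hz'))
  refine no_fill x q hq ?_ A (hb.subset (hAN.trans (compl_subset_comm.1 hΩN))) ?_
  · intro z
    by_cases hz : z ∈ A
    · simp only [q, hz, if_true]
      exact mul_ne_zero (toC_sub_ne (fun h => hx0A (h ▸ hz))) (Complex.exp_ne_zero _)
    · simp only [q, hz, if_false]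
      exact toC_sub_ne (fun h => hz (h ▸ hxA))
  · intro z hz; simp [q, hz]



/-- There is a `1`-Lipschitz curve of parameter length `ℓ` from `x` to `y` inside `P`. -/
def CurveIn (P : Set (Eu 2)) (ℓ : ℝ) (x y : Eu 2) : Prop :=
  0 ≤ ℓ ∧ ∃ γ : ℝ → Eu 2, LipschitzOnWith 1 γ (Icc 0 ℓ) ∧ γ 0 = x ∧ γ ℓ = y ∧
    ∀ t ∈ Icc (0:ℝ) ℓ, γ t ∈ P

theorem glue_curves {γ₁ γ₂ : ℝ → Eu 2} {a b : ℝ} (ha : 0 ≤ a) (hb : 0 ≤ b)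
    (h1 : LipschitzOnWith 1 γ₁ (Icc 0 a)) (h2 : LipschitzOnWith 1 γ₂ (Icc 0 b))
    (h : γ₁ a = γ₂ 0) :
    ∃ γ : ℝ → Eu 2, LipschitzOnWith 1 γ (Icc 0 (a + b)) ∧ (∀ t, t ≤ a → γ t = γ₁ t) ∧
      ∀ t, a ≤ t → γ t = γ₂ (t - a) := by
  classical
  refine ⟨fun t => if t ≤ a then γ₁ t else γ₂ (t - a), ?_, ?_, ?_⟩
  · have key : ∀ s ∈ Icc (0:ℝ) (a + b), ∀ t ∈ Icc (0:ℝ) (a + b), s ≤ t →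
        dist (if s ≤ a then γ₁ s else γ₂ (s - a)) (if t ≤ a then γ₁ t else γ₂ (t - a))
          ≤ t - s := by
      intro s hs t ht hst
      have d1 : ∀ u ∈ Icc (0:ℝ) a, ∀ v ∈ Icc (0:ℝ) a, u ≤ v → dist (γ₁ u) (γ₁ v) ≤ v - u := by
        intro u hu v hv huv
        have := h1.dist_le_mul u hu v hv
        rw [Real.dist_eq, abs_sub_comm, abs_of_nonneg (by linarith)] at this
        simpa using this
      have d2 : ∀ u ∈ Icc (0:ℝ) b, ∀ v ∈ Icc (0:ℝ) b, u ≤ v → dist (γ₂ u) (γ₂ v) ≤ v - u := by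
        intro u hu v hv huv
        have := h2.dist_le_mul u hu v hv
        rw [Real.dist_eq, abs_sub_comm, abs_of_nonneg (by linarith)] at this
        simpa using this
      by_cases hta : t ≤ a
      · rw [if_pos hta, if_pos (hst.trans hta)]
        exact d1 s ⟨hs.1, hst.trans hta⟩ t ⟨ht.1, hta⟩ hst
      · push Not at hta
        rw [if_neg (not_le.2 hta)]
        by_cases hsa : s ≤ a
        · rw [if_pos hsa]
          have e1 := d1 s ⟨hs.1, hsa⟩ a ⟨ha, le_rfl⟩ hsa
          have e2 := d2 0 ⟨le_rfl, hb⟩ (t - a) ⟨by linarith, by linarith [ht.2]⟩ (by linarith)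
          have := dist_triangle (γ₁ s) (γ₁ a) (γ₂ (t - a))
          rw [h] at this e1
          linarith
        · push Not at hsa
          rw [if_neg (not_le.2 hsa)]
          have := d2 (s - a) ⟨by linarith, by linarith [hs.2]⟩ (t - a)
            ⟨by linarith, by linarith [ht.2]⟩ (by linarith)
          linarith
    refine LipschitzOnWith.of_dist_le_mul fun s hs t ht => ?_
    rw [NNReal.coe_one, one_mul, Real.dist_eq]
    rcases le_total s t with hst | hst
    · rw [abs_sub_comm, abs_of_nonneg (by linarith)]
      exact key s hs t ht hst
    · rw [abs_of_nonneg (by linarith), dist_comm]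
      exact key t ht s hs hst
  · intro t ht; simp [ht]
  · intro t ht
    rcases ht.eq_or_lt with rfl | ht
    · simp [h]
    · simp [not_le.2 ht]

theorem CurveIn.trans {P : Set (Eu 2)} {a b : ℝ} {x y z : Eu 2} (h1 : CurveIn P a x y)
    (h2 : CurveIn P b y z) : CurveIn P (a + b) x z := by
  obtain ⟨ha, γ₁, l1, s1, t1, m1⟩ := h1
  obtain ⟨hb, γ₂, l2, s2, t2, m2⟩ := h2
  obtain ⟨γ, hl, e1, e2⟩ := glue_curves ha hb l1 l2 (t1.trans s2.symm)
  refine ⟨by linarith, γ, hl, (e1 0 ha).trans s1, ?_, ?_⟩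
  · rw [e2 _ (by linarith)]; simpa using t2
  · intro t ht
    rcases le_total t a with h | h
    · rw [e1 t h]; exact m1 t ⟨ht.1, h⟩
    · rw [e2 t h]; exact m2 _ ⟨by linarith, by linarith [ht.2]⟩

theorem CurveIn.segment {P : Set (Eu 2)} {x y : Eu 2} (h : segment ℝ x y ⊆ P) :
    CurveIn P (dist x y) x y := by
  refine ⟨dist_nonneg, ?_⟩
  rcases eq_or_ne x y with rfl | hxy
  · refine ⟨fun _ => x, LipschitzOnWith.of_dist_le_mul (by simp), rfl, rfl, fun t _ => h ?_⟩
    exact left_mem_segment ℝ x x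
  have hd : 0 < dist x y := dist_pos.2 hxy
  refine ⟨fun t => AffineMap.lineMap x y (t / dist x y), ?_, by simp, ?_, ?_⟩
  · refine LipschitzOnWith.of_dist_le_mul fun s _ t _ => ?_
    rw [dist_lineMap_lineMap, Real.dist_eq, Real.dist_eq, ← sub_div, abs_div, abs_of_pos hd]
    simp [div_mul_cancel₀ _ hd.ne']
  · simp [div_self hd.ne']
  · intro t ht
    apply h
    rw [segment_eq_image_lineMap]
    exact ⟨_, ⟨div_nonneg ht.1 hd.le, (div_le_one hd).2 ht.2⟩, rfl⟩

theorem chain_lemma (R ε : ℝ) (hε : 0 < ε) : ∃ K : ℝ, 0 < K ∧ ∀ (x : Eu 2) (r : ℝ), 0 < r →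
    ∀ S : Set (Eu 2), IsPreconnected S → S ⊆ closedBall x (R * r) → ∀ a ∈ S, ∀ b ∈ S,
    ∃ ℓ ≤ K * r, CurveIn {z | ∃ y ∈ S, dist z y ≤ ε * r} ℓ a b := by
  obtain ⟨t, ht⟩ := (isCompact_closedBall (0 : Eu 2) R).elim_finite_subcover
    (fun c : Eu 2 => ball c ε) (fun c => isOpen_ball)
    (fun z _ => mem_iUnion.2 ⟨z, mem_ball_self hε⟩)
  refine ⟨2 * ε * (t.card + 1), by positivity, fun x r hr S hS hSb a ha b hb => ?_⟩
  let c : t → Eu 2 := fun i => x + r • (i : Eu 2)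
  have hcov : ∀ z ∈ S, ∃ i : t, dist z (c i) < ε * r := by
    intro z hz
    have hz' := hSb hz
    have : r⁻¹ • (z - x) ∈ closedBall (0 : Eu 2) R := by
      rw [mem_closedBall_zero_iff, norm_smul, norm_inv, Real.norm_of_nonneg hr.le]
      rw [mem_closedBall, dist_eq_norm] at hz'
      rw [inv_mul_le_iff₀ hr]; linarith
    obtain ⟨i, hi⟩ := mem_iUnion.1 (ht this)
    obtain ⟨hi, hi2⟩ := mem_iUnion.1 hi
    refine ⟨⟨i, hi⟩, ?_⟩
    rw [mem_ball, dist_eq_norm] at hi2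
    have e : z - c ⟨i, hi⟩ = r • (r⁻¹ • (z - x) - i) := by
      simp only [c, smul_sub, smul_smul, mul_inv_cancel₀ hr.ne', one_smul]; abel
    rw [dist_eq_norm, e, norm_smul, Real.norm_of_nonneg hr.le]
    nlinarith
  let G : SimpleGraph t := SimpleGraph.fromRel
    (fun i j => ∃ s ∈ S, dist s (c i) < ε * r ∧ dist s (c j) < ε * r)
  set P : Set (Eu 2) := {z | ∃ y ∈ S, dist z y ≤ ε * r} with hP
  have hseg : ∀ s ∈ S, ∀ u v : Eu 2, dist s u < ε * r → dist s v < ε * r →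
      ∃ ℓ ≤ 2 * ε * r, CurveIn P ℓ u v := by
    intro s hs u v hu hv
    refine ⟨dist u v, ?_, CurveIn.segment ?_⟩
    · have := dist_triangle_left u v s; linarith
    · intro z hz
      refine ⟨s, hs, ?_⟩
      have := (convex_ball s (ε * r)).segment_subset (mem_ball'.2 hu) (mem_ball'.2 hv) hz
      exact (mem_ball.1 this).le
  have hwalk : ∀ (i j : t) (w : G.Walk i j), ∃ ℓ ≤ 2 * ε * r * w.length,
      0 < w.length → CurveIn P ℓ (c i) (c j) := by
    intro i j w
    induction w with
    | nil => exact ⟨0, by simp, by simp⟩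
    | @cons u v w' hadj p ih =>
      obtain ⟨ℓ, hℓ, hc⟩ := ih
      have : ∃ s ∈ S, dist s (c u) < ε * r ∧ dist s (c v) < ε * r := by
        rcases (SimpleGraph.fromRel_adj _ _ _).1 hadj with ⟨-, h | h⟩
        · exact h
        · obtain ⟨s, hs, h1, h2⟩ := h; exact ⟨s, hs, h2, h1⟩
      obtain ⟨s, hs, h1, h2⟩ := this
      obtain ⟨ℓ', hℓ', hc'⟩ := hseg s hs _ _ h1 h2
      by_cases hp : 0 < p.length
      · refine ⟨ℓ' + ℓ, ?_, fun _ => hc'.trans (hc hp)⟩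
        rw [SimpleGraph.Walk.length_cons]; push_cast; linarith
      · have hp0 : p.length = 0 := by omega
        have hvw := SimpleGraph.Walk.eq_of_length_eq_zero hp0
        subst hvw
        refine ⟨ℓ', ?_, fun _ => hc'⟩
        rw [SimpleGraph.Walk.length_cons, hp0]; push_cast; linarith
  obtain ⟨i, hi⟩ := hcov a ha
  have hreach : ∀ z ∈ S, ∃ j : t, dist z (c j) < ε * r ∧ G.Reachable i j := by
    by_contra hcon
    push Not at hcon
    obtain ⟨z, hz, hzj⟩ := hcon
    let U : Set (Eu 2) := ⋃ j : {j : t // G.Reachable i j}, ball (c j) (ε * r)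
    let V : Set (Eu 2) := ⋃ j : {j : t // ¬ G.Reachable i j}, ball (c j) (ε * r)
    have hU : IsOpen U := isOpen_iUnion fun _ => isOpen_ball
    have hV : IsOpen V := isOpen_iUnion fun _ => isOpen_ball
    have hUV : S ⊆ U ∪ V := by
      intro y hy
      obtain ⟨j, hj⟩ := hcov y hy
      by_cases hr' : G.Reachable i j
      · exact Or.inl (mem_iUnion.2 ⟨⟨j, hr'⟩, hj⟩)
      · exact Or.inr (mem_iUnion.2 ⟨⟨j, hr'⟩, hj⟩)
    have hSU : (S ∩ U).Nonempty :=
      ⟨a, ha, mem_iUnion.2 ⟨⟨i, SimpleGraph.Reachable.refl i⟩, hi⟩⟩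
    have hSV : (S ∩ V).Nonempty := by
      obtain ⟨j, hj⟩ := hcov z hz
      exact ⟨z, hz, mem_iUnion.2 ⟨⟨j, hzj j hj⟩, hj⟩⟩
    obtain ⟨y, hy, hyU, hyV⟩ := hS U V hU hV hUV hSU hSV
    obtain ⟨⟨j, hj⟩, hj'⟩ := mem_iUnion.1 hyU
    obtain ⟨⟨k, hk⟩, hk'⟩ := mem_iUnion.1 hyV
    refine hk (hj.trans (SimpleGraph.Adj.reachable ?_))
    refine (SimpleGraph.fromRel_adj _ _ _).2 ⟨?_, Or.inl ⟨y, hy, hj', hk'⟩⟩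
    rintro rfl
    exact hk hj
  obtain ⟨j, hj, hij⟩ := hreach b hb
  classical
  obtain ⟨w⟩ := hij
  obtain ⟨ℓ, hℓ, hc⟩ := hwalk i j w.toPath
  have hlen : (w.toPath : G.Walk i j).length < t.card := by
    have := w.toPath.2.length_lt
    simpa using this
  have hlen' : ((w.toPath : G.Walk i j).length : ℝ) + 1 ≤ t.card := by exact_mod_cast hlen
  have hεr : 0 < ε * r := by positivity
  have ea : CurveIn P (dist a (c i)) a (c i) := by
    apply CurveIn.segment
    intro z hz
    refine ⟨a, ha, ?_⟩
    have := (convex_ball a (ε * r)).segment_subset (mem_ball_self hεr) (mem_ball'.2 hi) hz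
    exact (mem_ball.1 this).le
  have eb : CurveIn P (dist (c j) b) (c j) b := by
    apply CurveIn.segment
    intro z hz
    refine ⟨b, hb, ?_⟩
    have := (convex_ball b (ε * r)).segment_subset (mem_ball'.2 hj) (mem_ball_self hεr) hz
    exact (mem_ball.1 this).le
  rw [dist_comm] at hj
  by_cases hp : 0 < (w.toPath : G.Walk i j).length
  · refine ⟨_, ?_, (ea.trans (hc hp)).trans eb⟩
    nlinarith
  · have hp0 : (w.toPath : G.Walk i j).length = 0 := by omega
    have hij := SimpleGraph.Walk.eq_of_length_eq_zero hp0
    subst hij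
    refine ⟨_, ?_, ea.trans eb⟩
    nlinarith


lemma exp_arc_le {θ t : ℝ} (hθ : |θ| ≤ Real.pi) (ht0 : 0 ≤ t) (ht1 : t ≤ 1) :
    ‖Complex.exp (Complex.I * ((t * θ : ℝ) : ℂ)) - 1‖ ≤ ‖Complex.exp (Complex.I * (θ : ℂ)) - 1‖ := by
  rw [Complex.norm_exp_I_mul_ofReal_sub_one, Complex.norm_exp_I_mul_ofReal_sub_one]
  have key : ∀ x : ℝ, |x| ≤ Real.pi → ‖2 * Real.sin (x / 2)‖ = 2 * Real.sin (|x| / 2) := by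
    intro x hx
    rcases le_total 0 x with h | h
    · rw [abs_of_nonneg h] at hx ⊢
      rw [Real.norm_of_nonneg]
      have := Real.sin_nonneg_of_nonneg_of_le_pi (x := x/2) (by linarith) (by linarith [Real.pi_pos])
      linarith
    · rw [abs_of_nonpos h] at hx ⊢
      have := Real.sin_nonneg_of_nonneg_of_le_pi (x := -x/2) (by linarith) (by linarith [Real.pi_pos])
      have h2 : Real.sin (x/2) = - Real.sin (-x/2) := by rw [← Real.sin_neg]; congr 1; ring
      rw [h2, Real.norm_eq_abs, mul_neg, abs_neg, abs_of_nonneg (by linarith)]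
  have h1 : |t * θ| ≤ |θ| := by
    rw [abs_mul, abs_of_nonneg ht0]; exact mul_le_of_le_one_left (abs_nonneg _) ht1
  rw [key _ hθ, key _ (h1.trans hθ)]
  have := Real.sin_le_sin_of_le_of_le_pi_div_two (x := |t*θ|/2) (y := |θ|/2)
    (by have := abs_nonneg (t*θ); linarith [Real.pi_pos]) (by linarith) (by linarith)
  linarith

lemma arcC (a y w : ℂ) (ρ : ℝ) (hρ : 0 ≤ ρ) (ha : ρ < ‖a - w‖) (hy : ρ < ‖y - w‖) :
    JoinedIn (closedBall a (2 * dist a y) \ closedBall w ρ) a y := by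
  have ha0 : 0 < ‖a - w‖ := hρ.trans_lt ha
  have hy0 : 0 < ‖y - w‖ := hρ.trans_lt hy
  have hane : a - w ≠ 0 := norm_pos_iff.1 ha0
  have hyne : y - w ≠ 0 := norm_pos_iff.1 hy0
  set k : ℝ := ‖a - w‖ / ‖y - w‖ with hk
  have hkpos : 0 < k := by positivity
  set θ : ℝ := Complex.arg ((y - w) / (a - w)) with hθ
  set y' : ℂ := w + (k : ℂ) * (y - w) with hy'
  have hy'2 : y' = w + (a - w) * Complex.exp (Complex.I * θ) := by
    have h := Complex.norm_mul_exp_arg_mul_I ((y - w) / (a - w))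
    rw [← hθ, norm_div] at h
    have h3 : (a - w) * Complex.exp (θ * Complex.I) = (k : ℂ) * (y - w) := by
      have h4 : (y - w) = (a - w) * (((‖y - w‖ / ‖a - w‖ : ℝ) : ℂ) * Complex.exp (θ * Complex.I)) := by
        rw [h]; field_simp
      have h5 : (k : ℂ) * ((‖y - w‖ / ‖a - w‖ : ℝ) : ℂ) = 1 := by
        rw [← Complex.ofReal_mul, hk]
        rw [show ‖a - w‖ / ‖y - w‖ * (‖y - w‖ / ‖a - w‖) = 1 by field_simp]; simp
      calc (a - w) * Complex.exp (θ * Complex.I)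
          = ((k : ℂ) * ((‖y - w‖ / ‖a - w‖ : ℝ) : ℂ)) * ((a - w) * Complex.exp (θ * Complex.I)) := by
            rw [h5, one_mul]
        _ = (k : ℂ) * ((a - w) * (((‖y - w‖ / ‖a - w‖ : ℝ) : ℂ) * Complex.exp (θ * Complex.I))) := by ring
        _ = _ := by rw [← h4]
    rw [hy', ← h3, mul_comm Complex.I]
  have hyy' : dist y' y ≤ dist a y := by
    have : y' - y = ((k - 1 : ℝ) : ℂ) * (y - w) := by rw [hy']; push_cast; ring
    rw [dist_eq_norm, this, norm_mul, Complex.norm_real, Real.norm_eq_abs, ← abs_of_pos hy0, ← abs_mul,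
      sub_mul, one_mul, hk, div_mul_cancel₀ _ hy0.ne']
    calc |‖a - w‖ - ‖y - w‖| ≤ ‖(a - w) - (y - w)‖ := abs_norm_sub_norm_le _ _
      _ = dist a y := by rw [dist_eq_norm]; congr 1; ring
  have hay' : dist y' a ≤ 2 * dist a y := by
    have := dist_triangle y' y a
    rw [dist_comm y a] at this; linarith
  refine JoinedIn.trans (y := y') ?_ ?_
  · -- arc
    refine JoinedIn.ofLine (f := fun t : ℝ => w + (a - w) * Complex.exp (Complex.I * ((t * θ : ℝ) : ℂ)))
      ?_ ?_ ?_ ?_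
    · fun_prop
    · simp
    · simp [hy'2]
    · rintro _ ⟨t, ht, rfl⟩
      refine ⟨?_, ?_⟩
      · have h1 : w + (a - w) * Complex.exp (Complex.I * ((t * θ : ℝ) : ℂ)) - a
          = (a - w) * (Complex.exp (Complex.I * ((t * θ : ℝ) : ℂ)) - 1) := by ring
        have h2 : y' - a = (a - w) * (Complex.exp (Complex.I * (θ : ℂ)) - 1) := by rw [hy'2]; ring
        rw [mem_closedBall, dist_eq_norm]
        simp only []
        rw [h1, norm_mul]
        rw [dist_eq_norm, h2, norm_mul] at hay'
        exact (mul_le_mul_of_nonneg_left (exp_arc_le (Complex.abs_arg_le_pi _) ht.1 ht.2) ha0.le).trans hay'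
      · rw [mem_closedBall, dist_eq_norm]
        simp only []
        rw [add_sub_cancel_left, norm_mul, mul_comm Complex.I, Complex.norm_exp_ofReal_mul_I, mul_one]
        exact not_le.2 ha
  · refine JoinedIn.ofLine (f := fun t : ℝ => w + (((1 - t) * k + t : ℝ) : ℂ) * (y - w)) ?_ ?_ ?_ ?_
    · fun_prop
    · simp [hy']
    · simp
    · rintro _ ⟨t, ht, rfl⟩
      refine ⟨?_, ?_⟩
      · have h1 : w + (((1 - t) * k + t : ℝ) : ℂ) * (y - w) = (1 - t) • y' + t • y := by
          rw [hy', Complex.real_smul, Complex.real_smul]; push_cast; ring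
        simp only []
        rw [h1]
        have hc := convex_closedBall a (2 * dist a y)
        refine hc (mem_closedBall.2 hay') ?_ (by linarith [ht.2]) ht.1 (by ring)
        rw [mem_closedBall, dist_comm]; linarith [dist_nonneg (x := a) (y := y)]
      · rw [mem_closedBall, dist_eq_norm]
        simp only []
        rw [add_sub_cancel_left, norm_mul, Complex.norm_real, Real.norm_eq_abs, abs_of_nonneg (by nlinarith [ht.1, ht.2])]
        rw [add_mul, mul_assoc, hk, div_mul_cancel₀ _ hy0.ne', not_le]
        rcases le_total t (1/2) with h | h
        · nlinarith [ht.1, ht.2]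
        · nlinarith [ht.1, ht.2]

lemma move_lemma {Ω : Set (Eu 2)} {a y w : Eu 2} {ρ : ℝ} (hρ : 0 ≤ ρ)
    (ha : a ∉ closedBall w ρ) (hy : y ∉ closedBall w ρ) (hΩne : a ∈ Ω) (hd : dist a y < infDist a Ωᶜ / 2) :
    JoinedIn (Ω \ closedBall w ρ) a y := by
  have h := arcC (toC a) (toC y) (toC w) ρ hρ
    (by rw [← map_sub, LinearIsometryEquiv.norm_map, ← dist_eq_norm]; simpa using ha)
    (by rw [← map_sub, LinearIsometryEquiv.norm_map, ← dist_eq_norm]; simpa using hy)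
  have h2 := h.map_continuousOn toC.symm.continuous.continuousOn
  simp only [LinearIsometryEquiv.symm_apply_apply] at h2
  refine h2.mono ?_
  rintro _ ⟨z, ⟨hz1, hz2⟩, rfl⟩
  rw [LinearIsometryEquiv.dist_map] at hz1
  have e : ∀ v : Eu 2, dist (toC.symm z) v = dist z (toC v) := by
    intro v
    rw [← toC.dist_map, LinearIsometryEquiv.apply_symm_apply]
  refine ⟨?_, ?_⟩
  · by_contra hn
    have := infDist_le_dist_of_mem (x := a) (show toC.symm z ∈ Ωᶜ from hn)
    rw [dist_comm, e] at this
    rw [mem_closedBall] at hz1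
    linarith
  · rw [mem_closedBall, e]; exact hz2


lemma edist_half_iff {Ω : Set (Eu 2)} (hne : (Ωᶜ).Nonempty) (x y : Eu 2) :
    edist x y < ENNReal.ofReal (1/2) * EMetric.infEdist x Ωᶜ ↔ dist x y < infDist x Ωᶜ / 2 := by
  have h : EMetric.infEdist x Ωᶜ = ENNReal.ofReal (infDist x Ωᶜ) := by
    rw [infDist, ENNReal.ofReal_toReal]
    · rfl
    · exact infEDist_ne_top hne
  rw [h, ← ENNReal.ofReal_mul (by norm_num), edist_dist, ENNReal.ofReal_lt_ofReal_iff_of_nonneg dist_nonneg]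
  constructor <;> intro h <;> linarith

lemma compl_nonempty_of_bdd {Ω : Set (Eu 2)} (hb : Bornology.IsBounded Ω) : (Ωᶜ).Nonempty := by
  by_contra h
  rw [Set.not_nonempty_iff_eq_empty, Set.compl_empty_iff] at h
  rw [h] at hb
  exact NormedSpace.unbounded_univ ℝ (Eu 2) hb

lemma hsp_test {Ω : Set (Eu 2)} (hΩ : IsOpen Ω) (hb : Bornology.IsBounded Ω) {s p q C : ℝ}
    (hp : 0 < p) (hq : 0 < q)
    (hC : ∀ u : Eu 2 → ℝ, MemMball Ω s p u →
      eLpNorm (fun x => u x - ⨍ y in Ω, u y) (ENNReal.ofReal q) (volume.restrict Ω)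
      ≤ ENNReal.ofReal C * ballNorm Ω s p u) {u : Eu 2 → ℝ} (hu : Measurable u) {S F0 F1 : Set (Eu 2)}
    (hS : MeasurableSet S) {L : ℝ} (hL : 0 ≤ L)
    (h1 : ∀ ζ ∈ Ω, ∀ η ∈ Ω, dist ζ η < infDist ζ Ωᶜ / 2 → |u ζ - u η| ≤ dist ζ η ^ s * L)
    (h2 : ∀ ζ ∈ Ω, ∀ η ∈ Ω, dist ζ η < infDist ζ Ωᶜ / 2 → ζ ∉ S → η ∉ S → u ζ = u η)
    (hF0 : MeasurableSet F0) (hF1 : MeasurableSet F1) (hF0Ω : F0 ⊆ Ω) (hF1Ω : F1 ⊆ Ω)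
    (hu0 : ∀ z ∈ F0, u z = 0) (hu1 : ∀ z ∈ F1, u z = 1) :
    ENNReal.ofReal (1/2) * (min (volume F0) (volume F1)) ^ (1/q) ≤
      ENNReal.ofReal C * (ENNReal.ofReal L * (volume (S ∩ Ω)) ^ (1/p)) := by
  have hne := compl_nonempty_of_bdd hb
  set g : Eu 2 → ℝ := S.indicator (fun _ => L) with hg
  have hgD : g ∈ DBall Ω s (1/2) u := by
    refine ⟨measurable_const.indicator hS, fun x => indicator_nonneg (fun _ _ => hL) x, ∅,
      empty_subset _, measure_empty, ?_⟩
    rintro ζ ⟨hζ, -⟩ η ⟨hη, -⟩ hd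
    rw [edist_half_iff hne] at hd
    by_cases hζS : ζ ∈ S
    · refine (h1 ζ hζ η hη hd).trans ?_
      have : 0 ≤ g η := indicator_nonneg (fun _ _ => hL) _
      have h3 : g ζ = L := indicator_of_mem hζS _
      refine mul_le_mul_of_nonneg_left (by linarith) (by positivity)
    by_cases hηS : η ∈ S
    · refine (h1 ζ hζ η hη hd).trans ?_
      have : 0 ≤ g ζ := indicator_nonneg (fun _ _ => hL) _
      have h3 : g η = L := indicator_of_mem hηS _
      refine mul_le_mul_of_nonneg_left (by linarith) (by positivity)
    · rw [h2 ζ hζ η hη hd hζS hηS]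
      have h3 : 0 ≤ g ζ := indicator_nonneg (fun _ _ => hL) _
      have h4 : 0 ≤ g η := indicator_nonneg (fun _ _ => hL) _
      simp; positivity
  have hpp : ENNReal.ofReal p ≠ 0 := by simpa using hp
  have hqq : ENNReal.ofReal q ≠ 0 := by simpa using hq
  have hgn : eLpNorm g (ENNReal.ofReal p) (volume.restrict Ω)
      = ENNReal.ofReal L * (volume (S ∩ Ω)) ^ (1/p) := by
    rw [hg, eLpNorm_indicator_const hS hpp ENNReal.ofReal_ne_top, Measure.restrict_apply hS,
      ENNReal.toReal_ofReal hp.le, Real.enorm_of_nonneg hL]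
  have hbn : ballNorm Ω s p u ≤ ENNReal.ofReal L * (volume (S ∩ Ω)) ^ (1/p) := by
    rw [← hgn]; exact iInf₂_le g hgD
  have hfin : ballNorm Ω s p u < ⊤ := by
    refine hbn.trans_lt (ENNReal.mul_lt_top ENNReal.ofReal_lt_top ?_)
    refine ENNReal.rpow_lt_top_of_nonneg (by positivity) ?_
    exact ((measure_mono inter_subset_right).trans_lt hb.measure_lt_top).ne
  have h3 := (hC u ⟨hu, hfin⟩).trans (mul_le_mul_right hbn _)
  refine le_trans ?_ h3
  set m := ⨍ y in Ω, u y
  -- lower bound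
  have low : ∀ F : Set (Eu 2), MeasurableSet F → F ⊆ Ω → (∀ z ∈ F, 1/2 ≤ |u z - m|) →
      ENNReal.ofReal (1/2) * (volume F) ^ (1/q) ≤
        eLpNorm (fun x => u x - m) (ENNReal.ofReal q) (volume.restrict Ω) := by
    intro F hF hFΩ hFm
    have : ENNReal.ofReal (1/2) * (volume F) ^ (1/q) =
        eLpNorm (F.indicator (fun _ => (1/2:ℝ))) (ENNReal.ofReal q) (volume.restrict Ω) := by
      rw [eLpNorm_indicator_const hF hqq ENNReal.ofReal_ne_top, Measure.restrict_apply hF,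
        ENNReal.toReal_ofReal hq.le, Real.enorm_of_nonneg (by norm_num), inter_eq_self_of_subset_left hFΩ]
    rw [this]
    refine eLpNorm_mono fun z => ?_
    by_cases hz : z ∈ F
    · rw [indicator_of_mem hz, Real.norm_of_nonneg (by norm_num)]; exact hFm z hz
    · rw [indicator_of_notMem hz]; simp
  rcases le_total m (1/2) with h | h
  · refine le_trans ?_ (low F1 hF1 hF1Ω fun z hz => ?_)
    · gcongr; exact min_le_right _ _
    · rw [hu1 z hz, abs_of_nonneg (by linarith)]; linarith
  · refine le_trans ?_ (low F0 hF0 hF0Ω fun z hz => ?_)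
    · gcongr; exact min_le_left _ _
    · rw [hu0 z hz, zero_sub, abs_neg, abs_of_nonneg (by linarith)]; linarith

def phi (w : Eu 2) (a τ : ℝ) (ζ : Eu 2) : ℝ := max 0 (min 1 ((dist ζ w - a) / τ))

lemma phi_nonneg (w : Eu 2) (a τ : ℝ) (ζ : Eu 2) : 0 ≤ phi w a τ ζ := le_max_left _ _
lemma phi_le_one (w : Eu 2) (a τ : ℝ) (ζ : Eu 2) : phi w a τ ζ ≤ 1 :=
  max_le zero_le_one (min_le_left _ _)
lemma phi_zero {w : Eu 2} {a τ : ℝ} {ζ : Eu 2} (hτ : 0 < τ) (h : dist ζ w ≤ a) : phi w a τ ζ = 0 := by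
  refine max_eq_left ((min_le_right _ _).trans ?_)
  exact div_nonpos_of_nonpos_of_nonneg (by linarith) hτ.le
lemma phi_one {w : Eu 2} {a τ : ℝ} {ζ : Eu 2} (hτ : 0 < τ) (h : a + τ ≤ dist ζ w) : phi w a τ ζ = 1 := by
  have : 1 ≤ (dist ζ w - a) / τ := by rw [le_div_iff₀ hτ]; linarith
  rw [phi, min_eq_left this, max_eq_right zero_le_one]
lemma phi_lip {w : Eu 2} {a τ s : ℝ} (hτ : 0 < τ) (hs : 0 < s) (hs1 : s ≤ 1) (ζ η : Eu 2) :
    |phi w a τ ζ - phi w a τ η| ≤ dist ζ η ^ s * τ ^ (-s) := by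
  have h1 : |phi w a τ ζ - phi w a τ η| ≤ 1 := by
    rw [abs_le]
    constructor <;> linarith [phi_nonneg w a τ ζ, phi_nonneg w a τ η, phi_le_one w a τ ζ, phi_le_one w a τ η]
  have h2 : |phi w a τ ζ - phi w a τ η| ≤ dist ζ η / τ := by
    unfold phi
    calc _ ≤ |min 1 ((dist ζ w - a) / τ) - min 1 ((dist η w - a) / τ)| := by
          have := abs_max_sub_max_le_max 0 (min 1 ((dist ζ w - a) / τ)) 0 (min 1 ((dist η w - a) / τ))
          simpa using this
      _ ≤ |(dist ζ w - a) / τ - (dist η w - a) / τ| := by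
          have := abs_min_sub_min_le_max 1 ((dist ζ w - a) / τ) 1 ((dist η w - a) / τ)
          simpa using this
      _ = |dist ζ w - dist η w| / τ := by
          rw [← sub_div, abs_div, abs_of_pos hτ]; congr 2; ring
      _ ≤ dist ζ η / τ := by gcongr; exact abs_dist_sub_le _ _ _
  have h0 : 0 ≤ dist ζ η / τ := by positivity
  rw [Real.rpow_neg hτ.le, ← div_eq_mul_inv, ← Real.div_rpow dist_nonneg hτ.le]
  rcases le_total (dist ζ η / τ) 1 with h | h
  · exact h2.trans (Real.self_le_rpow_of_le_one h0 h hs1)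
  · exact h1.trans (Real.one_le_rpow h hs.le)
lemma phi_cont (w : Eu 2) (a τ : ℝ) : Continuous (phi w a τ) := by
  unfold phi; fun_prop


lemma vol_ball2 (x : Eu 2) {r : ℝ} (hr : 0 ≤ r) : volume.real (ball x r) = Real.pi * r ^ 2 := by
  rw [Measure.real, EuclideanSpace.volume_ball_fin_two]
  simp [ENNReal.toReal_ofReal hr, ENNReal.toReal_ofReal Real.pi_pos.le]; ring
lemma vol_cball2 (x : Eu 2) {r : ℝ} (hr : 0 ≤ r) : volume.real (closedBall x r) = Real.pi * r ^ 2 := by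
  rw [Measure.real, EuclideanSpace.volume_closedBall_fin_two]
  simp [ENNReal.toReal_ofReal hr, ENNReal.toReal_ofReal Real.pi_pos.le]; ring

lemma joined_of_notJoined {V : Set (Eu 2)} {x x0 z : Eu 2} (h : ¬ JoinedIn V x0 x) (hz : z ∈ pathComponentIn V x) :
    ¬ JoinedIn V x0 z := fun h' => h (h'.trans (JoinedIn.symm hz))

lemma comp_est {Ω : Set (Eu 2)} (hΩ : IsOpen Ω) (hb : Bornology.IsBounded Ω) {s p q C : ℝ}
    (hs : 0 < s) (hs1 : s ≤ 1) (hp : 0 < p) (hq : 0 < q) (hC0 : 0 < C)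
    (hC : ∀ u : Eu 2 → ℝ, MemMball Ω s p u →
      eLpNorm (fun x => u x - ⨍ y in Ω, u y) (ENNReal.ofReal q) (volume.restrict Ω)
      ≤ ENNReal.ofReal C * ballNorm Ω s p u) {x0 : Eu 2} (hx0 : x0 ∈ Ω) :
    ∃ K > 0, ∀ x w ρ, 0 ≤ ρ → ρ < infDist x0 Ωᶜ / 4 → x0 ∉ closedBall w ρ →
      ¬ JoinedIn (Ω \ closedBall w ρ) x0 x → ∀ a τ, ρ ≤ a → 0 < τ → ∀ S,
      (S = closedBall w (a + τ) ∨ S = pathComponentIn (Ω \ closedBall w ρ) x \ ball w a) →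
      volume.real (pathComponentIn (Ω \ closedBall w ρ) x \ ball w (a + τ)) ≤
        K * τ ^ (-(s * q)) * volume.real (S ∩ Ω) ^ (q / p) := by
  have hne := compl_nonempty_of_bdd hb
  set D := infDist x0 Ωᶜ with hD
  have hDpos : 0 < D := (hΩ.isClosed_compl.notMem_iff_infDist_pos hne).1 (by simpa using hx0)
  have hballΩ : ball x0 D ⊆ Ω := by
    have := ball_infDist_compl_subset (x := x0) (s := Ω); exact this
  have hbt : volume Ω ≠ ⊤ := hb.measure_lt_top.ne
  set v : ℝ := Real.pi * D ^ 2 * 3 / 16 with hv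
  have hvpos : 0 < v := by rw [hv]; have := Real.pi_pos; positivity
  have hvM : v ≤ volume.real Ω := by
    have h1 : volume.real (ball x0 D) ≤ volume.real Ω := measureReal_mono hballΩ hbt
    rw [vol_ball2 _ hDpos.le] at h1
    have : 0 < Real.pi * D ^ 2 := by have := Real.pi_pos; positivity
    linarith
  have hMpos : 0 < volume.real Ω := hvpos.trans_le hvM
  set κ := v / volume.real Ω with hκ
  have hκpos : 0 < κ := by positivity
  have hκ1 : κ ≤ 1 := by rw [hκ, div_le_one hMpos]; exact hvM
  refine ⟨(2 * C) ^ q / κ, by positivity, ?_⟩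
  intro x w ρ hρ0 hρ hx0w hnj a τ hρa hτ S hSS
  set V := Ω \ closedBall w ρ with hV
  have hVo : IsOpen V := hΩ.sdiff isClosed_closedBall
  set T := pathComponentIn V x with hT
  have hTo : IsOpen T := hVo.pathComponentIn x
  have hTV : T ⊆ V := pathComponentIn_subset
  have hTΩ : T ⊆ Ω := hTV.trans sdiff_subset
  have hmove : ∀ ζ ∈ Ω, ∀ η ∈ Ω, dist ζ η < infDist ζ Ωᶜ / 2 → ζ ∉ closedBall w ρ → η ∉ closedBall w ρ →
      (ζ ∈ T ↔ η ∈ T) := by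
    intro ζ hζ η hη hd h1 h2
    have := move_lemma hρ0 h1 h2 hζ hd
    exact ⟨fun h => JoinedIn.trans h this, fun h => JoinedIn.trans h this.symm⟩
  set u : Eu 2 → ℝ := T.indicator (phi w a τ) with hu
  set F0 : Set (Eu 2) := ball x0 (D / 2) \ closedBall w ρ with hF0
  set F1 : Set (Eu 2) := T \ ball w (a + τ) with hF1
  have hF0T : ∀ z ∈ F0, z ∉ T := by
    intro z hz hzT
    refine joined_of_notJoined hnj hzT (move_lemma hρ0 hx0w hz.2 hx0 ?_)
    rw [dist_comm]; exact hz.1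
  have hSmeas : MeasurableSet S := by
    rcases hSS with h | h
    · rw [h]; exact measurableSet_closedBall
    · rw [h]; exact hTo.measurableSet.diff measurableSet_ball
  have cases : ∀ ζ ∈ Ω, ∀ η ∈ Ω, dist ζ η < infDist ζ Ωᶜ / 2 → (ζ ∉ T ∧ η ∉ T) ∨
      (u ζ = phi w a τ ζ ∧ u η = phi w a τ η) := by
    intro ζ hζ η hη hd
    have hout : ∀ z, z ∈ closedBall w ρ → u z = phi w a τ z := by
      intro z hz
      rw [hu, indicator_of_notMem (fun h => (hTV h).2 hz), phi_zero hτ]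
      exact (mem_closedBall.1 hz).trans hρa
    by_cases h1 : ζ ∈ T
    · right
      refine ⟨indicator_of_mem h1 _, ?_⟩
      by_cases h2 : η ∈ closedBall w ρ
      · exact hout η h2
      · exact indicator_of_mem ((hmove ζ hζ η hη hd (hTV h1).2 h2).1 h1) _
    · by_cases h2 : η ∈ T
      · right
        refine ⟨?_, indicator_of_mem h2 _⟩
        by_cases h3 : ζ ∈ closedBall w ρ
        · exact hout ζ h3
        · exact absurd ((hmove ζ hζ η hη hd h3 (hTV h2).2).2 h2) h1
      · exact Or.inl ⟨h1, h2⟩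
  have key := hsp_test hΩ hb (s := s) (F0 := F0) (F1 := F1) hp hq hC (u := u) ((phi_cont w a τ).measurable.indicator hTo.measurableSet)
    hSmeas (L := τ ^ (-s)) (by positivity) ?_ ?_ (measurableSet_ball.diff measurableSet_closedBall)
    (hTo.measurableSet.diff measurableSet_ball)
    (fun z hz => hballΩ (ball_subset_ball (by linarith) hz.1)) (fun z hz => hTΩ hz.1)
    (fun z hz => indicator_of_notMem (hF0T z hz) _)
    (fun z hz => by
      rw [hu, indicator_of_mem hz.1, phi_one hτ]
      have := hz.2; simp at this; exact this)
  · have f0 : volume F0 ≠ ⊤ := (measure_mono sdiff_subset).trans_lt (measure_ball_lt_top (μ := volume) (x := x0) (r := D/2)) |>.ne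
    have f1 : volume F1 ≠ ⊤ := ((measure_mono (sdiff_subset.trans hTΩ)).trans_lt hb.measure_lt_top).ne
    have fS : volume (S ∩ Ω) ≠ ⊤ := ((measure_mono inter_subset_right).trans_lt hb.measure_lt_top).ne
    have key2 := ENNReal.toReal_mono (by
      refine ENNReal.mul_ne_top ENNReal.ofReal_ne_top (ENNReal.mul_ne_top ENNReal.ofReal_ne_top ?_)
      exact ENNReal.rpow_ne_top_of_nonneg (by positivity) fS) key
    rw [ENNReal.toReal_mul, ENNReal.toReal_mul, ENNReal.toReal_mul, ← ENNReal.toReal_rpow, ← ENNReal.toReal_rpow,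
      ENNReal.toReal_ofReal (by norm_num), ENNReal.toReal_ofReal hC0.le, ENNReal.toReal_ofReal (by positivity),
      ENNReal.toReal_min f0 f1] at key2
    change 1/2 * (min (volume.real F0) (volume.real F1)) ^ (1/q) ≤ C * (τ ^ (-s) * volume.real (S ∩ Ω) ^ (1/p)) at key2
    have hF0v : v ≤ volume.real F0 := by
      have h1 : volume.real (ball x0 (D/2)) - volume.real (closedBall w ρ) ≤ volume.real F0 := by
        have := le_measureReal_sdiff (μ := (volume : Measure (Eu 2))) (s₁ := ball x0 (D/2)) (s₂ := closedBall w ρ)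
          (by exact measure_closedBall_lt_top.ne)
        linarith
      rw [vol_ball2 _ (by linarith), vol_cball2 _ hρ0] at h1
      have h2 : Real.pi * ρ ^ 2 ≤ Real.pi * (D/4) ^ 2 := by gcongr
      have : v = Real.pi * (D/2)^2 - Real.pi * (D/4)^2 := by rw [hv]; ring
      linarith
    have hF1M : volume.real F1 ≤ volume.real Ω := measureReal_mono (sdiff_subset.trans hTΩ) hbt
    have hmin : κ * volume.real F1 ≤ min (volume.real F0) (volume.real F1) := by
      refine le_min ?_ (mul_le_of_le_one_left measureReal_nonneg hκ1)
      refine le_trans ?_ hF0v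
      rw [hκ, div_mul_eq_mul_div, div_le_iff₀ hMpos]
      exact mul_le_mul_of_nonneg_left hF1M hvpos.le
    have key3 : (κ * volume.real F1) ^ (1/q) ≤ 2 * C * (τ ^ (-s) * volume.real (S ∩ Ω) ^ (1/p)) := by
      have : (κ * volume.real F1) ^ (1/q) ≤ (min (volume.real F0) (volume.real F1)) ^ (1/q) := by
        gcongr
      linarith
    have hX : 0 ≤ κ * volume.real F1 := by positivity
    have key4 := Real.rpow_le_rpow (by positivity) key3 hq.le
    rw [← Real.rpow_mul hX, one_div_mul_cancel hq.ne', Real.rpow_one,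
      Real.mul_rpow (x := 2 * C) (by positivity) (by positivity), Real.mul_rpow (x := τ ^ (-s)) (by positivity) (by positivity),
      ← Real.rpow_mul hτ.le, ← Real.rpow_mul measureReal_nonneg] at key4
    rw [show -(s * q) = -s * q by ring, show q / p = 1 / p * q by ring, div_mul_eq_mul_div, div_mul_eq_mul_div,
      le_div_iff₀ hκpos]
    linarith
  · intro ζ hζ η hη hd
    rcases cases ζ hζ η hη hd with ⟨h1, h2⟩ | ⟨h1, h2⟩
    · rw [hu, indicator_of_notMem h1, indicator_of_notMem h2]
      simp; positivity
    · rw [h1, h2]; exact phi_lip hτ hs hs1 ζ η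
  · intro ζ hζ η hη hd hζS hηS
    rcases cases ζ hζ η hη hd with ⟨h1, h2⟩ | ⟨h1, h2⟩
    · rw [hu, indicator_of_notMem h1, indicator_of_notMem h2]
    · rcases hSS with h | h
      · rw [h, mem_closedBall, not_le] at hζS hηS
        rw [h1, h2, phi_one hτ hζS.le, phi_one hτ hηS.le]
      · have : ∀ z, z ∉ S → u z = 0 := by
          intro z hz
          by_cases hzT : z ∈ T
          · rw [hu, indicator_of_mem hzT, phi_zero hτ]
            by_contra hcon
            rw [h] at hz
            exact hz ⟨hzT, by simpa using (not_le.1 hcon).le⟩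
          · exact indicator_of_notMem hzT _
        rw [this ζ hζS, this η hηS]


lemma sep_small {Ω : Set (Eu 2)} (hΩ : IsOpen Ω) (hb : Bornology.IsBounded Ω) {s p q C : ℝ}
    (hs : 0 < s) (hs1 : s ≤ 1) (hp : 0 < p) (hq : 0 < q) (hqp : q / p = 1 + s * q / 2) (hC0 : 0 < C)
    (hC : ∀ u : Eu 2 → ℝ, MemMball Ω s p u →
      eLpNorm (fun x => u x - ⨍ y in Ω, u y) (ENNReal.ofReal q) (volume.restrict Ω)
      ≤ ENNReal.ofReal C * ballNorm Ω s p u) {x0 : Eu 2} (hx0 : x0 ∈ Ω) :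
    ∃ C' > 0, ∀ x ∈ Ω, ∀ w ρ, 0 < ρ → ρ < infDist x0 Ωᶜ / 4 → x0 ∉ closedBall w ρ →
      ¬ JoinedIn (Ω \ closedBall w ρ) x0 x → dist x w ≤ C' * ρ := by
  obtain ⟨K, hK, h⟩ := comp_est hΩ hb hs hs1 hp hq hC0 hC hx0
  have hsq : 0 < s * q := by positivity
  set M : ℝ := (4 * K) ^ (1 / (s * q)) with hM
  have hMpos : 0 < M := by positivity
  have hM1 : K * M ^ (-(s * q)) = 1 / 4 := by
    rw [hM, ← Real.rpow_mul (by positivity), mul_neg, one_div_mul_cancel hsq.ne', Real.rpow_neg (by positivity),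
      Real.rpow_one]
    field_simp
  set K1 : ℝ := K * (4 * Real.pi) ^ (q / p) with hK1
  have hK1pos : 0 < K1 := by have := Real.pi_pos; positivity
  refine ⟨2 + 2 * M * Real.sqrt K1, by positivity, ?_⟩
  intro x hx w ρ hρ hρD hx0w hnj
  set V := Ω \ closedBall w ρ with hV
  have hVo : IsOpen V := hΩ.sdiff isClosed_closedBall
  set T := pathComponentIn V x with hT
  have hTo : IsOpen T := hVo.pathComponentIn x
  have hTV : T ⊆ V := pathComponentIn_subset
  have hTΩ : T ⊆ Ω := hTV.trans sdiff_subset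
  have h' := h x w ρ hρ.le hρD hx0w hnj
  have hTfin : ∀ a, volume (T \ ball w a) ≠ ⊤ := fun a =>
    ((measure_mono (sdiff_subset.trans hTΩ)).trans_lt hb.measure_lt_top).ne
  set A := Real.sqrt K1 * ρ with hA
  have hApos : 0 < A := by positivity
  have init : volume.real (T \ ball w (2 * ρ)) ≤ A ^ 2 := by
    have h1 := h' ρ ρ le_rfl hρ _ (Or.inl rfl)
    rw [← two_mul] at h1
    refine h1.trans ?_
    have h2 : volume.real (closedBall w (2 * ρ) ∩ Ω) ≤ 4 * Real.pi * ρ ^ 2 := by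
      refine (measureReal_mono inter_subset_left measure_closedBall_lt_top.ne).trans ?_
      rw [vol_cball2 _ (by positivity)]; apply le_of_eq; ring
    have hpi := Real.pi_pos
    calc K * ρ ^ (-(s * q)) * volume.real (closedBall w (2 * ρ) ∩ Ω) ^ (q / p)
        ≤ K * ρ ^ (-(s * q)) * (4 * Real.pi * ρ ^ 2) ^ (q / p) := by gcongr
      _ = K1 * (ρ ^ (-(s * q)) * (ρ ^ (2:ℝ)) ^ (q/p)) := by
          rw [Real.mul_rpow (by positivity) (by positivity), hK1, Real.rpow_two]; ring
      _ = K1 * ρ ^ 2 := by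
          rw [← Real.rpow_mul hρ.le, ← Real.rpow_add hρ, hqp,
            show -(s * q) + 2 * (1 + s * q / 2) = 2 by ring, Real.rpow_two]
      _ = A ^ 2 := by rw [hA, mul_pow, Real.sq_sqrt hK1pos.le]
  have step : ∀ j : ℕ, volume.real (T \ ball w (2 * ρ + 2 * M * (A - A * (1/2)^j))) ≤ (A * (1/2)^j) ^ 2 := by
    intro j
    induction j with
    | zero => simpa using init
    | succ j ih =>
      set B := A * (1/2)^j with hB
      have hBpos : 0 < B := by positivity
      have hBs : A * (1/2)^(j+1) = B / 2 := by rw [hB, pow_succ]; ring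
      have hBA : B ≤ A := by
        rw [hB]; exact mul_le_of_le_one_right hApos.le (pow_le_one₀ (by norm_num) (by norm_num))
      rw [hBs]
      have h1 := h' (2 * ρ + 2 * M * (A - B)) (M * B) (by nlinarith) (by positivity) _ (Or.inr rfl)
      rw [show 2 * ρ + 2 * M * (A - B) + M * B = 2 * ρ + 2 * M * (A - B / 2) by ring,
        inter_eq_self_of_subset_left (sdiff_subset.trans hTΩ)] at h1
      refine h1.trans ?_
      calc _ ≤ K * (M * B) ^ (-(s * q)) * (B ^ 2) ^ (q / p) := by gcongr
        _ = (K * M ^ (-(s * q))) * (B ^ (-(s * q)) * (B ^ (2:ℝ)) ^ (q/p)) := by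
          rw [Real.mul_rpow (by positivity) (by positivity), Real.rpow_two]; ring
        _ = (1/4) * B ^ 2 := by
          rw [← Real.rpow_mul hBpos.le, ← Real.rpow_add hBpos, hqp,
            show -(s * q) + 2 * (1 + s * q / 2) = 2 by ring, Real.rpow_two, hM1]
        _ = (B / 2) ^ 2 := by ring
  have hbz : volume.real (T \ ball w (2 * ρ + 2 * M * A)) = 0 := by
    refine le_antisymm ?_ measureReal_nonneg
    have hle : ∀ j : ℕ, volume.real (T \ ball w (2 * ρ + 2 * M * A)) ≤ (A * (1/2)^j) ^ 2 := by
      intro j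
      refine (measureReal_mono ?_ (hTfin _)).trans (step j)
      refine sdiff_subset_sdiff_right (ball_subset_ball ?_)
      have : 0 < A * (1/2:ℝ)^j := by positivity
      nlinarith
    have hlim : Filter.Tendsto (fun j : ℕ => (A * (1/2:ℝ)^j) ^ 2) Filter.atTop (nhds 0) := by
      have := (((tendsto_pow_atTop_nhds_zero_of_lt_one (r := (1/2:ℝ)) (by norm_num) (by norm_num)).const_mul A).pow 2)
      simpa using this
    exact ge_of_tendsto' hlim hle
  by_contra hcon
  rw [not_le] at hcon
  have e : (2 + 2 * M * Real.sqrt K1) * ρ = 2 * ρ + 2 * M * A := by rw [hA]; ring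
  rw [e] at hcon
  have hxV : x ∈ V := ⟨hx, by rw [mem_closedBall, not_le]; nlinarith [mul_pos hMpos hApos]⟩
  have hxT : x ∈ T := mem_pathComponentIn_self hxV
  have hopen : IsOpen (T \ closedBall w (2 * ρ + 2 * M * A)) := hTo.sdiff isClosed_closedBall
  have hpos := hopen.measure_pos volume ⟨x, hxT, by simpa using hcon⟩
  have hz : volume (T \ ball w (2 * ρ + 2 * M * A)) = 0 := by
    rwa [measureReal_eq_zero_iff (hTfin _)] at hbz
  exact hpos.ne' (measure_mono_null (sdiff_subset_sdiff_right ball_subset_closedBall) hz)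

lemma sep_lemma {Ω : Set (Eu 2)} (hΩ : IsOpen Ω) (hcon : IsConnected Ω) (hb : Bornology.IsBounded Ω) {s p q C : ℝ}
    (hs : 0 < s) (hs1 : s ≤ 1) (hp : 0 < p) (hq : 0 < q) (hqp : q / p = 1 + s * q / 2) (hC0 : 0 < C)
    (hC : ∀ u : Eu 2 → ℝ, MemMball Ω s p u →
      eLpNorm (fun x => u x - ⨍ y in Ω, u y) (ENNReal.ofReal q) (volume.restrict Ω)
      ≤ ENNReal.ofReal C * ballNorm Ω s p u) {x0 : Eu 2} (hx0 : x0 ∈ Ω) :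
    ∃ C' > 0, ∀ x ∈ Ω, ∀ w ρ, 0 < ρ → infDist w Ωᶜ ≤ ρ →
      ¬ JoinedIn (Ω \ closedBall w ρ) x0 x → dist x w ≤ C' * ρ := by
  have hne := compl_nonempty_of_bdd hb
  set D := infDist x0 Ωᶜ with hD
  have hDpos : 0 < D := (hΩ.isClosed_compl.notMem_iff_infDist_pos hne).1 (by simpa using hx0)
  obtain ⟨C1, hC1, h1⟩ := sep_small hΩ hb hs hs1 hp hq hqp hC0 hC hx0
  have hpc : IsPathConnected Ω := (hΩ.isConnected_iff_isPathConnected).1 hcon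
  refine ⟨C1 + (4 * diam Ω / D + 1), by have := diam_nonneg (s := Ω); positivity, ?_⟩
  intro x hx w ρ hρ hwρ hnj
  have hd0 := diam_nonneg (s := Ω)
  rcases lt_or_ge ρ (D / 4) with hlt | hge
  · have : dist x w ≤ C1 * ρ := by
      refine h1 x hx w ρ hρ hlt ?_ hnj
      rw [mem_closedBall, not_le]
      have := infDist_le_infDist_add_dist (s := Ωᶜ) (x := x0) (y := w)
      linarith
    have h2 : 0 ≤ (4 * diam Ω / D + 1) * ρ := by positivity
    linarith
  · have hmeet : (Ω ∩ closedBall w ρ).Nonempty := by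
      by_contra hcc
      rw [not_nonempty_iff_eq_empty, ← disjoint_iff_inter_eq_empty] at hcc
      rw [hcc.sdiff_eq_left] at hnj
      exact hnj (hpc.joinedIn x0 hx0 x hx)
    obtain ⟨z, hz1, hz2⟩ := hmeet
    have h3 : dist x w ≤ dist x z + dist z w := dist_triangle _ _ _
    have h4 := dist_le_diam_of_mem hb hx hz1
    rw [mem_closedBall] at hz2
    have h5 : diam Ω ≤ 4 * diam Ω / D * ρ := by
      rw [div_mul_eq_mul_div, le_div_iff₀ hDpos]; nlinarith
    have h6 : 0 ≤ C1 * ρ := by positivity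
    linarith


lemma step_lemma {Ω : Set (Eu 2)} (hΩ : IsOpen Ω) (hb : Bornology.IsBounded Ω)
    (hsc : SimplyConnectedSpace Ω) {x0 : Eu 2} (hx0 : x0 ∈ Ω) {C : ℝ} (hC : 0 < C)
    (hsep : ∀ x ∈ Ω, ∀ w ρ, 0 < ρ → infDist w Ωᶜ ≤ ρ →
      ¬ JoinedIn (Ω \ closedBall w ρ) x0 x → dist x w ≤ C * ρ) {Dm : ℝ} (hDm : ∀ x ∈ Ω, infDist x Ωᶜ < Dm) :
    ∃ K > 0, ∃ η > 0, ∀ x ∈ Ω, ∃ x1 ∈ Ω, (x1 = x0 ∨ 2 * infDist x Ωᶜ ≤ infDist x1 Ωᶜ) ∧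
      ∃ ℓ ≤ K * infDist x Ωᶜ, CurveIn {z | η * infDist x Ωᶜ ≤ infDist z Ωᶜ} ℓ x x1 := by
  have hne := compl_nonempty_of_bdd hb
  have hdpos : ∀ x, x ∈ Ω ↔ 0 < infDist x Ωᶜ := fun x => by
    rw [← hΩ.isClosed_compl.notMem_iff_infDist_pos hne]; simp
  set D := infDist x0 Ωᶜ with hD
  have hDpos : 0 < D := (hdpos x0).1 hx0
  have hDmpos : 0 < Dm := hDpos.trans (hDm x0 hx0)
  set ε : ℝ := min (1 / (2 * (2 * C + 1))) (D / Dm) with hε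
  have hεpos : 0 < ε := by positivity
  have hε1 : 2 * C * ε + ε ≤ 1 / 2 := by
    have : ε ≤ 1 / (2 * (2 * C + 1)) := min_le_left _ _
    calc 2 * C * ε + ε = (2 * C + 1) * ε := by ring
      _ ≤ (2 * C + 1) * (1 / (2 * (2 * C + 1))) := by gcongr
      _ = 1 / 2 := by field_simp
  have hε2 : ∀ x ∈ Ω, ε * infDist x Ωᶜ < D := by
    intro x hx
    have : ε ≤ D / Dm := min_le_right _ _
    calc ε * infDist x Ωᶜ < ε * Dm := by gcongr; exact hDm x hx
      _ ≤ D / Dm * Dm := by gcongr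
      _ = D := by field_simp
  have hdiam := diam_nonneg (s := Ω)
  set R : ℝ := 4 * C + 2 * diam Ω / D + 1 with hR
  have hRpos : 0 < R := by positivity
  have hR1 : 4 * C < R := by
    have : 0 ≤ 2 * diam Ω / D := by positivity
    linarith
  have hR2 : diam Ω < R * (D / 2) := by
    calc diam Ω = 2 * diam Ω / D * (D / 2) := by field_simp
      _ < R * (D / 2) := by gcongr; linarith
  obtain ⟨K, hK, hchain⟩ := chain_lemma R (ε / 2) (by positivity)
  refine ⟨K, hK, ε / 2, by positivity, ?_⟩
  intro x hx
  set r := infDist x Ωᶜ with hr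
  have hrpos : 0 < r := (hdpos x).1 hx
  have hdc : Continuous fun y : Eu 2 => infDist y Ωᶜ := continuous_infDist_pt _
  set N : Set (Eu 2) := {y | infDist y Ωᶜ ≤ ε * r} ∪ ({y | infDist y Ωᶜ ≤ 2 * r} ∩ {y | R * r ≤ dist y x}) with hN
  have hNc : IsClosed N := by
    refine (isClosed_le hdc continuous_const).union ((isClosed_le hdc continuous_const).inter
      (isClosed_le continuous_const (by fun_prop)))
  have hj : JoinedIn Nᶜ x x0 := by
    refine gate Ω hΩ hb hsc N hNc ?_ ?_ ?_ ?_
    · intro y hy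
      left
      rw [mem_ofPred_eq, infDist_zero_of_mem hy]; positivity
    · rintro (h | ⟨-, h⟩)
      · rw [mem_ofPred_eq, ← hr] at h; nlinarith
      · rw [mem_ofPred_eq, dist_self] at h; nlinarith
    · rintro (h | ⟨h, h'⟩)
      · exact absurd h (not_le.2 (hε2 x hx))
      · rw [mem_ofPred_eq] at h h'
        have h1 := dist_le_diam_of_mem hb hx0 hx
        rw [← hD] at h
        nlinarith
    · rintro y (h | ⟨h, h'⟩)
      · rw [mem_ofPred_eq] at h
        refine ⟨2 * ε * r, by nlinarith, ?_⟩
        by_contra hnj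
        have h1 := hsep x hx y (2 * ε * r) (by positivity) (by nlinarith) hnj
        have h2 := infDist_le_infDist_add_dist (s := Ωᶜ) (x := x) (y := y)
        nlinarith
      · rw [mem_ofPred_eq] at h h'
        refine ⟨4 * r, by linarith, ?_⟩
        by_contra hnj
        have h1 := hsep x hx y (4 * r) (by positivity) (by linarith) hnj
        rw [dist_comm] at h1
        nlinarith
  obtain ⟨γ, hγ⟩ := hj
  set f : ℝ → ℝ := fun t => infDist (γ.extend t) Ωᶜ with hf
  have hfc : Continuous f := hdc.comp γ.continuous_extend
  have hγN : ∀ t : ℝ, γ.extend t ∉ N := by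
    intro t
    have : γ.extend t ∈ range γ := by rw [← γ.extend_range]; exact mem_range_self t
    obtain ⟨u, hu⟩ := this
    rw [← hu]; exact hγ u
  have hf0 : f 0 = r := by simp [hf, hr]
  have hεf : ∀ t, ε * r < f t := by
    intro t
    by_contra hh
    exact hγN t (Or.inl (not_lt.1 hh))
  have hdist : ∀ t, f t ≤ 2 * r → dist (γ.extend t) x < R * r := by
    intro t ht
    by_contra hh
    exact hγN t (Or.inr ⟨ht, not_lt.1 hh⟩)
  have ivt : ∀ t, 0 ≤ t → (∀ u ∈ Icc 0 t, f u ≠ 2 * r) → f t ≤ 2 * r := by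
    intro t ht hu
    by_contra hh
    obtain ⟨u, hu1, hu2⟩ := intermediate_value_Icc ht hfc.continuousOn (show 2 * r ∈ Icc (f 0) (f t) from
      ⟨by rw [hf0]; linarith, (not_le.1 hh).le⟩)
    exact hu u hu1 hu2
  have main : ∀ t0, 0 ≤ t0 → (∀ t ∈ Icc 0 t0, f t ≤ 2 * r) →
      ∃ ℓ ≤ K * r, CurveIn {z | ε / 2 * r ≤ infDist z Ωᶜ} ℓ x (γ.extend t0) := by
    intro t0 ht0 hle
    set S := γ.extend '' Icc 0 t0 with hS
    obtain ⟨ℓ, hℓ, h0, g, g1, g2, g3, g4⟩ := hchain x r hrpos S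
      (isPreconnected_Icc.image _ γ.continuous_extend.continuousOn) (by
        rintro _ ⟨t, ht, rfl⟩
        exact (hdist t (hle t ht)).le) x ⟨0, ⟨le_rfl, ht0⟩, by simp⟩ (γ.extend t0) ⟨t0, ⟨ht0, le_rfl⟩, rfl⟩
    refine ⟨ℓ, hℓ, h0, g, g1, g2, g3, fun t ht => ?_⟩
    obtain ⟨y, ⟨u, hu, rfl⟩, hy⟩ := g4 t ht
    have h1 := infDist_le_infDist_add_dist (s := Ωᶜ) (x := γ.extend u) (y := g t)
    have h2 := hεf u
    simp only [hf] at h2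
    rw [dist_comm] at hy
    rw [mem_ofPred_eq]; linarith
  by_cases hex : ∃ t ∈ Icc (0:ℝ) 1, f t = 2 * r
  · set Z := {t | t ∈ Icc (0:ℝ) 1 ∧ f t = 2 * r} with hZ
    have hZc : IsCompact Z := by
      refine isCompact_Icc.of_isClosed_subset ?_ (fun t ht => ht.1)
      exact isClosed_Icc.inter (isClosed_eq hfc continuous_const)
    obtain ⟨t0, ht0, hmin⟩ := hZc.exists_isLeast hex
    refine ⟨γ.extend t0, (hdpos _).2 ?_, Or.inr ht0.2.ge, main t0 ht0.1.1 ?_⟩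
    · change 0 < f t0; rw [ht0.2]; positivity
    · intro t ht
      rcases ht.2.eq_or_lt with h | h
      · rw [h, ht0.2]
      · refine ivt t ht.1 fun u hu he => ?_
        have := hmin (show u ∈ Z from ⟨⟨hu.1, hu.2.trans (ht.2.trans ht0.1.2)⟩, he⟩)
        linarith [hu.2]
  · push Not at hex
    refine ⟨x0, hx0, Or.inl rfl, ?_⟩
    have := main 1 zero_le_one (fun t ht => ivt t ht.1 fun u hu => hex u ⟨hu.1, hu.2.trans ht.2⟩)
    simpa using this

lemma john_of_step {Ω : Set (Eu 2)} (hΩ : IsOpen Ω) (hb : Bornology.IsBounded Ω)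
    {x0 : Eu 2} (hx0 : x0 ∈ Ω) {Dm : ℝ} (hDm : ∀ x ∈ Ω, infDist x Ωᶜ < Dm)
    {K η : ℝ} (hK : 0 < K) (hη : 0 < η) (h : ∀ x ∈ Ω, ∃ x1 ∈ Ω, (x1 = x0 ∨ 2 * infDist x Ωᶜ ≤ infDist x1 Ωᶜ) ∧
      ∃ ℓ ≤ K * infDist x Ωᶜ, CurveIn {z | η * infDist x Ωᶜ ≤ infDist z Ωᶜ} ℓ x x1) : IsJohnDomain Ω := by
  have hne := compl_nonempty_of_bdd hb
  have hdpos : ∀ x, x ∈ Ω ↔ 0 < infDist x Ωᶜ := fun x => by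
    rw [← hΩ.isClosed_compl.notMem_iff_infDist_pos hne]; simp
  set c := η / (2 * K) with hc
  have hcpos : 0 < c := by positivity
  have hcη : c * (2 * K) = η := by rw [hc]; field_simp
  have claim : ∀ n : ℕ, ∀ x ∈ Ω, Dm / 2 ^ n ≤ infDist x Ωᶜ → ∃ ℓ : ℝ, 0 ≤ ℓ ∧ ∃ γ : ℝ → Eu 2,
      LipschitzOnWith 1 γ (Icc 0 ℓ) ∧ γ 0 = x ∧ γ ℓ = x0 ∧
      ∀ t ∈ Icc 0 ℓ, c * (t + K * infDist x Ωᶜ) ≤ infDist (γ t) Ωᶜ := by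
    intro n
    induction n with
    | zero => intro x hx h1; have := hDm x hx; simp at h1; linarith
    | succ n ih =>
      intro x hx h1
      obtain ⟨x1, hx1, hor, ℓ, hℓ, h0, g, g1, g2, g3, g4⟩ := h x hx
      have g4' : ∀ t ∈ Icc 0 ℓ, c * (t + K * infDist x Ωᶜ) ≤ infDist (g t) Ωᶜ := by
        intro t ht
        refine le_trans ?_ (g4 t ht)
        have : t + K * infDist x Ωᶜ ≤ 2 * K * infDist x Ωᶜ := by linarith [ht.2]
        calc _ ≤ c * (2 * K * infDist x Ωᶜ) := by gcongr
          _ = _ := by rw [← mul_assoc, hcη]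
      rcases hor with rfl | hor
      · exact ⟨ℓ, h0, g, g1, g2, g3, g4'⟩
      · obtain ⟨ℓ2, hℓ2, g', k1, k2, k3, k4⟩ := ih x1 hx1 (by
          rw [pow_succ, ← div_div, div_le_iff₀ (by norm_num)] at h1; linarith)
        obtain ⟨G, G1, G2, G3⟩ := glue_curves h0 hℓ2 g1 k1 (by rw [g3, k2])
        refine ⟨ℓ + ℓ2, by positivity, G, G1, by rw [G2 0 h0, g2], by rw [G3 _ (by linarith)]; simpa using k3, ?_⟩
        intro t ht
        rcases le_total t ℓ with h2 | h2
        · rw [G2 t h2]; exact g4' t ⟨ht.1, h2⟩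
        · rw [G3 t h2]
          refine le_trans ?_ (k4 (t - ℓ) ⟨by linarith, by linarith [ht.2]⟩)
          refine mul_le_mul_of_nonneg_left ?_ hcpos.le
          nlinarith
  refine ⟨x0, hx0, c, hcpos, fun x hx => ?_⟩
  have hxpos := (hdpos x).1 hx
  obtain ⟨n, hn⟩ := exists_nat_gt (Dm / infDist x Ωᶜ)
  have hn2 : Dm / 2 ^ n ≤ infDist x Ωᶜ := by
    rw [div_lt_iff₀ hxpos] at hn
    rw [div_le_iff₀ (by positivity)]
    have : (n : ℝ) ≤ 2 ^ n := by exact_mod_cast Nat.lt_two_pow_self.le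
    nlinarith
  obtain ⟨ℓ, h0, g, g1, g2, g3, g4⟩ := claim n x hx hn2
  refine ⟨ℓ, h0, g, g1, g2, g3, fun t ht => ?_⟩
  have h1 := g4 t ht
  have h2 : 0 < c * (K * infDist x Ωᶜ) := by positivity
  have h3 : 0 ≤ c * t := mul_nonneg hcpos.le ht.1
  rw [mul_add] at h1
  exact ⟨(hdpos _).2 (by linarith), by linarith⟩

lemma infDist_bound {Ω : Set (Eu 2)} (hb : Bornology.IsBounded Ω) : ∃ Dm, ∀ x ∈ Ω, infDist x Ωᶜ < Dm := by
  obtain ⟨z, hz⟩ := compl_nonempty_of_bdd hb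
  obtain ⟨R, hR⟩ := hb.subset_closedBall z
  refine ⟨R + 1, fun x hx => ?_⟩
  have := infDist_le_dist_of_mem (x := x) hz
  have h2 := hR hx
  rw [mem_closedBall] at h2; linarith

/-- HSP implies John. -/
theorem john_of_hsp {Ω : Set (Eu 2)} (hΩ : IsDomainEu Ω) (hb : Bornology.IsBounded Ω)
    (hsc : SimplyConnectedSpace Ω) {s p : ℝ} (hs : 0 < s) (hs1 : s ≤ 1) (hp : 0 < p) (hp2 : p < 2 / s)
    (h : SupportsHSP Ω s p) : IsJohnDomain Ω := by
  obtain ⟨C, hC0, hC⟩ := h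
  obtain ⟨x0, hx0⟩ := hΩ.2.nonempty
  have hps : p * s < 2 := by rwa [lt_div_iff₀ hs] at hp2
  have h2ps : 0 < 2 - p * s := by linarith
  obtain ⟨C', hC', hsep⟩ := sep_lemma (q := p * 2 / (2 - p * s)) hΩ.1 hΩ.2 hb hs hs1 hp (by positivity)
    (by field_simp; ring) hC0 (by simpa using hC) hx0
  obtain ⟨Dm, hDm⟩ := infDist_bound hb
  obtain ⟨K, hK, η, hη, hst⟩ := step_lemma hΩ.1 hb hsc hx0 hC' hsep hDm
  exact john_of_step hΩ.1 hb hx0 hDm hK hη hst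


lemma exists_small {U N : Set (Eu 2)} {g : Eu 2 → ℝ} {y : Eu 2} {R lam W p : ℝ} (hp : 0 < p) (hR : 0 ≤ R)
    (hlam : 0 ≤ lam) (hU : ball y R ⊆ U) (hN : volume N = 0)
    (hW : ∫⁻ z in U, ENNReal.ofReal (g z ^ p) ≤ ENNReal.ofReal W) (hW0 : 0 ≤ W)
    (h : W < lam ^ p * (Real.pi * R ^ 2)) : ∃ z ∈ ball y R, z ∉ N ∧ g z ≤ lam := by
  by_contra hcon
  push Not at hcon
  have h1 : ∫⁻ z in ball y R, ENNReal.ofReal (lam ^ p) ≤ ∫⁻ z in ball y R, ENNReal.ofReal (g z ^ p) := by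
    refine lintegral_mono_ae ?_
    have hNae : ∀ᵐ z ∂(volume.restrict (ball y R)), z ∉ N :=
      ae_restrict_of_ae (measure_eq_zero_iff_ae_notMem.1 hN)
    filter_upwards [hNae, ae_restrict_mem measurableSet_ball] with z hz1 hz2
    refine ENNReal.ofReal_le_ofReal (Real.rpow_le_rpow hlam (hcon z hz2 hz1).le hp.le)
  have h2 := h1.trans ((lintegral_mono_set hU).trans hW)
  rw [setLIntegral_const] at h2
  have h3 : volume (ball y R) = ENNReal.ofReal (Real.pi * R ^ 2) := by
    rw [← vol_ball2 y hR, Measure.real, ENNReal.ofReal_toReal measure_ball_lt_top.ne]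
  rw [h3, ← ENNReal.ofReal_mul (by positivity), ENNReal.ofReal_le_ofReal_iff hW0] at h2
  linarith

set_option maxHeartbeats 1000000 in
/-- Local pointwise estimate. -/
lemma local_pointwise {s p q : ℝ} (hs : 0 < s) (hs1 : s ≤ 1) (hp : 0 < p) (hps : p * s < 2)
    (hq : q = p * 2 / (2 - p * s)) :
    ∃ B ≥ 1, ∃ A > 0, ∀ (u g : Eu 2 → ℝ) (N : Set (Eu 2)) (x : Eu 2) (ρ W : ℝ), 0 < ρ → 0 < W → volume N = 0 →
      (∀ y, 0 ≤ g y) →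
      (∀ y ∈ ball x (2 * ρ) \ N, ∀ z ∈ ball x (2 * ρ) \ N, |u y - u z| ≤ dist y z ^ s * (g y + g z)) →
      ∫⁻ z in ball x (2 * ρ), ENNReal.ofReal (g z ^ p) ≤ ENNReal.ofReal W →
      ∀ y0 ∈ ball x ρ \ N, g y0 ^ p ≤ B * W / ρ ^ 2 →
      ∀ y ∈ closedBall x ρ \ N, |u y - u y0| ^ q ≤ A * (W ^ (q / p) / ρ ^ 2 + W ^ (q / p - 1) * g y ^ p) := by
  have h2ps : 0 < 2 - p * s := by linarith
  have hqpos : 0 < q := by rw [hq]; positivity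
  set θ : ℝ := (2:ℝ) ^ (-(p / 2)) with hθ
  have hθ0 : 0 < θ := by positivity
  have hθ1 : θ < 1 := Real.rpow_lt_one_of_one_lt_of_neg (by norm_num) (by linarith)
  set β : ℝ := (2:ℝ) ^ (1 - p * s / 2) with hβ
  have hβ1 : 1 < β := Real.one_lt_rpow (by norm_num) (by linarith)
  have hβθ : 2 * θ ^ s = β := by
    rw [hθ, hβ, ← Real.rpow_mul (by norm_num)]
    nth_rewrite 1 [← Real.rpow_one 2]
    rw [← Real.rpow_add (by norm_num)]; congr 1; ring
  have hθp : θ ^ 2 * 2 ^ p = 1 := by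
    rw [hθ, ← Real.rpow_two, ← Real.rpow_mul (by norm_num), ← Real.rpow_add (by norm_num)]
    rw [show -(p/2) * 2 + p = 0 by ring, Real.rpow_zero]
  set B : ℝ := 1 / (1 - θ) ^ 2 with hB
  have h1θ : 0 < 1 - θ := by linarith
  have hB1 : 1 ≤ B := by
    rw [hB, le_div_iff₀ (by positivity), one_mul]
    exact pow_le_one₀ h1θ.le (by linarith)
  have hBθ : (1 - θ) ^ 2 * B = 1 := by rw [hB]; field_simp
  set A0 : ℝ := 8 + 3 / (β - 1) with hA0
  have hβ1' : 0 < β - 1 := by linarith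
  have hA0pos : 0 < A0 := by positivity
  have hA0β : A0 + 3 ≤ A0 * β := by
    have : 3 / (β - 1) * (β - 1) = 3 := by field_simp
    nlinarith
  refine ⟨B, hB1, A0 ^ q * B ^ (q / p) * (1 + 2 ^ p / B), by positivity, ?_⟩
  intro u g N x ρ W hρ hW hN hg0 hH hint y0 hy0 hgy0
  set lam : ℝ := (B * W / ρ ^ 2) ^ (1 / p) with hlam
  have hlampos : 0 < lam := by positivity
  have hlamp : lam ^ p = B * W / ρ ^ 2 := by
    rw [hlam, ← Real.rpow_mul (by positivity), one_div_mul_cancel hp.ne', Real.rpow_one]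
  have hgy0' : g y0 ≤ lam := by
    rw [← hlamp] at hgy0
    exact (Real.rpow_le_rpow_iff (hg0 _) hlampos.le hp).1 hgy0
  have claim : ∀ k : ℕ, ∀ y, y ∉ N → y ∈ ball x (2 * ρ) → dist y x ≤ ρ * (1 + θ ^ k) → g y ≤ lam * 2 ^ k →
      |u y - u y0| ≤ A0 * ρ ^ s * lam * β ^ k := by
    intro k
    induction k with
    | zero =>
      intro y hy hyb hyd hgy
      simp at hgy
      have hy0b : y0 ∈ ball x (2 * ρ) := ball_subset_ball (by linarith) hy0.1
      have h1 := hH y ⟨hyb, hy⟩ y0 ⟨hy0b, hy0.2⟩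
      have h2 : dist y y0 ≤ 4 * ρ := by
        have := dist_triangle_right y y0 x
        rw [mem_ball] at hyb hy0b; linarith
      have h3 : dist y y0 ^ s ≤ 4 * ρ ^ s := by
        calc dist y y0 ^ s ≤ (4 * ρ) ^ s := by gcongr
          _ = 4 ^ s * ρ ^ s := Real.mul_rpow (by norm_num) hρ.le
          _ ≤ 4 * ρ ^ s := by
            gcongr
            calc (4:ℝ) ^ s ≤ 4 ^ (1:ℝ) := Real.rpow_le_rpow_of_exponent_le (by norm_num) hs1
              _ = 4 := by simp
      calc |u y - u y0| ≤ _ := h1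
        _ ≤ 4 * ρ ^ s * (lam + lam) := by
          have := hg0 y; have := hg0 y0
          gcongr
        _ = 8 * (ρ ^ s * lam) := by ring
        _ ≤ A0 * (ρ ^ s * lam) := by
          gcongr; rw [hA0]; have : 0 < 3 / (β - 1) := by positivity
          linarith
        _ = _ := by simp; ring
    | succ k ih =>
      intro y hy hyb hyd hgy
      have hθk : θ ^ k ≤ 1 := pow_le_one₀ hθ0.le hθ1.le
      have hθkpos : 0 < θ ^ k := by positivity
      set R := ρ * θ ^ k * (1 - θ) with hR
      have hRpos : 0 < R := by positivity
      have hRsum : ρ * (1 + θ ^ (k+1)) + R = ρ * (1 + θ ^ k) := by rw [hR, pow_succ]; ring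
      have hsub : ball y R ⊆ ball x (2 * ρ) := by
        refine ball_subset_ball' ?_
        have : ρ * (1 + θ ^ k) ≤ ρ * 2 := by gcongr; linarith
        linarith
      obtain ⟨z, hz1, hz2, hz3⟩ := exists_small hp hRpos.le (lam := lam * 2 ^ k) (by positivity) hsub hN hint hW.le (by
        have e : (lam * 2 ^ k) ^ p * (Real.pi * R ^ 2) = Real.pi * W := by
          have e1 : ((2:ℝ) ^ k) ^ p = (2 ^ p) ^ k := by
            rw [← Real.rpow_natCast, ← Real.rpow_mul (by norm_num), mul_comm, Real.rpow_mul (by norm_num), Real.rpow_natCast]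
          rw [Real.mul_rpow hlampos.le (by positivity), hlamp, e1, hR]
          calc B * W / ρ ^ 2 * (2 ^ p) ^ k * (Real.pi * (ρ * θ ^ k * (1 - θ)) ^ 2)
              = Real.pi * W * (((1 - θ) ^ 2 * B)) * ((θ ^ 2 * 2 ^ p) ^ k) * (ρ ^ 2 / ρ ^ 2) := by
                rw [mul_pow (θ ^ 2)]; ring
            _ = Real.pi * W := by rw [hBθ, hθp, div_self (by positivity)]; simp
        rw [e]
        have := Real.pi_gt_three
        nlinarith)
      have h1 := ih z hz2 (hsub hz1) (by
        rw [mem_ball] at hz1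
        have := dist_triangle z y x
        linarith) hz3
      have h2 := hH y ⟨hyb, hy⟩ z ⟨hsub hz1, hz2⟩
      have h3 : dist y z ^ s ≤ ρ ^ s * (θ ^ s) ^ k := by
        have e1 : (θ ^ s) ^ k = (θ ^ k) ^ s := by
          rw [← Real.rpow_natCast, ← Real.rpow_mul hθ0.le, mul_comm, Real.rpow_mul hθ0.le, Real.rpow_natCast]
        rw [e1, ← Real.mul_rpow hρ.le hθkpos.le]
        gcongr
        rw [dist_comm]
        refine (mem_ball.1 hz1).le.trans ?_
        rw [hR]; exact mul_le_of_le_one_right (by positivity) (by linarith)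
      have h4 : |u y - u z| ≤ 3 * ρ ^ s * lam * β ^ k := by
        calc |u y - u z| ≤ _ := h2
          _ ≤ (ρ ^ s * (θ ^ s) ^ k) * (lam * 2 ^ (k+1) + lam * 2 ^ k) := by
            have := hg0 y; have := hg0 z
            gcongr
          _ = 3 * ρ ^ s * lam * (2 * θ ^ s) ^ k := by rw [mul_pow, pow_succ]; ring
          _ = _ := by rw [hβθ]
      calc |u y - u y0| ≤ |u y - u z| + |u z - u y0| := abs_sub_le _ _ _
        _ ≤ 3 * ρ ^ s * lam * β ^ k + A0 * ρ ^ s * lam * β ^ k := add_le_add h4 h1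
        _ = (A0 + 3) * (ρ ^ s * lam * β ^ k) := by ring
        _ ≤ (A0 * β) * (ρ ^ s * lam * β ^ k) := by gcongr
        _ = _ := by rw [pow_succ]; ring
  intro y hy
  have hyb : y ∈ ball x (2 * ρ) := closedBall_subset_ball (by linarith) hy.1
  have hyd : ∀ k : ℕ, dist y x ≤ ρ * (1 + θ ^ k) := by
    intro k
    have := hy.1; rw [mem_closedBall] at this
    have : 0 < ρ * θ ^ k := by positivity
    linarith
  -- the exponent identity
  have hqe : (1 - p * s / 2) * q = p := by rw [hq]; field_simp
  have bound : |u y - u y0| ≤ A0 * ρ ^ s * lam * (max 1 (2 * g y / lam)) ^ (1 - p * s / 2) := by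
    rcases le_or_gt (g y) lam with hle | hgt
    · have h1 := claim 0 y hy.2 hyb (hyd 0) (by simpa using hle)
      refine h1.trans ?_
      rw [pow_zero, mul_one]
      refine le_mul_of_one_le_right (by positivity) (Real.one_le_rpow (le_max_left _ _) (by linarith))
    · obtain ⟨k, hk1, hk2⟩ := exists_nat_pow_near (x := g y / lam) (y := 2) (by rw [le_div_iff₀ hlampos]; linarith) (by norm_num)
      have h1 := claim (k+1) y hy.2 hyb (hyd _) (by rw [div_lt_iff₀ hlampos] at hk2; linarith)
      refine h1.trans ?_
      have e1 : β ^ (k+1) = (2 ^ (k+1)) ^ (1 - p * s / 2) := by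
        rw [hβ, ← Real.rpow_natCast, ← Real.rpow_natCast, ← Real.rpow_mul (by norm_num), ← Real.rpow_mul (by norm_num), mul_comm]
      rw [e1]
      have h5 : (2:ℝ) ^ (k+1) ≤ max 1 (2 * g y / lam) := by
        refine le_trans ?_ (le_max_right _ _)
        rw [pow_succ, mul_div_assoc]; linarith
      have : 0 ≤ 1 - p * s / 2 := by linarith
      gcongr
  have hgy := hg0 y
  have hW1 : W ^ (q / p) = W ^ (q / p - 1) * W := by
    rw [Real.rpow_sub_one hW.ne']; field_simp
  have hρq : ρ ^ (s * q) * lam ^ q = B ^ (q / p) * (W ^ (q / p) / ρ ^ 2) := by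
    have e1 : lam ^ q = (B * W / ρ ^ 2) ^ (q / p) := by
      rw [hlam, ← Real.rpow_mul (by positivity)]; congr 1; ring
    rw [e1, Real.div_rpow (by positivity) (by positivity), Real.mul_rpow (by positivity) hW.le]
    have e2 : (ρ ^ 2) ^ (q / p) = ρ ^ (s * q) * ρ ^ 2 := by
      rw [← Real.rpow_two, ← Real.rpow_mul hρ.le, ← Real.rpow_add hρ]
      congr 1; rw [hq]; field_simp; ring
    rw [e2]; field_simp
  calc |u y - u y0| ^ q ≤ (A0 * ρ ^ s * lam * (max 1 (2 * g y / lam)) ^ (1 - p * s / 2)) ^ q := by gcongr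
    _ = A0 ^ q * (ρ ^ (s * q) * lam ^ q) * (max 1 (2 * g y / lam)) ^ p := by
      rw [Real.mul_rpow (by positivity) (by positivity), Real.mul_rpow (by positivity) hlampos.le,
        Real.mul_rpow (by positivity) (by positivity), ← Real.rpow_mul hρ.le,
        ← Real.rpow_mul (x := max 1 (2 * g y / lam)) (le_max_of_le_left zero_le_one), hqe]; ring
    _ ≤ A0 ^ q * (ρ ^ (s * q) * lam ^ q) * (1 + (2 * g y / lam) ^ p) := by
      gcongr
      rcases max_cases 1 (2 * g y / lam) with ⟨h, -⟩ | ⟨h, -⟩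
      · rw [h, Real.one_rpow]; have : 0 ≤ (2 * g y / lam) ^ p := by positivity
        linarith
      · rw [h]; linarith
    _ = A0 ^ q * B ^ (q / p) * (W ^ (q / p) / ρ ^ 2 + 2 ^ p / B * (W ^ (q / p - 1) * g y ^ p)) := by
      rw [hρq, Real.div_rpow (by positivity) hlampos.le, Real.mul_rpow (by norm_num) hgy, hlamp, hW1]
      field_simp
    _ ≤ A0 ^ q * B ^ (q / p) * ((1 + 2 ^ p / B) * (W ^ (q / p) / ρ ^ 2 + W ^ (q / p - 1) * g y ^ p)) := by
      refine mul_le_mul_of_nonneg_left ?_ (by positivity)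
      have h1 : 0 ≤ W ^ (q / p) / ρ ^ 2 := by positivity
      have h2 : 0 ≤ W ^ (q / p - 1) * g y ^ p := by positivity
      have h3 : 0 ≤ (2:ℝ) ^ p / B := by positivity
      nlinarith
    _ = _ := by ring


lemma local_integral {s p q : ℝ} (hs : 0 < s) (hs1 : s ≤ 1) (hp : 0 < p) (hps : p * s < 2)
    (hq : q = p * 2 / (2 - p * s)) :
    ∃ B ≥ 1, ∃ A > 0, ∀ (u g : Eu 2 → ℝ) (N : Set (Eu 2)) (x : Eu 2) (ρ W : ℝ), 0 < ρ → 0 < W → volume N = 0 →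
      Measurable g → (∀ y, 0 ≤ g y) →
      (∀ y ∈ ball x (2 * ρ) \ N, ∀ z ∈ ball x (2 * ρ) \ N, |u y - u z| ≤ dist y z ^ s * (g y + g z)) →
      ∫⁻ z in ball x (2 * ρ), ENNReal.ofReal (g z ^ p) ≤ ENNReal.ofReal W →
      ∀ y0 ∈ ball x ρ \ N, g y0 ^ p ≤ B * W / ρ ^ 2 →
      ∫⁻ y in closedBall x ρ, ENNReal.ofReal (|u y - u y0| ^ q) ≤ ENNReal.ofReal (A * W ^ (q / p)) := by
  obtain ⟨B, hB, A, hA, h⟩ := local_pointwise hs hs1 hp hps hq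
  have hpi := Real.pi_pos
  refine ⟨B, hB, A * (Real.pi + 1), by positivity, ?_⟩
  intro u g N x ρ W hρ hW hN hgm hg0 hH hint y0 hy0 hgy0
  have h1 := h u g N x ρ W hρ hW hN hg0 hH hint y0 hy0 hgy0
  have hW1 : W ^ (q / p) = W ^ (q / p - 1) * W := by
    rw [Real.rpow_sub_one hW.ne']; field_simp
  calc ∫⁻ y in closedBall x ρ, ENNReal.ofReal (|u y - u y0| ^ q)
      ≤ ∫⁻ y in closedBall x ρ, (ENNReal.ofReal (A * (W ^ (q / p) / ρ ^ 2)) +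
          ENNReal.ofReal (A * W ^ (q / p - 1)) * ENNReal.ofReal (g y ^ p)) := by
        refine lintegral_mono_ae ?_
        have hNae : ∀ᵐ z ∂(volume.restrict (closedBall x ρ)), z ∉ N :=
          ae_restrict_of_ae (measure_eq_zero_iff_ae_notMem.1 hN)
        filter_upwards [hNae, ae_restrict_mem measurableSet_closedBall] with z hz1 hz2
        have hgz := hg0 z
        rw [← ENNReal.ofReal_mul (by positivity), ← ENNReal.ofReal_add (by positivity) (by positivity)]
        refine ENNReal.ofReal_le_ofReal ((h1 z ⟨hz2, hz1⟩).trans (le_of_eq (by ring)))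
    _ = ENNReal.ofReal (A * (W ^ (q / p) / ρ ^ 2)) * volume (closedBall x ρ) +
          ENNReal.ofReal (A * W ^ (q / p - 1)) * ∫⁻ y in closedBall x ρ, ENNReal.ofReal (g y ^ p) := by
        rw [lintegral_add_left measurable_const, setLIntegral_const, lintegral_const_mul]
        exact (hgm.pow_const p).ennreal_ofReal
    _ ≤ ENNReal.ofReal (A * (W ^ (q / p) / ρ ^ 2)) * ENNReal.ofReal (Real.pi * ρ ^ 2) +
          ENNReal.ofReal (A * W ^ (q / p - 1)) * ENNReal.ofReal W := by
        gcongr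
        · rw [← vol_cball2 x hρ.le, Measure.real, ENNReal.ofReal_toReal measure_closedBall_lt_top.ne]
        · exact (lintegral_mono_set (closedBall_subset_ball (by linarith))).trans hint
    _ = ENNReal.ofReal (A * (Real.pi + 1) * W ^ (q / p)) := by
        rw [← ENNReal.ofReal_mul (by positivity), ← ENNReal.ofReal_mul (by positivity),
          ← ENNReal.ofReal_add (by positivity) (by positivity)]
        congr 1
        rw [hW1]; field_simp

def Gset (Ω : Set (Eu 2)) (K : ℝ) (x : Eu 2) : Set (Eu 2) :=
  {y | dist y x ≤ 10 * K * infDist x Ωᶜ ∧ infDist x Ωᶜ / (10 * K) ≤ infDist y Ωᶜ}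

lemma Gset_self {Ω : Set (Eu 2)} {K : ℝ} (hK : 1 ≤ K) (x : Eu 2) :
    ball x (2 * (infDist x Ωᶜ / 20)) ⊆ Gset Ω K x := by
  intro y hy
  rw [mem_ball] at hy
  have h0 := infDist_nonneg (x := x) (s := Ωᶜ)
  have h1 := infDist_le_infDist_add_dist (s := Ωᶜ) (x := x) (y := y)
  rw [dist_comm x y] at h1
  refine ⟨by nlinarith, ?_⟩
  rw [div_le_iff₀ (by positivity)]
  nlinarith

/-- comparability -/
lemma radius_comp {Ω : Set (Eu 2)} {x' z : Eu 2} (h : dist x' z ≤ infDist z Ωᶜ / 20) :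
    19 / 20 * infDist z Ωᶜ ≤ infDist x' Ωᶜ ∧ infDist x' Ωᶜ ≤ 21 / 20 * infDist z Ωᶜ := by
  have h1 := infDist_le_infDist_add_dist (s := Ωᶜ) (x := x') (y := z)
  have h2 := infDist_le_infDist_add_dist (s := Ωᶜ) (x := z) (y := x')
  rw [dist_comm z x'] at h2
  constructor <;> linarith

lemma Gset_next {Ω : Set (Eu 2)} {K : ℝ} (hK : 1 ≤ K) {x x' z : Eu 2}
    (hxx' : dist x' x ≤ K * infDist x Ωᶜ) (hlow : infDist x Ωᶜ / K ≤ infDist x' Ωᶜ)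
    (hup : infDist x' Ωᶜ ≤ 2 * infDist x Ωᶜ) (h : dist x' z ≤ infDist z Ωᶜ / 20) :
    ball z (2 * (infDist z Ωᶜ / 20)) ⊆ Gset Ω K x := by
  intro y hy
  rw [mem_ball] at hy
  have h0 := infDist_nonneg (x := x) (s := Ωᶜ)
  obtain ⟨h1, h2⟩ := radius_comp h
  have h3 := infDist_le_infDist_add_dist (s := Ωᶜ) (x := z) (y := y)
  rw [dist_comm z y] at h3
  refine ⟨?_, ?_⟩
  · have h4 := dist_triangle4 y z x' x
    rw [dist_comm z x'] at h4
    nlinarith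
  · rw [div_le_iff₀ (by positivity)] at hlow ⊢
    nlinarith

set_option maxHeartbeats 2000000 in
lemma chain_est {s p K B : ℝ} (hs : 0 < s) (hp : 0 < p) (hK : 1 ≤ K) (hB : 1 ≤ B) :
    ∃ C0 > 0, ∀ (Ω : Set (Eu 2)) (u g : Eu 2 → ℝ) (N : Set (Eu 2)) (x x' z y1 y2 : Eu 2) (W ℓ : ℝ),
      (∀ x, x ∈ Ω ↔ 0 < infDist x Ωᶜ) → volume N = 0 → (∀ y, 0 ≤ g y) → 0 < W →
      (∀ y ∈ Ω \ N, ∀ z ∈ Ω \ N, dist y z < infDist y Ωᶜ / 2 → |u y - u z| ≤ dist y z ^ s * (g y + g z)) →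
      x ∈ Ω → z ∈ Ω → ℓ ≤ K * infDist x Ωᶜ → CurveIn {z | infDist x Ωᶜ / K ≤ infDist z Ωᶜ} ℓ x x' →
      infDist x' Ωᶜ ≤ 2 * infDist x Ωᶜ → dist x' z ≤ infDist z Ωᶜ / 20 →
      ∫⁻ z in Gset Ω K x, ENNReal.ofReal (g z ^ p) ≤ ENNReal.ofReal W →
      y1 ∈ ball x (infDist x Ωᶜ / 20) \ N → y2 ∈ ball z (infDist z Ωᶜ / 20) \ N →
      g y1 ^ p ≤ B * W / (infDist x Ωᶜ / 20) ^ 2 → g y2 ^ p ≤ B * W / (infDist z Ωᶜ / 20) ^ 2 →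
      |u y1 - u y2| ≤ C0 * (infDist x Ωᶜ ^ s * (W / infDist x Ωᶜ ^ 2) ^ (1 / p)) := by
  obtain ⟨m, hm⟩ := exists_nat_ge (40 * K ^ 2)
  have hmpos : (0:ℝ) < m := by nlinarith
  refine ⟨2 * (m + 2) * (1600 * B * K ^ 2) ^ (1 / p), by positivity, ?_⟩
  intro Ω u g N x x' z y1 y2 W ℓ hdpos hN hg0 hW hH hx hz hℓ hcurve hup hx'z hint hy1 hy2 hg1 hg2
  obtain ⟨hℓ0, γ, γlip, γ0, γ1, γP⟩ := hcurve
  set r := infDist x Ωᶜ with hr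
  have hrpos : 0 < r := (hdpos x).1 hx
  have hKpos : 0 < K := by linarith
  set δ := r / (40 * K) with hδ
  have hδpos : 0 < δ := by positivity
  have hδr : r / K = 40 * δ := by rw [hδ]; field_simp
  have hδr2 : δ ≤ r / 40 := by rw [hδ]; gcongr; linarith
  set dz := infDist z Ωᶜ with hdz
  have hdzpos : 0 < dz := (hdpos z).1 hz
  obtain ⟨c1, c2⟩ := radius_comp hx'z
  rw [← hdz] at c1 c2
  have hx'low : r / K ≤ infDist x' Ωᶜ := by
    have := γP ℓ ⟨hℓ0, le_rfl⟩; rw [γ1] at this; exact this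
  set Λ : ℝ := (1600 * B * K ^ 2 * (W / r ^ 2)) ^ (1 / p) with hΛ
  have hΛpos : 0 < Λ := by positivity
  have hΛp : Λ ^ p = 1600 * B * K ^ 2 * (W / r ^ 2) := by
    rw [hΛ, ← Real.rpow_mul (by positivity), one_div_mul_cancel hp.ne', Real.rpow_one]
  have toΛ : ∀ y, g y ^ p ≤ Λ ^ p → g y ≤ Λ := fun y h =>
    (Real.rpow_le_rpow_iff (hg0 _) hΛpos.le hp).1 h
  have hgy1 : g y1 ≤ Λ := by
    refine toΛ _ (hg1.trans ?_)
    rw [hΛp]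
    have e : B * W / (r / 20) ^ 2 = 400 * B * 1 * (W / r ^ 2) := by field_simp; ring
    rw [e]; gcongr
    · norm_num
    · nlinarith
  have hgy2 : g y2 ≤ Λ := by
    refine toΛ _ (hg2.trans ?_)
    rw [hΛp]
    have e1 : r ≤ 2 * K * dz := by
      rw [div_le_iff₀ hKpos] at hx'low; nlinarith
    have e : 1600 * B * K ^ 2 * (W / r ^ 2) = B * W * (1600 * K ^ 2 / r ^ 2) := by ring
    rw [e, div_eq_mul_one_div (B * W)]
    refine mul_le_mul_of_nonneg_left ?_ (by positivity)
    rw [div_le_div_iff₀ (by positivity) (by positivity)]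
    have : r ^ 2 ≤ (2 * K * dz) ^ 2 := by gcongr
    nlinarith
  -- chain points
  have hzi : ∀ i : ℕ, i ≤ m → (i : ℝ) * ℓ / m ∈ Icc 0 ℓ := by
    intro i hi
    refine ⟨by positivity, ?_⟩
    rw [div_le_iff₀ hmpos, mul_comm]
    have : (i:ℝ) ≤ m := by exact_mod_cast hi
    gcongr
  have hyi : ∀ i : ℕ, ∃ y, i ≤ m → y ∈ ball (γ (i * ℓ / m)) δ ∧ y ∉ N ∧ g y ≤ Λ := by
    intro i
    by_cases hi : i ≤ m
    · have hmem := hzi i hi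
      have hlow := γP _ hmem
      rw [mem_ofPred_eq] at hlow
      have hsub : ball (γ (i * ℓ / m)) δ ⊆ Gset Ω K x := by
        intro y hy
        rw [mem_ball] at hy
        have hd : dist (γ (i * ℓ / m)) x ≤ ℓ := by
          have := γlip.dist_le_mul _ hmem 0 ⟨le_rfl, hℓ0⟩
          rw [γ0] at this
          refine this.trans ?_
          rw [Real.dist_eq, sub_zero, abs_of_nonneg hmem.1]; simpa using hmem.2
        have h3 := infDist_le_infDist_add_dist (s := Ωᶜ) (x := γ (i * ℓ / m)) (y := y)
        rw [dist_comm _ y] at h3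
        refine ⟨?_, ?_⟩
        · have := dist_triangle y (γ (i * ℓ / m)) x
          rw [← hr]
          nlinarith
        · rw [← hr]
          have : r / (10 * K) = 4 * δ := by rw [hδ]; field_simp; norm_num
          linarith
      obtain ⟨y, h1, h2, h3⟩ := exists_small hp hδpos.le hΛpos.le hsub hN hint hW.le (by
        rw [hΛp]
        have e : 1600 * B * K ^ 2 * (W / r ^ 2) * (Real.pi * δ ^ 2) = B * Real.pi * W := by
          rw [hδ]; field_simp; norm_num
        rw [e]
        have := Real.pi_gt_three
        have : 1 < B * Real.pi := by nlinarith
        nlinarith)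
      exact ⟨y, fun _ => ⟨h1, h2, h3⟩⟩
    · exact ⟨x, fun h => absurd h hi⟩
  choose y hy using hyi
  have hdy : ∀ i : ℕ, i ≤ m → 39 * δ ≤ infDist (y i) Ωᶜ := by
    intro i hi
    have hlow := γP _ (hzi i hi)
    rw [mem_ofPred_eq] at hlow
    have h3 := infDist_le_infDist_add_dist (s := Ωᶜ) (x := γ (i * ℓ / m)) (y := y i)
    have h4 := (hy i hi).1
    rw [mem_ball, dist_comm] at h4
    linarith
  have hyΩ : ∀ i : ℕ, i ≤ m → y i ∈ Ω \ N := fun i hi =>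
    ⟨(hdpos _).2 (by have := hdy i hi; linarith), (hy i hi).2.1⟩
  have bd : ∀ a ∈ Ω \ N, ∀ b ∈ Ω \ N, dist a b < infDist a Ωᶜ / 2 → dist a b ≤ r → g a ≤ Λ → g b ≤ Λ →
      |u a - u b| ≤ r ^ s * (2 * Λ) := by
    intro a ha b hb h1 h2 h3 h4
    refine (hH a ha b hb h1).trans ?_
    have := hg0 a; have := hg0 b
    gcongr
    linarith
  have link : ∀ i : ℕ, i + 1 ≤ m → |u (y i) - u (y (i+1))| ≤ r ^ s * (2 * Λ) := by
    intro i hi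
    have hd : dist (y i) (y (i+1)) < 3 * δ := by
      have h1 := (hy i (by omega)).1
      have h2 := (hy (i+1) hi).1
      have h3 : dist (γ (i * ℓ / m)) (γ ((i+1 : ℕ) * ℓ / m)) ≤ δ := by
        refine (γlip.dist_le_mul _ (hzi i (by omega)) _ (hzi (i+1) hi)).trans ?_
        rw [Real.dist_eq]
        have e : (i:ℝ) * ℓ / m - ((i+1 : ℕ) : ℝ) * ℓ / m = - (ℓ / m) := by push_cast; ring
        rw [e, abs_neg, abs_of_nonneg (by positivity)]
        simp only [NNReal.coe_one, one_mul]
        rw [div_le_iff₀ hmpos]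
        have : δ * (40 * K ^ 2) = K * r := by rw [hδ]; field_simp
        nlinarith
      rw [mem_ball] at h1 h2
      have h4 := dist_triangle4 (y i) (γ (i * ℓ / m)) (γ ((i+1 : ℕ) * ℓ / m)) (y (i+1))
      rw [dist_comm (γ ((i+1 : ℕ) * ℓ / m)) (y (i+1))] at h4
      linarith
    have := hdy i (by omega)
    exact bd _ (hyΩ i (by omega)) _ (hyΩ (i+1) hi) (by linarith) (by linarith) (hy i (by omega)).2.2 (hy (i+1) hi).2.2
  have hsum : ∀ i : ℕ, i ≤ m → |u (y 0) - u (y i)| ≤ i * (r ^ s * (2 * Λ)) := by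
    intro i
    induction i with
    | zero => intro _; simp
    | succ i ih =>
      intro hi
      have h1 := ih (by omega)
      have h2 := link i hi
      have h3 := abs_sub_le (u (y 0)) (u (y i)) (u (y (i+1)))
      push_cast; linarith
  have hy0b := (hy 0 (Nat.zero_le _)).1
  have hymb := (hy m le_rfl).1
  have em : (m:ℝ) * ℓ / m = ℓ := by field_simp
  rw [em, γ1] at hymb
  simp only [Nat.cast_zero, zero_mul, zero_div, γ0] at hy0b
  rw [mem_ball] at hy0b hymb
  have hy1b := hy1.1; have hy2b := hy2.1
  rw [mem_ball] at hy1b hy2b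
  have hd1 : 19 / 20 * r ≤ infDist y1 Ωᶜ := (radius_comp hy1b.le).1
  have hd2 : 19 / 20 * dz ≤ infDist y2 Ωᶜ := (radius_comp hy2b.le).1
  have first : |u y1 - u (y 0)| ≤ r ^ s * (2 * Λ) := by
    have h1 := dist_triangle_right y1 (y 0) x
    exact bd _ ⟨(hdpos _).2 (by linarith), hy1.2⟩ _ (hyΩ 0 (Nat.zero_le _)) (by linarith) (by linarith) hgy1
      (hy 0 (Nat.zero_le _)).2.2
  have last : |u y2 - u (y m)| ≤ r ^ s * (2 * Λ) := by
    have h1 := dist_triangle4 y2 z x' (y m)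
    rw [dist_comm z x', dist_comm x' (y m)] at h1
    exact bd _ ⟨(hdpos _).2 (by linarith), hy2.2⟩ _ (hyΩ m le_rfl) (by linarith) (by linarith) hgy2
      (hy m le_rfl).2.2
  have h1 := abs_sub_le (u y1) (u (y 0)) (u y2)
  have h2 := abs_sub_le (u (y 0)) (u (y m)) (u y2)
  have h3 := hsum m le_rfl
  rw [abs_sub_comm (u y2)] at last
  have hΛe : Λ = (1600 * B * K ^ 2) ^ (1 / p) * (W / r ^ 2) ^ (1 / p) := by
    rw [hΛ, Real.mul_rpow (by positivity) (by positivity)]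
  calc |u y1 - u y2| ≤ (m + 2) * (r ^ s * (2 * Λ)) := by linarith
    _ = _ := by rw [hΛe]; ring


lemma john_walk {Ω : Set (Eu 2)} (h : IsJohnDomain Ω) : ∃ x0 ∈ Ω, ∃ K ≥ (1:ℝ), ∀ x ∈ Ω, ∃ x' ∈ Ω, ∃ ℓ ≤ K * infDist x Ωᶜ,
    CurveIn {z | infDist x Ωᶜ / K ≤ infDist z Ωᶜ} ℓ x x' ∧ infDist x' Ωᶜ ≤ 2 * infDist x Ωᶜ ∧
    (x' = x0 ∨ infDist x' Ωᶜ = 2 * infDist x Ωᶜ) := by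
  obtain ⟨x0, hx0, C, hC, H⟩ := h
  refine ⟨x0, hx0, 1 + 2 / C, by have : 0 < 2 / C := by positivity
                                 linarith, ?_⟩
  intro x hx
  obtain ⟨ℓ, hℓ, γ, γlip, γ0, γ1, γP⟩ := H x hx
  have hd0 := infDist_nonneg (x := x) (s := Ωᶜ)
  have low : ∀ t ∈ Icc 0 ℓ, infDist x Ωᶜ / (1 + 2 / C) ≤ infDist (γ t) Ωᶜ := by
    intro t ht
    have h1 := (γP t ht).2
    have h2 : dist x (γ t) ≤ t := by
      have := γlip.dist_le_mul 0 ⟨le_rfl, hℓ⟩ t ht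
      rw [γ0, Real.dist_eq, zero_sub, abs_neg, abs_of_nonneg ht.1] at this
      simpa using this
    have h3 := infDist_le_infDist_add_dist (s := Ωᶜ) (x := x) (y := γ t)
    rw [div_le_iff₀ (by positivity)]
    have h4 : t ≤ infDist (γ t) Ωᶜ / C := by rw [le_div_iff₀ hC]; linarith
    have h5 : infDist (γ t) Ωᶜ * (2 / C) = 2 * (infDist (γ t) Ωᶜ / C) := by ring
    have := ht.1
    nlinarith
  have mk : ∀ t ∈ Icc 0 ℓ, infDist (γ t) Ωᶜ ≤ 2 * infDist x Ωᶜ → (γ t = x0 ∨ infDist (γ t) Ωᶜ = 2 * infDist x Ωᶜ) →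
      ∃ x' ∈ Ω, ∃ ℓ ≤ (1 + 2 / C) * infDist x Ωᶜ,
    CurveIn {z | infDist x Ωᶜ / (1 + 2 / C) ≤ infDist z Ωᶜ} ℓ x x' ∧ infDist x' Ωᶜ ≤ 2 * infDist x Ωᶜ ∧
    (x' = x0 ∨ infDist x' Ωᶜ = 2 * infDist x Ωᶜ) := by
    intro t ht h1 h2
    refine ⟨γ t, (γP t ht).1, t, ?_, ⟨ht.1, γ, γlip.mono (Icc_subset_Icc_right ht.2), γ0, rfl, fun t' ht' =>
      low t' ⟨ht'.1, ht'.2.trans ht.2⟩⟩, h1, h2⟩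
    have h3 := (γP t ht).2
    have h4 : t ≤ 2 * infDist x Ωᶜ / C := by rw [le_div_iff₀ hC]; linarith
    have h5 : (2 / C) * infDist x Ωᶜ  = 2 * infDist x Ωᶜ / C := by ring
    linarith
  rcases le_or_gt (infDist x0 Ωᶜ) (2 * infDist x Ωᶜ) with hle | hgt
  · refine mk ℓ ⟨hℓ, le_rfl⟩ (by rw [γ1]; exact hle) (Or.inl γ1)
  · have hc : ContinuousOn (fun t => infDist (γ t) Ωᶜ) (Icc 0 ℓ) :=
      (continuous_infDist_pt _).comp_continuousOn γlip.continuousOn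
    have := intermediate_value_Icc hℓ hc
    simp only [γ0, γ1] at this
    obtain ⟨t, ht, hte⟩ := this ⟨by linarith, hgt.le⟩
    exact mk t ht hte.le (Or.inr hte)

/-- Abstract tree inequality. -/
lemma tree_ineq {ι : Type*} {q M : ℝ} (hq : 1 < q) (hM : 0 < M) (F : Finset ι) (par : ι → Option ι) (r w a A : ι → ℝ)
    (rel : ι → ι → Prop) (hpar : ∀ Q ∈ F, ∀ P, par Q = some P → P ∈ F ∧ r Q < r P)
    (hrel1 : ∀ Q ∈ F, rel Q Q) (hrel2 : ∀ Q ∈ F, ∀ P0, par Q = some P0 → ∀ P, rel P0 P → rel Q P)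
    (hrel3 : ∀ Q ∈ F, ∀ P0, par Q = some P0 → ¬ rel P0 Q)
    (hw : ∀ Q ∈ F, 0 ≤ w Q) (ha : ∀ Q ∈ F, 0 ≤ a Q) (hA : ∀ Q ∈ F, 0 ≤ A Q)
    (hA0 : ∀ Q ∈ F, par Q = none → A Q ≤ a Q) (hA1 : ∀ Q ∈ F, ∀ P, par Q = some P → A Q ≤ A P + a Q)
    (hsum : ∀ P ∈ F, ∀ S ⊆ F, (∀ Q ∈ S, rel Q P) → ∑ Q ∈ S, w Q ≤ M * w P) :
    ∑ Q ∈ F, w Q * A Q ^ q ≤ 2 * (q * M * (2 * q * M) ^ (q - 1)) * ∑ Q ∈ F, w Q * a Q ^ q := by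
  classical
  have hq1 : 0 < q - 1 := by linarith
  -- one step
  have step : ∀ x y b : ℝ, 0 ≤ x → 0 ≤ y → 0 ≤ b → y ≤ x + b → y ^ q ≤ x ^ q + q * (b * y ^ (q - 1)) := by
    intro x y b hx hy hb h
    rcases le_or_gt y x with hle | hgt
    · have : y ^ q ≤ x ^ q := by gcongr
      have : 0 ≤ q * (b * y ^ (q - 1)) := by positivity
      linarith
    · have hypos : 0 < y := by linarith
      have h1 := one_add_mul_self_le_rpow_one_add (s := x / y - 1) (by have : 0 ≤ x / y := by positivity
                                                                       linarith) hq.le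
      rw [show 1 + (x / y - 1) = x / y by ring, Real.div_rpow hx hy] at h1
      rw [le_div_iff₀ (by positivity)] at h1
      have h2 : (1 + q * (x / y - 1)) * y ^ q = y ^ q + q * ((x - y) * y ^ (q - 1)) := by
        rw [Real.rpow_sub_one hypos.ne']; field_simp
      rw [h2] at h1
      have h3 : 0 ≤ q * ((x + b - y) * y ^ (q - 1)) := by
        have : 0 ≤ x + b - y := by linarith
        positivity
      nlinarith
  have key : ∀ k : ℕ, ∀ Q ∈ F, (F.filter (fun P => r Q < r P)).card = k →
      A Q ^ q ≤ ∑ P ∈ F.filter (fun P => rel Q P), q * (a P * A P ^ (q - 1)) := by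
    intro k
    induction k using Nat.strong_induction_on with
    | _ k ih =>
      intro Q hQ hk
      have hnn : ∀ P ∈ F, 0 ≤ q * (a P * A P ^ (q - 1)) := by
        intro P hP
        have := ha P hP; have := hA P hP
        positivity
      cases hP : par Q with
      | none =>
        have h1 := step 0 (A Q) (a Q) le_rfl (hA Q hQ) (ha Q hQ) (by have := hA0 Q hQ hP; linarith)
        rw [Real.zero_rpow (by linarith), zero_add] at h1
        refine h1.trans ?_
        refine Finset.single_le_sum (f := fun P => q * (a P * A P ^ (q - 1))) (fun P hP => hnn P (Finset.mem_filter.1 hP).1) ?_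
        simp [hQ, hrel1 Q hQ]
      | some P0 =>
        obtain ⟨hP0, hr⟩ := hpar Q hQ P0 hP
        have h1 := step (A P0) (A Q) (a Q) (hA P0 hP0) (hA Q hQ) (ha Q hQ) (hA1 Q hQ P0 hP)
        have h2 := ih _ (by
          rw [← hk]
          apply Finset.card_lt_card
          rw [Finset.ssubset_iff_of_subset]
          · exact ⟨P0, by simp [hP0, hr], by simp⟩
          · intro P
            simp only [Finset.mem_filter]
            exact fun h => ⟨h.1, hr.trans h.2⟩) P0 hP0 rfl
        have h3 : insert Q (F.filter (fun P => rel P0 P)) ⊆ F.filter (fun P => rel Q P) := by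
          intro P hP'
          rw [Finset.mem_insert] at hP'
          rcases hP' with rfl | hP'
          · simp [hQ, hrel1 P hQ]
          · rw [Finset.mem_filter] at hP' ⊢
            exact ⟨hP'.1, hrel2 Q hQ P0 hP P hP'.2⟩
        have h4 := Finset.sum_le_sum_of_subset_of_nonneg (f := fun P => q * (a P * A P ^ (q - 1))) h3
          (fun P hP _ => hnn P (Finset.mem_filter.1 hP).1)
        rw [Finset.sum_insert (by simp [hrel3 Q hQ P0 hP])] at h4
        linarith
  have h1 : ∑ Q ∈ F, w Q * A Q ^ q ≤ ∑ P ∈ F, M * w P * (q * (a P * A P ^ (q - 1))) := by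
    calc ∑ Q ∈ F, w Q * A Q ^ q ≤ ∑ Q ∈ F, w Q * ∑ P ∈ F.filter (fun P => rel Q P), q * (a P * A P ^ (q - 1)) :=
          Finset.sum_le_sum fun Q hQ => mul_le_mul_of_nonneg_left (key _ Q hQ rfl) (hw Q hQ)
      _ = ∑ P ∈ F, (∑ Q ∈ F.filter (fun Q => rel Q P), w Q) * (q * (a P * A P ^ (q - 1))) := by
          simp_rw [Finset.mul_sum, Finset.sum_filter, Finset.sum_mul]
          rw [Finset.sum_comm]
          refine Finset.sum_congr rfl fun P _ => Finset.sum_congr rfl fun Q _ => ?_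
          split_ifs <;> simp
      _ ≤ _ := by
          refine Finset.sum_le_sum fun P hP => ?_
          have := ha P hP; have := hA P hP
          refine mul_le_mul_of_nonneg_right (hsum P hP _ (Finset.filter_subset _ _) (by simp)) (by positivity)
  have h2 : ∑ P ∈ F, M * w P * (q * (a P * A P ^ (q - 1))) ≤
      ∑ P ∈ F, (1 / 2 * (w P * A P ^ q) + (q * M * (2 * q * M) ^ (q - 1)) * (w P * a P ^ q)) := by
    refine Finset.sum_le_sum fun P hP => ?_
    have hap := ha P hP
    have hAp := hA P hP
    have hwp := hw P hP
    have e : ∀ t : ℝ, 0 ≤ t → t ^ q = t * t ^ (q - 1) := by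
      intro t ht
      have := Real.rpow_add_of_nonneg ht zero_le_one hq1.le
      rw [Real.rpow_one] at this
      rw [← this]; congr 1; ring
    rcases le_or_gt (A P) (2 * q * M * a P) with hle | hgt
    · have : A P ^ (q - 1) ≤ (2 * q * M) ^ (q - 1) * a P ^ (q - 1) := by
        rw [← Real.mul_rpow (by positivity) hap]; gcongr
      have h3 : 0 ≤ 1 / 2 * (w P * A P ^ q) := by positivity
      calc M * w P * (q * (a P * A P ^ (q - 1))) ≤ M * w P * (q * (a P * ((2 * q * M) ^ (q - 1) * a P ^ (q - 1)))) := by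
            gcongr
        _ = (q * M * (2 * q * M) ^ (q - 1)) * (w P * a P ^ q) := by rw [e (a P) hap]; ring
        _ ≤ _ := by linarith
    · have h3 : 0 ≤ (q * M * (2 * q * M) ^ (q - 1)) * (w P * a P ^ q) := by positivity
      have : M * w P * (q * (a P * A P ^ (q - 1))) ≤ 1 / 2 * (w P * A P ^ q) := by
        rw [e (A P) hAp]
        have : 0 ≤ w P * A P ^ (q - 1) := by positivity
        nlinarith
      linarith
  rw [Finset.sum_add_distrib, ← Finset.mul_sum, ← Finset.mul_sum] at h2
  linarith


lemma nodes_exist {Ω : Set (Eu 2)} (hb : Bornology.IsBounded Ω)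
    (hdpos : ∀ x, x ∈ Ω ↔ 0 < infDist x Ωᶜ) :
    ∃ T ⊆ Ω, T.Countable ∧ (T.PairwiseDisjoint fun x => closedBall x (infDist x Ωᶜ / 100)) ∧
      ∀ y ∈ Ω, ∃ x ∈ T, dist y x ≤ infDist x Ωᶜ / 20 := by
  obtain ⟨Dm, hDm⟩ := infDist_bound hb
  obtain ⟨T, hT, hdis, hcov⟩ := Vitali.exists_disjoint_subfamily_covering_enlargement_closedBall Ω (fun x => x)
    (fun x => infDist x Ωᶜ / 100) (Dm / 100) (fun x hx => by have := hDm x hx; linarith) 5 (by norm_num)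
  refine ⟨T, hT, ?_, hdis, ?_⟩
  · refine hdis.countable_of_nonempty_interior fun x hx => ?_
    have h1 := (hdpos x).1 (hT hx)
    have : (ball x (infDist x Ωᶜ / 100)).Nonempty := nonempty_ball.2 (by positivity)
    exact this.mono ball_subset_interior_closedBall
  · intro y hy
    obtain ⟨x, hx, h⟩ := hcov y hy
    refine ⟨x, hx, ?_⟩
    have h1 := (hdpos y).1 hy
    have := h (mem_closedBall_self (by positivity))
    rw [mem_closedBall] at this
    linarith

lemma packing {Ω T : Set (Eu 2)} (hT : T.PairwiseDisjoint fun x => closedBall x (infDist x Ωᶜ / 100))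
    (S : Finset (Eu 2)) (hS : (S : Set (Eu 2)) ⊆ T) {c : Eu 2} {R : ℝ} (hR : 0 ≤ R)
    (h : ∀ x ∈ S, dist x c + infDist x Ωᶜ / 100 ≤ R) : ∑ x ∈ S, infDist x Ωᶜ ^ 2 ≤ 10 ^ 4 * R ^ 2 := by
  have hd := hT.subset hS
  have h1 : volume.real (⋃ x ∈ S, closedBall x (infDist x Ωᶜ / 100)) = ∑ x ∈ S, volume.real (closedBall x (infDist x Ωᶜ / 100)) :=
    measureReal_biUnion_finset hd (fun x _ => measurableSet_closedBall) (fun x _ => measure_closedBall_lt_top.ne)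
  have h2 : volume.real (⋃ x ∈ S, closedBall x (infDist x Ωᶜ / 100)) ≤ volume.real (closedBall c R) := by
    refine measureReal_mono ?_ measure_closedBall_lt_top.ne
    refine iUnion₂_subset fun x hx => closedBall_subset_closedBall' ?_
    have := h x hx; linarith
  rw [h1, vol_cball2 c hR] at h2
  have h3 : ∑ x ∈ S, volume.real (closedBall x (infDist x Ωᶜ / 100)) = Real.pi / 10 ^ 4 * ∑ x ∈ S, infDist x Ωᶜ ^ 2 := by
    rw [Finset.mul_sum]
    refine Finset.sum_congr rfl fun x _ => ?_
    rw [vol_cball2 x (by have := infDist_nonneg (x := x) (s := Ωᶜ); positivity)]; ring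
  rw [h3] at h2
  have hpi := Real.pi_pos
  have : Real.pi / 10 ^ 4 * ∑ x ∈ S, infDist x Ωᶜ ^ 2 ≤ Real.pi / 10 ^ 4 * (10 ^ 4 * R ^ 2) := by
    refine h2.trans (le_of_eq (by ring))
  exact le_of_mul_le_mul_left this (by positivity)

lemma overlap_card {Ω T : Set (Eu 2)} (hTΩ : T ⊆ Ω) (hdpos : ∀ x, x ∈ Ω ↔ 0 < infDist x Ωᶜ)
    (hT : T.PairwiseDisjoint fun x => closedBall x (infDist x Ωᶜ / 100)) {K : ℝ} (hK : 1 ≤ K)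
    (S : Finset (Eu 2)) (hS : (S : Set (Eu 2)) ⊆ T) (y : Eu 2) (h : ∀ x ∈ S, y ∈ Gset Ω K x) :
    (S.card : ℝ) ≤ 10 ^ 4 * ((10 * K + 1) ^ 2 * (10 * K)) ^ 2 := by
  rcases S.eq_empty_or_nonempty with rfl | ⟨x1, hx1⟩
  · simp; positivity
  have hy : 0 < infDist y Ωᶜ := by
    have h1 := (h x1 hx1).2
    have h2 := (hdpos x1).1 (hTΩ (hS hx1))
    have : 0 < infDist x1 Ωᶜ / (10 * K) := by positivity
    linarith
  have h1 := packing hT S hS (c := y) (R := (10 * K + 1) * (10 * K) * infDist y Ωᶜ) (by positivity) (by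
    intro x hx
    have h1 := (h x hx).1
    have h2 := (h x hx).2
    rw [div_le_iff₀ (by positivity)] at h2
    have h3 := (hdpos x).1 (hTΩ (hS hx))
    rw [dist_comm]
    calc dist y x + infDist x Ωᶜ / 100 ≤ (10 * K + 1) * infDist x Ωᶜ := by linarith
      _ ≤ (10 * K + 1) * (infDist y Ωᶜ * (10 * K)) := by gcongr
      _ = _ := by ring)
  have h2 : ∑ x ∈ S, (infDist y Ωᶜ / (10 * K + 1)) ^ 2 ≤ ∑ x ∈ S, infDist x Ωᶜ ^ 2 := by
    refine Finset.sum_le_sum fun x hx => ?_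
    have h1 := (h x hx).1
    have h3 := infDist_le_infDist_add_dist (s := Ωᶜ) (x := y) (y := x)
    gcongr
    rw [div_le_iff₀ (by positivity)]
    linarith
  rw [Finset.sum_const, nsmul_eq_mul] at h2
  have h3 := h2.trans h1
  have : (infDist y Ωᶜ / (10 * K + 1)) ^ 2 * S.card ≤ (infDist y Ωᶜ / (10 * K + 1)) ^ 2 * (10 ^ 4 * ((10 * K + 1) ^ 2 * (10 * K)) ^ 2) := by
    rw [mul_comm]; refine h3.trans (le_of_eq (by field_simp))
  exact le_of_mul_le_mul_left this (by positivity)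

lemma Gset_meas (Ω : Set (Eu 2)) (K : ℝ) (x : Eu 2) : MeasurableSet (Gset Ω K x) := by
  refine IsClosed.measurableSet (IsClosed.inter ?_ ?_)
  · exact isClosed_le (continuous_id.dist continuous_const) continuous_const
  · exact isClosed_le continuous_const (continuous_infDist_pt _)

lemma Gset_sub {Ω : Set (Eu 2)} (hdpos : ∀ x, x ∈ Ω ↔ 0 < infDist x Ωᶜ) {K : ℝ} (hK : 1 ≤ K) {x : Eu 2} (hx : x ∈ Ω) :
    Gset Ω K x ⊆ Ω := by
  intro y hy
  rw [hdpos] at hx ⊢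
  have : 0 < infDist x Ωᶜ / (10 * K) := by positivity
  exact this.trans_le hy.2

lemma overlap_int {Ω T : Set (Eu 2)} (hTΩ : T ⊆ Ω) (hdpos : ∀ x, x ∈ Ω ↔ 0 < infDist x Ωᶜ) (hm : MeasurableSet Ω)
    (hT : T.PairwiseDisjoint fun x => closedBall x (infDist x Ωᶜ / 100)) {K : ℝ} (hK : 1 ≤ K)
    (S : Finset (Eu 2)) (hS : (S : Set (Eu 2)) ⊆ T) (f : Eu 2 → ℝ≥0∞) (hf : Measurable f) :
    ∑ x ∈ S, ∫⁻ z in Gset Ω K x, f z ≤ ENNReal.ofReal (10 ^ 4 * ((10 * K + 1) ^ 2 * (10 * K)) ^ 2) * ∫⁻ z in Ω, f z := by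
  classical
  have h1 : ∀ x ∈ S, ∫⁻ z in Gset Ω K x, f z = ∫⁻ z, (Gset Ω K x).indicator f z := fun x _ =>
    (lintegral_indicator (Gset_meas Ω K x) f).symm
  rw [Finset.sum_congr rfl h1, ← lintegral_finsetSum _ (fun x _ => hf.indicator (Gset_meas Ω K x)),
    ← lintegral_indicator hm, ← lintegral_const_mul _ (hf.indicator hm)]
  refine lintegral_mono fun y => ?_
  by_cases hy : y ∈ Ω
  · simp only [indicator_apply, hy, if_true]
    rw [← Finset.sum_filter, Finset.sum_const, nsmul_eq_mul]
    gcongr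
    have := overlap_card hTΩ hdpos hT hK (S.filter (fun x => y ∈ Gset Ω K x))
      (fun x hx => hS (Finset.mem_filter.1 hx).1) y (fun x hx => (Finset.mem_filter.1 hx).2)
    rw [← ENNReal.ofReal_natCast]
    exact ENNReal.ofReal_le_ofReal this
  · have : ∀ x ∈ S, (Gset Ω K x).indicator f y = 0 := fun x hx =>
      indicator_of_notMem (fun h => hy (Gset_sub hdpos hK (hTΩ (hS hx)) h)) _
    simp only
    rw [Finset.sum_eq_zero this]; exact zero_le

lemma nodes_finite {Ω T : Set (Eu 2)} (hb : Bornology.IsBounded Ω) (hTΩ : T ⊆ Ω)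
    (hT : T.PairwiseDisjoint fun x => closedBall x (infDist x Ωᶜ / 100)) {ε : ℝ} (hε : 0 < ε) :
    {x ∈ T | ε ≤ infDist x Ωᶜ}.Finite := by
  obtain ⟨Dm, hDm⟩ := infDist_bound hb
  obtain ⟨R, hR⟩ := hb.subset_closedBall 0
  by_contra hinf
  obtain ⟨n, hn⟩ := exists_nat_gt (10 ^ 4 * (max R 0 + max Dm 0) ^ 2 / ε ^ 2)
  obtain ⟨S, hS, hcard⟩ := Set.Infinite.exists_subset_card_eq hinf n
  have h1 := packing hT S (fun x hx => (hS hx).1) (c := 0) (R := max R 0 + max Dm 0) (by positivity) (by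
    intro x hx
    have h2 := hTΩ (hS hx).1
    have h3 := hR h2
    rw [mem_closedBall] at h3
    have h4 := hDm x h2
    have h5 := infDist_nonneg (x := x) (s := Ωᶜ)
    have := le_max_left R 0
    have := le_max_left Dm 0
    linarith)
  have h2 : ∑ x ∈ S, ε ^ 2 ≤ ∑ x ∈ S, infDist x Ωᶜ ^ 2 := by
    refine Finset.sum_le_sum fun x hx => ?_
    have := (hS hx).2
    gcongr
  rw [Finset.sum_const, nsmul_eq_mul, hcard] at h2
  rw [div_lt_iff₀ (by positivity)] at hn
  linarith


lemma add_rpow_two {a b q : ℝ} (ha : 0 ≤ a) (hb : 0 ≤ b) (hq : 0 < q) : (a + b) ^ q ≤ 2 ^ q * (a ^ q + b ^ q) := by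
  have h1 : (0:ℝ) ≤ a ^ q := by positivity
  have h2 : (0:ℝ) ≤ b ^ q := by positivity
  have h3 : (0:ℝ) < 2 ^ q := by positivity
  rcases le_total a b with h | h
  · calc (a + b) ^ q ≤ (2 * b) ^ q := by gcongr; linarith
      _ = 2 ^ q * b ^ q := Real.mul_rpow (by norm_num) hb
      _ ≤ _ := by gcongr; linarith
  · calc (a + b) ^ q ≤ (2 * a) ^ q := by gcongr; linarith
      _ = 2 ^ q * a ^ q := Real.mul_rpow (by norm_num) ha
      _ ≤ _ := by gcongr; linarith

lemma sum_rpow_le {ι : Type*} (S : Finset ι) (W : ι → ℝ) (hW : ∀ i ∈ S, 0 ≤ W i) {t X : ℝ} (ht : 1 ≤ t)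
    (h : ∑ i ∈ S, W i ≤ X) : ∑ i ∈ S, W i ^ t ≤ X ^ t := by
  have ht1 : 0 ≤ t - 1 := by linarith
  have hX : 0 ≤ X := (Finset.sum_nonneg hW).trans h
  have e : ∀ x : ℝ, 0 ≤ x → x ^ t = x * x ^ (t - 1) := by
    intro x hx
    have := Real.rpow_add_of_nonneg hx zero_le_one ht1
    rw [Real.rpow_one] at this
    rw [← this]; congr 1; ring
  calc ∑ i ∈ S, W i ^ t ≤ ∑ i ∈ S, W i * X ^ (t - 1) := by
        refine Finset.sum_le_sum fun i hi => ?_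
        have h0 := hW i hi
        rw [e _ h0]
        have : W i ≤ X := (Finset.single_le_sum hW hi).trans h
        gcongr
    _ = (∑ i ∈ S, W i) * X ^ (t - 1) := by rw [Finset.sum_mul]
    _ ≤ X * X ^ (t - 1) := by gcongr
    _ = X ^ t := (e X hX).symm

set_option maxHeartbeats 2000000 in
lemma john_core {Ω : Set (Eu 2)} (hΩ : IsOpen Ω) (hb : Bornology.IsBounded Ω) (hJ : IsJohnDomain Ω) {s p q : ℝ}
    (hs : 0 < s) (hs1 : s ≤ 1) (hp : 0 < p) (hps : p * s < 2) (hq : q = p * 2 / (2 - p * s)) (hq1 : 1 < q) :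
    ∃ C > 0, ∀ (u g : Eu 2 → ℝ) (N : Set (Eu 2)) (I1 : ℝ), volume N = 0 → Measurable g → (∀ y, 0 < g y) → 0 < I1 →
      (∀ y ∈ Ω \ N, ∀ z ∈ Ω \ N, dist y z < infDist y Ωᶜ / 2 → |u y - u z| ≤ dist y z ^ s * (g y + g z)) →
      ∫⁻ z in Ω, ENNReal.ofReal (g z ^ p) ≤ ENNReal.ofReal I1 →
      ∃ c0 : ℝ, ∫⁻ y in Ω, ENNReal.ofReal (|u y - c0| ^ q) ≤ ENNReal.ofReal (C * I1 ^ (q / p)) := by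
  have hne := compl_nonempty_of_bdd hb
  have hdpos : ∀ x, x ∈ Ω ↔ 0 < infDist x Ωᶜ := fun x => by
    rw [← hΩ.isClosed_compl.notMem_iff_infDist_pos hne]; simp
  obtain ⟨x0, hx0, K, hK, walk⟩ := john_walk hJ
  obtain ⟨T, hTΩ, hTc, hT, hcov⟩ := nodes_exist hb hdpos
  obtain ⟨B, hB, A, hA, loc⟩ := local_integral hs hs1 hp hps hq
  obtain ⟨C0, hC0, chain⟩ := chain_est (s := s) (p := p) (K := K) (B := B) hs hp hK hB
  have hKpos : 0 < K := by linarith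
  have h2ps : 0 < 2 - p * s := by linarith
  have hqp : q / p = 2 / (2 - p * s) := by rw [hq]; field_simp
  have hqp1 : 1 ≤ q / p := by
    rw [hqp, le_div_iff₀ h2ps]; have : 0 < p * s := by positivity
    linarith
  set M : ℝ := 10 ^ 4 * (2 * K + 1) ^ 2 with hM
  have hMpos : 0 < M := by positivity
  set N0 : ℝ := 10 ^ 4 * ((10 * K + 1) ^ 2 * (10 * K)) ^ 2 with hN0
  have hN0pos : 0 < N0 := by positivity
  set C1 : ℝ := 2 * (q * M * (2 * q * M) ^ (q - 1)) with hC1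
  have hC1pos : 0 < C1 := by positivity
  have hpi := Real.pi_pos
  refine ⟨2 ^ q * (A + Real.pi / 400 * (C1 * C0 ^ q)) * N0 ^ (q / p), by positivity, ?_⟩
  intro u g N I1 hN hgm hgpos hI hH hint
  have hg0 : ∀ y, 0 ≤ g y := fun y => (hgpos y).le
  set f : Eu 2 → ℝ≥0∞ := fun z => ENNReal.ofReal (g z ^ p) with hf
  have hfm : Measurable f := (hgm.pow_const p).ennreal_ofReal
  have hfpos : ∀ z, f z ≠ 0 := fun z => by
    have := hgpos z
    have : 0 < g z ^ p := by positivity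
    simpa [hf] using this
  set V : Eu 2 → ℝ := fun x => (∫⁻ z in ball x (2 * (infDist x Ωᶜ / 20)), f z).toReal with hV
  set W : Eu 2 → ℝ := fun x => (∫⁻ z in Gset Ω K x, f z).toReal with hW
  have hGfin : ∀ x ∈ Ω, ∫⁻ z in Gset Ω K x, f z ≠ ⊤ := fun x hx =>
    (((lintegral_mono_set (Gset_sub hdpos hK hx)).trans hint).trans_lt ENNReal.ofReal_lt_top).ne
  have hVfin : ∀ x ∈ Ω, ∫⁻ z in ball x (2 * (infDist x Ωᶜ / 20)), f z ≠ ⊤ := fun x hx =>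
    ((lintegral_mono_set (Gset_self hK x)).trans_lt (hGfin x hx).lt_top).ne
  have hVpos : ∀ x ∈ Ω, 0 < V x := by
    intro x hx
    refine ENNReal.toReal_pos ?_ (hVfin x hx)
    have := (hdpos x).1 hx
    rw [← pos_iff_ne_zero, setLIntegral_pos_iff hfm]
    have h1 : Function.support f = univ := by ext z; simp [hfpos z]
    rw [h1, univ_inter]
    exact measure_ball_pos _ _ (by positivity)
  have hVW : ∀ x ∈ Ω, V x ≤ W x := fun x hx =>
    ENNReal.toReal_mono (hGfin x hx) (lintegral_mono_set (Gset_self hK x))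
  have hWpos : ∀ x ∈ Ω, 0 < W x := fun x hx => (hVpos x hx).trans_le (hVW x hx)
  have hWe : ∀ x ∈ Ω, ∫⁻ z in Gset Ω K x, f z ≤ ENNReal.ofReal (W x) := fun x hx =>
    (ENNReal.ofReal_toReal (hGfin x hx)).ge
  have hVe : ∀ x ∈ Ω, ∫⁻ z in ball x (2 * (infDist x Ωᶜ / 20)), f z ≤ ENNReal.ofReal (V x) := fun x hx =>
    (ENNReal.ofReal_toReal (hVfin x hx)).ge
  have hy : ∀ x, ∃ y, x ∈ Ω → y ∈ ball x (infDist x Ωᶜ / 20) \ N ∧ g y ^ p ≤ B * V x / (infDist x Ωᶜ / 20) ^ 2 := by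
    intro x
    by_cases hx : x ∈ Ω
    · have hd := (hdpos x).1 hx
      have hVx := hVpos x hx
      have hρ : 0 < infDist x Ωᶜ / 20 := by positivity
      have hlamp : ((B * V x / (infDist x Ωᶜ / 20) ^ 2) ^ (1 / p)) ^ p = B * V x / (infDist x Ωᶜ / 20) ^ 2 := by
        rw [← Real.rpow_mul (by positivity), one_div_mul_cancel hp.ne', Real.rpow_one]
      obtain ⟨y, h1, h2, h3⟩ := exists_small (lam := (B * V x / (infDist x Ωᶜ / 20) ^ 2) ^ (1 / p)) hp hρ.le
        (by positivity) (ball_subset_ball (by linarith : infDist x Ωᶜ / 20 ≤ 2 * (infDist x Ωᶜ / 20))) hN (hVe x hx) hVx.le (by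
          rw [hlamp]
          have e : B * V x / (infDist x Ωᶜ / 20) ^ 2 * (Real.pi * (infDist x Ωᶜ / 20) ^ 2) = B * Real.pi * V x := by
            field_simp
          rw [e]
          have := Real.pi_gt_three
          have : 1 < B * Real.pi := by nlinarith
          nlinarith)
      refine ⟨y, fun _ => ⟨⟨h1, h2⟩, ?_⟩⟩
      rw [← hlamp]
      exact Real.rpow_le_rpow (hg0 y) h3 hp.le
    · exact ⟨x, fun h => absurd h hx⟩
  choose y hy using hy
  set c : Eu 2 → ℝ := fun x => u (y x) with hc
  set a : Eu 2 → ℝ := fun x => C0 * (infDist x Ωᶜ ^ s * (W x / infDist x Ωᶜ ^ 2) ^ (1 / p)) with ha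
  have hgW : ∀ x ∈ Ω, ∀ z ∈ Ω, V z ≤ W x → g (y z) ^ p ≤ B * W x / (infDist z Ωᶜ / 20) ^ 2 := by
    intro x hx z hz h
    refine (hy z hz).2.trans ?_
    gcongr
  have hpar : ∀ x, ∃ o : Option (Eu 2), x ∈ T → (o = none → |c x - c x0| ≤ a x) ∧
      (∀ P, o = some P → P ∈ T ∧ |c x - c P| ≤ a x ∧ 19 / 10 * infDist x Ωᶜ ≤ infDist P Ωᶜ ∧
        dist x P ≤ (K + 1 / 5) * infDist x Ωᶜ) := by
    intro x
    by_cases hxT : x ∈ T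
    swap
    · exact ⟨none, fun h => absurd h hxT⟩
    have hx := hTΩ hxT
    have hdx := (hdpos x).1 hx
    obtain ⟨x', hx', ℓ, hℓ, hcur, hup, hor⟩ := walk x hx
    have hlow : infDist x Ωᶜ / K ≤ infDist x' Ωᶜ := by
      obtain ⟨h0, γ, -, -, h2, h3⟩ := hcur
      have := h3 ℓ ⟨h0, le_rfl⟩
      rwa [h2] at this
    have hdist : dist x' x ≤ ℓ := by
      obtain ⟨h0, γ, h1, h2, h3, -⟩ := hcur
      have := h1.dist_le_mul ℓ ⟨h0, le_rfl⟩ 0 ⟨le_rfl, h0⟩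
      rw [h2, h3, Real.dist_eq, sub_zero, abs_of_nonneg h0] at this
      simpa using this
    have est : ∀ z ∈ Ω, dist x' z ≤ infDist z Ωᶜ / 20 → |c x - c z| ≤ a x := by
      intro z hz hxz
      have hVz : V z ≤ W x := ENNReal.toReal_mono (hGfin x hx)
        (lintegral_mono_set (Gset_next hK (hdist.trans hℓ) hlow hup hxz))
      exact chain Ω u g N x x' z (y x) (y z) (W x) ℓ hdpos hN hg0 (hWpos x hx) hH hx hz hℓ hcur hup hxz (hWe x hx)
        (hy x hx).1 (hy z hz).1 (hgW x hx x hx (hVW x hx)) (hgW x hx z hz hVz)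
    rcases hor with h0 | h2
    · refine ⟨none, fun _ => ⟨fun _ => est x0 hx0 ?_, fun P hP => by simp at hP⟩⟩
      rw [h0, dist_self]; have := (hdpos x0).1 hx0; positivity
    · obtain ⟨P, hP, hPd⟩ := hcov x' hx'
      refine ⟨some P, fun _ => ⟨fun h => by simp at h, fun P' hP' => ?_⟩⟩
      obtain rfl : P = P' := by simpa using hP'
      obtain ⟨c1, c2⟩ := radius_comp hPd
      refine ⟨hP, est P (hTΩ hP) hPd, by linarith, ?_⟩
      have := dist_triangle_left x P x'
      linarith
  choose par hpar using hpar
  have hapos : ∀ x ∈ Ω, 0 ≤ a x := by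
    intro x hx
    have := (hdpos x).1 hx; have := hWpos x hx
    positivity
  have hwa : ∀ x ∈ Ω, infDist x Ωᶜ ^ 2 * a x ^ q = C0 ^ q * W x ^ (q / p) := by
    intro x hx
    have hd := (hdpos x).1 hx; have hw := hWpos x hx
    simp only [ha]
    set d := infDist x Ωᶜ
    rw [Real.mul_rpow hC0.le (by positivity), Real.mul_rpow (by positivity) (by positivity), ← Real.rpow_mul (by positivity),
      ← Real.rpow_mul (by positivity), show 1 / p * q = q / p by ring, Real.div_rpow hw.le (by positivity)]
    have e2 : (d ^ 2) ^ (q / p) = d ^ (s * q) * d ^ 2 := by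
      rw [← Real.rpow_two, ← Real.rpow_mul hd.le, ← Real.rpow_add hd]
      congr 1; rw [hq]; field_simp; ring
    rw [e2]; field_simp
  have sumW : ∀ S : Finset (Eu 2), (S : Set (Eu 2)) ⊆ T → ∑ x ∈ S, W x ^ (q / p) ≤ (N0 * I1) ^ (q / p) := by
    intro S hS
    refine sum_rpow_le S W (fun x hx => (hWpos x (hTΩ (hS hx))).le) hqp1 ?_
    have h1 := overlap_int hTΩ hdpos hΩ.measurableSet hT hK S hS f hfm
    have h2 : ENNReal.ofReal (∑ x ∈ S, W x) ≤ ENNReal.ofReal (N0 * I1) := by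
      rw [ENNReal.ofReal_sum_of_nonneg (fun x hx => (hWpos x (hTΩ (hS hx))).le), ENNReal.ofReal_mul hN0pos.le]
      calc ∑ x ∈ S, ENNReal.ofReal (W x) = ∑ x ∈ S, ∫⁻ z in Gset Ω K x, f z :=
            Finset.sum_congr rfl fun x hx => ENNReal.ofReal_toReal (hGfin x (hTΩ (hS hx)))
        _ ≤ _ := h1
        _ ≤ _ := by gcongr
    exact (ENNReal.ofReal_le_ofReal_iff (by positivity)).1 h2
  have sumA : ∀ S : Finset (Eu 2), (S : Set (Eu 2)) ⊆ T →
      ∑ x ∈ S, infDist x Ωᶜ ^ 2 * |c x - c x0| ^ q ≤ C1 * (C0 ^ q * (N0 * I1) ^ (q / p)) := by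
    intro S hS
    obtain ⟨ε, hε, hεS⟩ : ∃ ε > 0, ∀ x ∈ S, ε ≤ infDist x Ωᶜ := by
      rcases S.eq_empty_or_nonempty with rfl | hne
      · exact ⟨1, one_pos, by simp⟩
      · obtain ⟨x1, hx1, hmin⟩ := S.exists_min_image (fun x => infDist x Ωᶜ) hne
        exact ⟨_, (hdpos x1).1 (hTΩ (hS hx1)), hmin⟩
    have hfin := nodes_finite hb hTΩ hT hε
    set F := hfin.toFinset with hF
    have memF : ∀ x, x ∈ F ↔ x ∈ T ∧ ε ≤ infDist x Ωᶜ := fun x => by rw [hF, Set.Finite.mem_toFinset]; rfl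
    have hFT : (F : Set (Eu 2)) ⊆ T := fun x hx => ((memF x).1 hx).1
    have hSF : S ⊆ F := fun x hx => (memF x).2 ⟨hS hx, hεS x hx⟩
    have hdF : ∀ x ∈ F, 0 < infDist x Ωᶜ := fun x hx => (hdpos x).1 (hTΩ (hFT hx))
    have tree := tree_ineq hq1 hMpos F par (fun x => infDist x Ωᶜ) (fun x => infDist x Ωᶜ ^ 2) a
      (fun x => |c x - c x0|) (fun Q P => dist Q P ≤ 2 * K * (infDist P Ωᶜ - infDist Q Ωᶜ))
      (fun Q hQ P hP => by
        obtain ⟨h1, h2, h3, h4⟩ := (hpar Q (hFT hQ)).2 P hP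
        have := hdF Q hQ
        exact ⟨(memF P).2 ⟨h1, by have := ((memF Q).1 hQ).2; linarith⟩, by linarith⟩)
      (fun Q hQ => by simp)
      (fun Q hQ P0 hP P hrel => by
        obtain ⟨h1, h2, h3, h4⟩ := (hpar Q (hFT hQ)).2 P0 hP
        have := hdF Q hQ
        have h5 := dist_triangle Q P0 P
        have h6 : (K + 1 / 5) * infDist Q Ωᶜ ≤ 2 * K * (9 / 10 * infDist Q Ωᶜ) := by nlinarith
        have h7 : 2 * K * (9 / 10 * infDist Q Ωᶜ) ≤ 2 * K * (infDist P0 Ωᶜ - infDist Q Ωᶜ) := by gcongr; linarith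
        linarith)
      (fun Q hQ P0 hP hrel => by
        obtain ⟨h1, h2, h3, h4⟩ := (hpar Q (hFT hQ)).2 P0 hP
        have := hdF Q hQ
        have h5 := dist_nonneg (x := P0) (y := Q)
        have h7 : 0 < 2 * K * (infDist P0 Ωᶜ - infDist Q Ωᶜ) := mul_pos (by positivity) (by linarith)
        linarith)
      (fun Q hQ => by positivity) (fun Q hQ => hapos Q (hTΩ (hFT hQ))) (fun Q hQ => abs_nonneg _)
      (fun Q hQ h => (hpar Q (hFT hQ)).1 h)
      (fun Q hQ P h => by
        have h1 := ((hpar Q (hFT hQ)).2 P h).2.1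
        have h2 := abs_sub_le (c Q) (c P) (c x0)
        linarith)
      (fun P hP S' hS' hrel => by
        have hdP := hdF P hP
        have := packing hT S' (fun x hx => hFT (hS' hx)) (c := P) (R := (2 * K + 1) * infDist P Ωᶜ) (by positivity) (by
          intro x hx
          have h1 := hrel x hx
          have h2 := hdF x (hS' hx)
          have h3 := dist_nonneg (x := x) (y := P)
          have h4 : 0 ≤ infDist P Ωᶜ - infDist x Ωᶜ := by
            by_contra hneg
            push Not at hneg
            have : 2 * K * (infDist P Ωᶜ - infDist x Ωᶜ) < 0 := mul_neg_of_pos_of_neg (by positivity) hneg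
            linarith
          nlinarith)
        refine this.trans (le_of_eq (by rw [hM]; ring)))
    calc ∑ x ∈ S, infDist x Ωᶜ ^ 2 * |c x - c x0| ^ q ≤ ∑ x ∈ F, infDist x Ωᶜ ^ 2 * |c x - c x0| ^ q :=
          Finset.sum_le_sum_of_subset_of_nonneg hSF fun x _ _ => by positivity
      _ ≤ _ := tree
      _ = C1 * ∑ x ∈ F, C0 ^ q * W x ^ (q / p) := by
          rw [← hC1]; congr 1
          exact Finset.sum_congr rfl fun x hx => hwa x (hTΩ (hFT hx))
      _ = C1 * (C0 ^ q * ∑ x ∈ F, W x ^ (q / p)) := by rw [← Finset.mul_sum]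
      _ ≤ _ := by gcongr; exact sumW F hFT
  refine ⟨c x0, ?_⟩
  have hqpos : 0 < q := by linarith
  have perx : ∀ x ∈ T, ∫⁻ z in closedBall x (infDist x Ωᶜ / 20), ENNReal.ofReal (|u z - c x0| ^ q) ≤
      ENNReal.ofReal (2 ^ q * (A * W x ^ (q / p) + Real.pi / 400 * (infDist x Ωᶜ ^ 2 * |c x - c x0| ^ q))) := by
    intro x hxT
    have hx := hTΩ hxT
    have hd := (hdpos x).1 hx
    have hWx := hWpos x hx
    have hsub : ∀ z ∈ ball x (2 * (infDist x Ωᶜ / 20)), 9 / 10 * infDist x Ωᶜ < infDist z Ωᶜ := by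
      intro z hz
      rw [mem_ball, dist_comm] at hz
      have := infDist_le_infDist_add_dist (s := Ωᶜ) (x := x) (y := z)
      linarith
    have h1 := loc u g N x (infDist x Ωᶜ / 20) (W x) (by positivity) hWx hN hgm hg0 (by
      intro z1 hz1 z2 hz2
      have e1 := hsub z1 hz1.1
      have e2 := hsub z2 hz2.1
      refine hH z1 ⟨(hdpos _).2 (by linarith), hz1.2⟩ z2 ⟨(hdpos _).2 (by linarith), hz2.2⟩ ?_
      have e3 := dist_triangle_right z1 z2 x
      have e4 := mem_ball.1 hz1.1
      have e5 := mem_ball.1 hz2.1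
      linarith) ((lintegral_mono_set (Gset_self hK x)).trans (hWe x hx)) (y x) (hy x hx).1 (hgW x hx x hx (hVW x hx))
    calc ∫⁻ z in closedBall x (infDist x Ωᶜ / 20), ENNReal.ofReal (|u z - c x0| ^ q)
        ≤ ∫⁻ z in closedBall x (infDist x Ωᶜ / 20), ENNReal.ofReal (2 ^ q) * (ENNReal.ofReal (|u z - u (y x)| ^ q) +
            ENNReal.ofReal (|c x - c x0| ^ q)) := by
          refine lintegral_mono fun z => ?_
          rw [← ENNReal.ofReal_add (by positivity) (by positivity), ← ENNReal.ofReal_mul (by positivity)]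
          refine ENNReal.ofReal_le_ofReal (le_trans ?_ (add_rpow_two (abs_nonneg _) (abs_nonneg _) hqpos))
          gcongr
          exact abs_sub_le _ _ _
      _ = ENNReal.ofReal (2 ^ q) * ((∫⁻ z in closedBall x (infDist x Ωᶜ / 20), ENNReal.ofReal (|u z - u (y x)| ^ q)) +
            ENNReal.ofReal (|c x - c x0| ^ q) * volume (closedBall x (infDist x Ωᶜ / 20))) := by
          rw [lintegral_const_mul' _ _ ENNReal.ofReal_ne_top, lintegral_add_right _ measurable_const, setLIntegral_const]
      _ ≤ ENNReal.ofReal (2 ^ q) * (ENNReal.ofReal (A * W x ^ (q / p)) +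
            ENNReal.ofReal (|c x - c x0| ^ q) * ENNReal.ofReal (Real.pi * (infDist x Ωᶜ / 20) ^ 2)) := by
          gcongr
          rw [← vol_cball2 x (by positivity), Measure.real, ENNReal.ofReal_toReal measure_closedBall_lt_top.ne]
      _ = _ := by
          rw [← ENNReal.ofReal_mul (by positivity), ← ENNReal.ofReal_add (by positivity) (by positivity),
            ← ENNReal.ofReal_mul (by positivity)]
          congr 1; ring
  have : Countable T := hTc
  calc ∫⁻ y in Ω, ENNReal.ofReal (|u y - c x0| ^ q)
      ≤ ∫⁻ y in ⋃ x : T, closedBall (x : Eu 2) (infDist (x : Eu 2) Ωᶜ / 20), ENNReal.ofReal (|u y - c x0| ^ q) := by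
        refine lintegral_mono_set fun z hz => ?_
        obtain ⟨x, hx, h⟩ := hcov z hz
        exact mem_iUnion.2 ⟨⟨x, hx⟩, h⟩
    _ ≤ ∑' x : T, ∫⁻ y in closedBall (x : Eu 2) (infDist (x : Eu 2) Ωᶜ / 20), ENNReal.ofReal (|u y - c x0| ^ q) :=
        lintegral_iUnion_le _ _
    _ ≤ ∑' x : T, ENNReal.ofReal (2 ^ q * (A * W x ^ (q / p) + Real.pi / 400 * (infDist (x : Eu 2) Ωᶜ ^ 2 * |c x - c x0| ^ q))) :=
        ENNReal.tsum_le_tsum fun x => perx x x.2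
    _ ≤ _ := by
        rw [ENNReal.tsum_eq_iSup_sum]
        refine iSup_le fun S => ?_
        have hnn : ∀ x : T, 0 ≤ 2 ^ q * (A * W x ^ (q / p) + Real.pi / 400 * (infDist (x : Eu 2) Ωᶜ ^ 2 * |c x - c x0| ^ q)) := by
          intro x
          have := hWpos x (hTΩ x.2)
          positivity
        rw [← ENNReal.ofReal_sum_of_nonneg (fun x _ => hnn x)]
        refine ENNReal.ofReal_le_ofReal ?_
        have hS' : ((S.map (Function.Embedding.subtype _) : Finset (Eu 2)) : Set (Eu 2)) ⊆ T := by
          intro x hx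
          simp at hx
          exact hx.1
        have e1 := sumW _ hS'
        have e2 := sumA _ hS'
        rw [Finset.sum_map] at e1 e2
        simp only [Function.Embedding.subtype_apply] at e1 e2
        rw [← Finset.mul_sum, Finset.sum_add_distrib, ← Finset.mul_sum, ← Finset.mul_sum]
        calc _ ≤ 2 ^ q * (A * (N0 * I1) ^ (q / p) + Real.pi / 400 * (C1 * (C0 ^ q * (N0 * I1) ^ (q / p)))) := by gcongr
          _ = _ := by rw [Real.mul_rpow hN0pos.le hI.le]; ring


lemma prob_avg {α : Type*} [MeasurableSpace α] (ν : Measure α) [IsProbabilityMeasure ν] (u : α → ℝ)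
    (hu : AEStronglyMeasurable u ν) {q : ℝ≥0∞} (hq : 1 ≤ q) (c : ℝ) :
    eLpNorm (fun x => u x - ∫ y, u y ∂ν) q ν ≤ 2 * eLpNorm (fun x => u x - c) q ν := by
  have hm : AEStronglyMeasurable (fun x => u x - c) ν := hu.sub aestronglyMeasurable_const
  by_cases htop : eLpNorm (fun x => u x - c) q ν = ⊤
  · rw [htop]; simp
  have hL : MemLp (fun x => u x - c) q ν := ⟨hm, lt_top_iff_ne_top.2 htop⟩
  have hint : Integrable (fun x => u x - c) ν := hL.integrable hq
  have hintu : Integrable u ν := by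
    have := hint.add (integrable_const c)
    refine this.congr (ae_of_all _ fun x => by simp)
  have e1 : ∫ y, (u y - c) ∂ν = ∫ y, u y ∂ν - c := by
    rw [integral_sub hintu (integrable_const c)]; simp
  have e2 : (fun x => u x - ∫ y, u y ∂ν) = (fun x => u x - c) - fun _ => ∫ y, (u y - c) ∂ν := by
    ext x; simp only [Pi.sub_apply, e1]; ring
  rw [e2]
  have hq0 : q ≠ 0 := by rintro rfl; simp at hq
  calc _ ≤ eLpNorm (fun x => u x - c) q ν + eLpNorm (fun _ : α => ∫ y, (u y - c) ∂ν) q ν :=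
        eLpNorm_sub_le hm aestronglyMeasurable_const hq
    _ ≤ eLpNorm (fun x => u x - c) q ν + eLpNorm (fun x => u x - c) q ν := by
        gcongr
        rw [eLpNorm_const _ hq0 (IsProbabilityMeasure.ne_zero ν)]
        simp only [measure_univ, ENNReal.one_rpow, mul_one]
        calc _ ≤ ∫⁻ y, ‖u y - c‖ₑ ∂ν := enorm_integral_le_lintegral_enorm _
          _ = eLpNorm (fun x => u x - c) 1 ν := (eLpNorm_one_eq_lintegral_enorm).symm
          _ ≤ _ := eLpNorm_le_eLpNorm_of_exponent_le hq hm
    _ = _ := (two_mul _).symm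

lemma avg_bound {α : Type*} [MeasurableSpace α] (ν : Measure α) [IsFiniteMeasure ν] (hν : ν ≠ 0) (u : α → ℝ)
    (hu : AEStronglyMeasurable u ν) {q : ℝ≥0∞} (hq : 1 ≤ q) (hqt : q ≠ ⊤) (c : ℝ) :
    eLpNorm (fun x => u x - ⨍ y, u y ∂ν) q ν ≤ 2 * eLpNorm (fun x => u x - c) q ν := by
  have : NeZero ν := ⟨hν⟩
  have hU : ν univ ≠ 0 := by simpa using hν
  have h := prob_avg ((ν univ)⁻¹ • ν) u (hu.smul_measure _) hq c
  rw [eLpNorm_smul_measure_of_ne_top hqt, eLpNorm_smul_measure_of_ne_top hqt, smul_eq_mul, smul_eq_mul,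
    mul_left_comm] at h
  have h1 : ((ν univ)⁻¹) ^ (1 / q).toReal ≠ 0 := by
    refine (ENNReal.rpow_pos (ENNReal.inv_pos.2 (measure_ne_top ν _)) (ENNReal.inv_ne_top.2 hU)).ne'
  have h2 : ((ν univ)⁻¹) ^ (1 / q).toReal ≠ ⊤ := by
    refine ENNReal.rpow_ne_top_of_nonneg ENNReal.toReal_nonneg (ENNReal.inv_ne_top.2 hU)
  exact (ENNReal.mul_le_mul_iff_right h1 h2).1 h

lemma eLpNorm_real {α : Type*} [MeasurableSpace α] (ν : Measure α) (f : α → ℝ) {q : ℝ} (hq : 0 < q) :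
    eLpNorm f (ENNReal.ofReal q) ν = (∫⁻ x, ENNReal.ofReal (|f x| ^ q) ∂ν) ^ (1 / q) := by
  rw [eLpNorm_eq_lintegral_rpow_enorm_toReal (by simpa using hq) ENNReal.ofReal_ne_top, ENNReal.toReal_ofReal hq.le]
  congr 1
  refine lintegral_congr fun x => ?_
  rw [← ENNReal.ofReal_rpow_of_nonneg (abs_nonneg _) hq.le, Real.enorm_eq_ofReal_abs]

lemma hsp_of_john {Ω : Set (Eu 2)} (hΩ : IsDomainEu Ω) (hb : Bornology.IsBounded Ω) (hJ : IsJohnDomain Ω) {s p : ℝ}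
    (hs : 0 < s) (hs1 : s ≤ 1) (hp1 : 2 / (2 + s) < p) (hp2 : p < 2 / s) : SupportsHSP Ω s p := by
  have hp : 0 < p := lt_trans (by positivity) hp1
  have hps : p * s < 2 := by rwa [lt_div_iff₀ hs] at hp2
  have h2ps : 0 < 2 - p * s := by linarith
  set q : ℝ := p * 2 / (2 - p * s) with hq
  have hq1 : 1 < q := by
    rw [div_lt_iff₀ (by positivity)] at hp1
    rw [hq, lt_div_iff₀ h2ps]; linarith
  have hqpos : 0 < q := by linarith
  obtain ⟨C, hC, core⟩ := john_core hΩ.1 hb hJ hs hs1 hp hps hq hq1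
  have hne := compl_nonempty_of_bdd hb
  have hfin : volume Ω ≠ ⊤ := hb.measure_lt_top.ne
  have : IsFiniteMeasure (volume.restrict Ω) := ⟨by simpa using hfin.lt_top⟩
  have hν : (volume.restrict Ω) ≠ 0 := by
    rw [Ne, Measure.restrict_eq_zero]
    exact (hΩ.1.measure_pos _ hΩ.2.nonempty).ne'
  set m := volume.real Ω with hm
  have hmpos : 0 < m := ENNReal.toReal_pos (hΩ.1.measure_pos _ hΩ.2.nonempty).ne' hfin
  have hme : volume Ω = ENNReal.ofReal m := (ENNReal.ofReal_toReal hfin).symm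
  set C2 : ℝ := 2 * (C ^ (1 / q) * (2 ^ p * 2) ^ (1 / p)) with hC2
  have hC2pos : 0 < C2 := by positivity
  refine ⟨C2, hC2pos, ?_⟩
  intro u hu
  have hexp : p * ((2:ℕ):ℝ) / (((2:ℕ):ℝ) - p * s) = q := by rw [hq]; norm_num
  rw [hexp]
  have main : ∀ g ∈ DBall Ω s (1/2) u, eLpNorm (fun x => u x - ⨍ y in Ω, u y) (ENNReal.ofReal q) (volume.restrict Ω) ≤
      ENNReal.ofReal C2 * eLpNorm g (ENNReal.ofReal p) (volume.restrict Ω) := by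
    rintro g ⟨hgm, hg0, N, hNΩ, hN, hH⟩
    by_cases htop : eLpNorm g (ENNReal.ofReal p) (volume.restrict Ω) = ⊤
    · rw [htop, ENNReal.mul_top (by simpa using hC2pos)]; exact le_top
    rw [eLpNorm_real _ _ hp] at htop ⊢
    have hX : ∫⁻ x in Ω, ENNReal.ofReal (|g x| ^ p) ≠ ⊤ := by
      intro h
      rw [h, ENNReal.top_rpow_of_pos (by positivity)] at htop
      exact htop rfl
    set J := (∫⁻ x in Ω, ENNReal.ofReal (|g x| ^ p)).toReal with hJdef
    have hJe : ∫⁻ x in Ω, ENNReal.ofReal (|g x| ^ p) = ENNReal.ofReal J := (ENNReal.ofReal_toReal hX).symm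
    have hJ0 : 0 ≤ J := ENNReal.toReal_nonneg
    have claim : ∀ t, J < t → eLpNorm (fun x => u x - ⨍ y in Ω, u y) (ENNReal.ofReal q) (volume.restrict Ω) ≤
        ENNReal.ofReal (C2 * t ^ (1 / p)) := by
      intro t ht
      have htpos : 0 < t := by linarith
      set η : ℝ := (t / m) ^ (1 / p) with hη
      have hηpos : 0 < η := by positivity
      have hηp : η ^ p = t / m := by
        rw [hη, ← Real.rpow_mul (by positivity), one_div_mul_cancel hp.ne', Real.rpow_one]
      obtain ⟨c0, hc0⟩ := core u (fun x => g x + η) N (2 ^ p * 2 * t) hN (hgm.add_const η)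
        (fun x => by have := hg0 x; positivity) (by positivity)
        (by
          intro y hy z hz hd
          refine (hH y hy z hz ((edist_half_iff hne y z).2 hd)).trans ?_
          gcongr <;> linarith)
        (by
          calc ∫⁻ z in Ω, ENNReal.ofReal ((g z + η) ^ p)
              ≤ ∫⁻ z in Ω, ENNReal.ofReal (2 ^ p) * (ENNReal.ofReal (|g z| ^ p) + ENNReal.ofReal (η ^ p)) := by
                refine lintegral_mono fun z => ?_
                rw [← ENNReal.ofReal_add (by positivity) (by positivity), ← ENNReal.ofReal_mul (by positivity),
                  abs_of_nonneg (hg0 z)]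
                exact ENNReal.ofReal_le_ofReal (add_rpow_two (hg0 z) hηpos.le hp)
            _ = ENNReal.ofReal (2 ^ p) * (ENNReal.ofReal J + ENNReal.ofReal (η ^ p) * ENNReal.ofReal m) := by
                rw [lintegral_const_mul' _ _ ENNReal.ofReal_ne_top, lintegral_add_right _ measurable_const, setLIntegral_const,
                  hJe, hme]
            _ ≤ _ := by
                rw [← ENNReal.ofReal_mul (by positivity), ← ENNReal.ofReal_add hJ0 (by positivity),
                  ← ENNReal.ofReal_mul (by positivity)]
                refine ENNReal.ofReal_le_ofReal ?_
                rw [hηp, div_mul_cancel₀ _ hmpos.ne', mul_assoc]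
                gcongr
                linarith)
      refine (avg_bound _ hν u hu.1.aestronglyMeasurable (by simpa using hq1.le) ENNReal.ofReal_ne_top c0).trans ?_
      rw [eLpNorm_real _ _ hqpos]
      calc _ ≤ 2 * (ENNReal.ofReal (C * (2 ^ p * 2 * t) ^ (q / p))) ^ (1 / q) := by gcongr
        _ = ENNReal.ofReal (C2 * t ^ (1 / p)) := by
          rw [ENNReal.ofReal_rpow_of_pos (by positivity), ← ENNReal.ofReal_ofNat, ← ENNReal.ofReal_mul (by norm_num)]
          congr 1
          rw [Real.mul_rpow hC.le (by positivity), ← Real.rpow_mul (by positivity),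
            show q / p * (1 / q) = 1 / p by field_simp, Real.mul_rpow (by positivity) htpos.le, hC2]
          ring
    rw [hJe, ENNReal.ofReal_rpow_of_nonneg hJ0 (by positivity), ← ENNReal.ofReal_mul hC2pos.le]
    have hcont : Continuous fun t : ℝ => ENNReal.ofReal (C2 * t ^ (1 / p)) :=
      ENNReal.continuous_ofReal.comp (continuous_const.mul (Real.continuous_rpow_const (by positivity)))
    have htend := (hcont.tendsto J).mono_left (nhdsWithin_le_nhds (s := Ioi J))
    exact ge_of_tendsto htend (by filter_upwards [self_mem_nhdsWithin] with t ht using claim t ht)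
  rw [ballNorm, ballNormRho]
  have hc0 : ENNReal.ofReal C2 ≠ 0 := by simpa using hC2pos
  rw [← ENNReal.div_le_iff' hc0 ENNReal.ofReal_ne_top]
  refine le_iInf₂ fun g hg => ?_
  rw [ENNReal.div_le_iff' hc0 ENNReal.ofReal_ne_top]
  exact main g hg

/-- For a bounded simply connected planar domain, being a John domain is
equivalent to supporting a `(2p/(2-ps), p)_s`-HSP imbedding for all (equivalently, some)
`s ∈ (0,1]` and `p ∈ (2/(2+s), 2/s)`. -/
theorem stmt7 (Ω : Set (Eu 2)) (hΩ : IsDomainEu Ω) (hbd : Bornology.IsBounded Ω)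
    (hsc : SimplyConnectedSpace Ω) :
    (IsJohnDomain Ω ↔
      ∀ s ∈ Set.Ioc (0:ℝ) 1, ∀ p : ℝ, (2 : ℝ) / (2 + s) < p → p < (2 : ℝ) / s →
        SupportsHSP Ω s p) ∧
    (IsJohnDomain Ω ↔
      ∃ s ∈ Set.Ioc (0:ℝ) 1, ∃ p : ℝ, (2 : ℝ) / (2 + s) < p ∧ p < (2 : ℝ) / s ∧
        SupportsHSP Ω s p) := by
  have ab : IsJohnDomain Ω → ∀ s ∈ Set.Ioc (0:ℝ) 1, ∀ p : ℝ, (2 : ℝ) / (2 + s) < p → p < (2 : ℝ) / s →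
        SupportsHSP Ω s p := fun hJ s hs p h1 h2 => hsp_of_john hΩ hbd hJ hs.1 hs.2 h1 h2
  have bc : (∀ s ∈ Set.Ioc (0:ℝ) 1, ∀ p : ℝ, (2 : ℝ) / (2 + s) < p → p < (2 : ℝ) / s →
        SupportsHSP Ω s p) → ∃ s ∈ Set.Ioc (0:ℝ) 1, ∃ p : ℝ, (2 : ℝ) / (2 + s) < p ∧ p < (2 : ℝ) / s ∧
        SupportsHSP Ω s p := fun h => ⟨1, by norm_num, 1, by norm_num, by norm_num, h 1 (by norm_num) 1 (by norm_num) (by norm_num)⟩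
  have ca : (∃ s ∈ Set.Ioc (0:ℝ) 1, ∃ p : ℝ, (2 : ℝ) / (2 + s) < p ∧ p < (2 : ℝ) / s ∧
        SupportsHSP Ω s p) → IsJohnDomain Ω := by
    rintro ⟨s, hs, p, h1, h2, h⟩
    have hs0 := hs.1
    have hp : 0 < p := lt_trans (by positivity) h1
    exact john_of_hsp hΩ hbd hsc hs.1 hs.2 hp h2 h
  exact ⟨⟨ab, fun h => ca (bc h)⟩, ⟨fun h => bc (ab h), ca⟩⟩
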